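/- Let d ≥ 3 and let E be the self-conformal set generated by a conformal iterated function system Φ = {φ_i}_{i=1}^ℓ on a compact set X ⊂ ℝ^d, with E not a singleton. Suppose E is contained in a (d−1)-dimensional sphere of ℝ^d but not contained in an affine hyperplane of ℝ^d. Then there exist finite words I, J over the alphabet {1, …, ℓ} such that the Minkowski sum φ_I(E) + φ_J(E) has positive thickness, where φ_I = φ_{i_1} ∘ ⋯ ∘ φ_{i_n} for I = i_1…i_n. -/

import Mathlib

open Metric Set
open scoped RealInnerProductSpace Pointwise

/-- The thickness of a compact set `E ⊆ ℝ^d`. -/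
noncomputable def thickness {d : ℕ} (E : Set (EuclideanSpace ℝ (Fin d))) : ℝ :=
  sSup {c : ℝ | c ∈ Set.Icc (0 : ℝ) 1 ∧
    ∀ x ∈ E, ∀ r : ℝ, 0 < r → r ≤ Metric.diam E →
      ∃ y : EuclideanSpace ℝ (Fin d),
        Metric.closedBall y (c * r) ⊆ convexHull ℝ (Metric.closedBall x r ∩ E)}

/-- For a finite word `I = i_1…i_n` over the alphabet of an IFS `φ`, the composition
`φ_I = φ_{i_1} ∘ ⋯ ∘ φ_{i_n}` (the identity for the empty word). -/
def compWord {α : Type*} {X : Type*} (φ : α → X → X) (I : List α) : X → X :=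
  I.foldr (fun i g => φ i ∘ g) id

open MeasureTheory Filter Topology
open scoped Convolution ContDiff

section WeakEquation

variable {F : Type*} [NormedAddCommGroup F] [InnerProductSpace ℝ F] [FiniteDimensional ℝ F]

/-- A conformal linear map is a positive multiple of a linear isometry. -/
lemma IsConformalMap.exists_eq_norm_smul [Nontrivial F] {A : F →L[ℝ] F} (hA : IsConformalMap A) :
    0 < ‖A‖ ∧ ∃ l : F ≃ₗᵢ[ℝ] F, ∀ v, A v = ‖A‖ • l v := by
  obtain ⟨c, hc, li, rfl⟩ := hA
  have hn : ‖c • li.toContinuousLinearMap‖ = |c| := by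
    rw [norm_smul, LinearIsometry.norm_toContinuousLinearMap, mul_one, Real.norm_eq_abs]
  rw [hn]
  refine ⟨abs_pos.2 hc, ?_⟩
  let l := li.toLinearIsometryEquiv rfl
  have hl : ∀ v, l v = li v := fun v => rfl
  rcases lt_or_gt_of_ne hc with h | h
  · refine ⟨l.trans (LinearIsometryEquiv.neg ℝ), fun v => ?_⟩
    simp [abs_of_neg h, hl]
  · refine ⟨l, fun v => ?_⟩
    simp [abs_of_pos h, hl]

lemma IsConformalMap.adjoint_apply [Nontrivial F] {A : F →L[ℝ] F}
    {l : F ≃ₗᵢ[ℝ] F} (hl : ∀ v, A v = ‖A‖ • l v) (e : F) :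
    ContinuousLinearMap.adjoint A e = ‖A‖ • l.symm e := by
  apply ext_inner_right ℝ
  intro v
  rw [ContinuousLinearMap.adjoint_inner_left, hl, inner_smul_right, inner_smul_left]
  congr 1
  rw [← l.inner_map_map (l.symm e) v, l.apply_symm_apply]

lemma IsConformalMap.norm_adjoint_apply [Nontrivial F] {A : F →L[ℝ] F} (hA : IsConformalMap A)
    (e : F) : ‖ContinuousLinearMap.adjoint A e‖ = ‖A‖ * ‖e‖ := by
  obtain ⟨h, l, hl⟩ := hA.exists_eq_norm_smul
  rw [IsConformalMap.adjoint_apply hl, norm_smul, l.symm.norm_map, norm_norm]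

lemma IsConformalMap.inner_map_map [Nontrivial F] {A : F →L[ℝ] F} (hA : IsConformalMap A)
    (u v : F) : ⟪A u, A v⟫ = ‖A‖ ^ 2 * ⟪u, v⟫ := by
  obtain ⟨h, l, hl⟩ := hA.exists_eq_norm_smul
  rw [hl u, hl v, inner_smul_left, inner_smul_right, l.inner_map_map]
  simp; ring

lemma IsConformalMap.abs_det [Nontrivial F] {A : F →L[ℝ] F} (hA : IsConformalMap A) :
    |A.det| = ‖A‖ ^ (Module.finrank ℝ F) := by
  obtain ⟨h, l, hl⟩ := hA.exists_eq_norm_smul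
  have : (A : F →ₗ[ℝ] F) = ‖A‖ • l.toLinearIsometry.toLinearMap := by
    ext v; simpa using hl v
  rw [ContinuousLinearMap.det, this, LinearMap.det_smul, abs_mul, ← LinearMap.normDet_eq_abs_det,
    LinearIsometry.normDet_eq_one]
  simp

variable [MeasurableSpace F] [BorelSpace F]

/-- The components of a `C¹` conformal map are `n`-harmonic in the weak sense. -/
lemma integral_conformal_eq_zero [Nontrivial F] (hd : 2 ≤ Module.finrank ℝ F) {f : F → F}
    (hf : ContDiff ℝ 1 f) {s : Set F} (hs : IsOpen s) (hinj : InjOn f s)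
    (hconf : ∀ x ∈ s, IsConformalMap (fderiv ℝ f x)) {ζ : F → ℝ} (hζ : ContDiff ℝ 1 ζ)
    (hζc : HasCompactSupport ζ) (hζs : tsupport ζ ⊆ s) (e : F) :
    ∫ x, ‖fderiv ℝ f x‖ ^ (Module.finrank ℝ F - 2) *
      fderiv ℝ ζ x (ContinuousLinearMap.adjoint (fderiv ℝ f x) e) = 0 := by
  classical
  set n := Module.finrank ℝ F with hn
  -- the derivative as a continuous linear equivalence
  have hequiv : ∀ x ∈ s, ∃ A : F ≃L[ℝ] F, (A : F →L[ℝ] F) = fderiv ℝ f x ∧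
      A.symm e = (‖fderiv ℝ f x‖ ^ 2)⁻¹ • ContinuousLinearMap.adjoint (fderiv ℝ f x) e := by
    intro x hx
    obtain ⟨h, l, hl⟩ := (hconf x hx).exists_eq_norm_smul
    let A : F ≃L[ℝ] F := l.toContinuousLinearEquiv.trans
      (ContinuousLinearEquiv.smulLeft (Units.mk0 _ h.ne'))
    have hA : ∀ v, A v = fderiv ℝ f x v := fun v => by rw [hl]; rfl
    refine ⟨A, by ext v; exact hA v, ?_⟩
    rw [A.symm_apply_eq, IsConformalMap.adjoint_apply hl, hA, hl]
    simp only [map_smul, l.apply_symm_apply, smul_smul]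
    field_simp
    simp
  let g := Function.invFunOn f s
  have hg : ∀ x ∈ s, g (f x) = x := fun x hx => hinj.leftInvOn_invFunOn hx
  have hgnhds : ∀ x ∈ s, ∀ᶠ y in 𝓝 x, g (f y) = y := fun x hx =>
    Filter.eventually_of_mem (hs.mem_nhds hx) hg
  have hopen : ∀ x ∈ s, f '' s ∈ 𝓝 (f x) := by
    intro x hx
    obtain ⟨A, hA, -⟩ := hequiv x hx
    have h1 : HasStrictFDerivAt f (A : F →L[ℝ] F) x := by
      rw [hA]; exact hf.hasStrictFDerivAt one_ne_zero
    rw [← h1.map_nhds_eq_of_equiv]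
    exact image_mem_map (hs.mem_nhds hx)
  let ψ : F → ℝ := (f '' s).indicator (ζ ∘ g)
  let ψ' : F → ℝ := (f '' s).indicator (fun y => fderiv ℝ ζ (g y)
    ((‖fderiv ℝ f (g y)‖ ^ 2)⁻¹ • ContinuousLinearMap.adjoint (fderiv ℝ f (g y)) e))
  have hψ : ∀ y, HasLineDerivAt ℝ ψ (ψ' y) y e := by
    intro y
    by_cases hy : y ∈ f '' s
    · obtain ⟨x, hx, rfl⟩ := hy
      obtain ⟨A, hA, hAe⟩ := hequiv x hx
      have h1 : HasStrictFDerivAt f (A : F →L[ℝ] F) x := by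
        rw [hA]; exact hf.hasStrictFDerivAt one_ne_zero
      have h2 := (h1.to_local_left_inverse (hgnhds x hx)).hasFDerivAt
      have h3 : HasFDerivAt ζ (fderiv ℝ ζ x) (g (f x)) := by
        rw [hg x hx]; exact (hζ.differentiable one_ne_zero x).hasFDerivAt
      have h4 := h3.comp _ h2
      have h5 : ψ =ᶠ[𝓝 (f x)] ζ ∘ g := by
        filter_upwards [hopen x hx] with z hz
        exact indicator_of_mem hz _
      have h6 := (h4.congr_of_eventuallyEq h5).hasLineDerivAt e
      convert! h6 using 1
      simp only [ψ']
      rw [indicator_of_mem (mem_image_of_mem f hx)]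
      simp [hg x hx, hAe]
    · have hK : IsClosed (f '' tsupport ζ) := (hζc.isCompact.image hf.continuous).isClosed
      have h1 : (f '' tsupport ζ)ᶜ ∈ 𝓝 y :=
        hK.isOpen_compl.mem_nhds (fun h => hy (image_mono hζs h))
      have h5 : ψ =ᶠ[𝓝 y] fun _ => 0 := by
        filter_upwards [h1] with z hz
        by_cases hzs : z ∈ f '' s
        · obtain ⟨x, hx, rfl⟩ := hzs
          simp only [ψ]
          rw [indicator_of_mem (mem_image_of_mem f hx)]
          simp only [Function.comp, hg x hx]
          exact image_eq_zero_of_notMem_tsupport (fun h => hz ⟨x, h, rfl⟩)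
        · exact indicator_of_notMem hzs _
      have h6 := ((hasFDerivAt_const (𝕜 := ℝ) (0 : ℝ) y).congr_of_eventuallyEq h5).hasLineDerivAt e
      convert! h6 using 1
      simp [ψ', indicator_of_notMem hy]
  have hfd : ∀ x ∈ s, HasFDerivWithinAt f (fderiv ℝ f x) s x := fun x _ =>
    (hf.differentiable one_ne_zero x).hasFDerivAt.hasFDerivWithinAt
  have hmeas : MeasurableSet (f '' s) := by
    have : IsOpen (f '' s) := isOpen_iff_mem_nhds.2 (by rintro _ ⟨x, hx, rfl⟩; exact hopen x hx)
    exact this.measurableSet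
  have cdf : Continuous (fderiv ℝ f) := hf.continuous_fderiv one_ne_zero
  have cdζ : Continuous (fderiv ℝ ζ) := hζ.continuous_fderiv one_ne_zero
  have cadj : Continuous (fun x => ContinuousLinearMap.adjoint (fderiv ℝ f x) e) := by
    have := (ContinuousLinearMap.adjoint (𝕜 := ℝ) (E := F) (F := F)).continuous.comp cdf
    exact this.clm_apply continuous_const
  have key : ∀ x ∈ s, |(fderiv ℝ f x).det| • ψ' (f x) = ‖fderiv ℝ f x‖ ^ (n - 2) *
      fderiv ℝ ζ x (ContinuousLinearMap.adjoint (fderiv ℝ f x) e) := by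
    intro x hx
    simp only [ψ']
    rw [indicator_of_mem (mem_image_of_mem f hx), (hconf x hx).abs_det, hg x hx, map_smul, smul_eq_mul,
      smul_eq_mul, ← hn]
    have h := (hconf x hx).exists_eq_norm_smul.1
    obtain ⟨m, hm⟩ := Nat.exists_eq_add_of_le hd
    have h2 : n = m + 2 := by omega
    rw [h2, Nat.add_sub_cancel]
    field_simp
    ring
  have hintegrable : Integrable (fun x => ‖fderiv ℝ f x‖ ^ (n - 2) *
      fderiv ℝ ζ x (ContinuousLinearMap.adjoint (fderiv ℝ f x) e)) := by
    apply Continuous.integrable_of_hasCompactSupport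
    · exact (cdf.norm.pow _).mul (cdζ.clm_apply cadj)
    · apply HasCompactSupport.mul_left
      apply (hζc.fderiv ℝ).mono
      intro x hx h
      apply hx
      simp [h]
  have hψ'int : Integrable ψ' := by
    rw [integrable_indicator_iff hmeas,
      integrableOn_image_iff_integrableOn_abs_det_fderiv_smul volume hs.measurableSet hfd hinj]
    refine (hintegrable.integrableOn (s := s)).congr_fun (fun x hx => ?_) hs.measurableSet
    beta_reduce
    rw [← key x hx]
    simp only [ψ']
    rw [indicator_of_mem (mem_image_of_mem f hx)]
  have hψint : Integrable ψ := by
    rw [integrable_indicator_iff hmeas,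
      integrableOn_image_iff_integrableOn_abs_det_fderiv_smul volume hs.measurableSet hfd hinj]
    have : Integrable (fun x => |(fderiv ℝ f x).det| * ζ x) := by
      apply Continuous.integrable_of_hasCompactSupport
      · exact ((ContinuousLinearMap.continuous_det.comp cdf).abs).mul hζ.continuous
      · exact hζc.mul_left
    refine (this.integrableOn (s := s)).congr_fun (fun x hx => ?_) hs.measurableSet
    simp [hg x hx]
  have h0 : ∫ y, ψ' y = 0 := by
    have := integral_bilinear_hasLineDerivAt_right_eq_neg_left_of_integrable (μ := volume)
      (B := ContinuousLinearMap.mul ℝ ℝ) (f := fun _ : F => (1 : ℝ)) (f' := fun _ => 0) (g := ψ)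
      (g' := ψ') (v := e) (by simp) (by simpa using hψ'int) (by simpa using hψint)
      (fun x _ => by simpa using (hasFDerivAt_const (1 : ℝ) x).hasLineDerivAt e) (fun x _ => hψ x)
    simpa using this
  rw [integral_indicator hmeas] at h0
  have h1 : ∫ y in f '' s, ψ' y = 0 := by
    rw [← h0]
    apply setIntegral_congr_fun hmeas
    intro y hy
    simp only [ψ']
    rw [indicator_of_mem hy]
  rw [integral_image_eq_integral_abs_det_fderiv_smul volume hs.measurableSet hfd hinj,
    setIntegral_congr_fun hs.measurableSet key] at h1
  rw [← h1, setIntegral_eq_integral_of_forall_compl_eq_zero]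
  intro x hx
  have : fderiv ℝ ζ x = 0 := by
    have h2 : x ∉ tsupport (fderiv ℝ ζ) := fun h => hx (hζs (tsupport_fderiv_subset ℝ h))
    exact image_eq_zero_of_notMem_tsupport h2
  simp [this]

end WeakEquation

section Energy

variable {F : Type*} [NormedAddCommGroup F] [InnerProductSpace ℝ F]

/-- Strong monotonicity of the vector field `p ↦ ‖p‖ ^ k • p`. -/
lemma inner_norm_pow_smul_sub_ge (k : ℕ) (p q : F) :
    (‖q‖ ^ k + ‖p‖ ^ k) / 2 * ‖q - p‖ ^ 2 ≤ ⟪‖q‖ ^ k • q - ‖p‖ ^ k • p, q - p⟫ := by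
  have h1 : ‖q - p‖ ^ 2 = ‖q‖ ^ 2 - 2 * ⟪q, p⟫ + ‖p‖ ^ 2 := norm_sub_sq_real q p
  have h2 : ⟪‖q‖ ^ k • q - ‖p‖ ^ k • p, q - p⟫ = ‖q‖ ^ k * ‖q‖ ^ 2
      - (‖q‖ ^ k + ‖p‖ ^ k) * ⟪q, p⟫ + ‖p‖ ^ k * ‖p‖ ^ 2 := by
    simp only [inner_sub_left, inner_sub_right, real_inner_smul_left, real_inner_self_eq_norm_sq,
      real_inner_comm q p]
    ring
  have h3 : 0 ≤ (‖q‖ ^ k - ‖p‖ ^ k) * (‖q‖ ^ 2 - ‖p‖ ^ 2) := by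
    rcases le_total ‖p‖ ‖q‖ with h | h
    · exact mul_nonneg (sub_nonneg.2 (by gcongr)) (sub_nonneg.2 (by gcongr))
    · exact mul_nonneg_of_nonpos_of_nonpos (sub_nonpos.2 (by gcongr)) (sub_nonpos.2 (by gcongr))
  rw [h1, h2]
  linarith

lemma norm_norm_pow_smul_sub_le (k : ℕ) {M : ℝ} {p q : F} (hp : ‖p‖ ≤ M) (hq : ‖q‖ ≤ M) :
    ‖‖q‖ ^ k • q - ‖p‖ ^ k • p‖ ≤ (M ^ k + k * M ^ (k - 1) * M) * ‖q - p‖ := by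
  have hM : 0 ≤ M := (norm_nonneg p).trans hp
  have h1 : ‖q‖ ^ k • q - ‖p‖ ^ k • p = ‖q‖ ^ k • (q - p) + (‖q‖ ^ k - ‖p‖ ^ k) • p := by
    simp only [smul_sub, sub_smul]; abel
  have h2 : |‖q‖ ^ k - ‖p‖ ^ k| ≤ ‖q - p‖ * k * M ^ (k - 1) := by
    refine (abs_pow_sub_pow_le _ _ _).trans ?_
    rw [abs_norm, abs_norm]
    gcongr
    · exact abs_norm_sub_norm_le q p
    · exact max_le hq hp
  calc ‖‖q‖ ^ k • q - ‖p‖ ^ k • p‖ ≤ ‖q‖ ^ k * ‖q - p‖ + |‖q‖ ^ k - ‖p‖ ^ k| * ‖p‖ := by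
        rw [h1]
        refine (norm_add_le _ _).trans ?_
        rw [norm_smul, norm_smul, Real.norm_eq_abs, Real.norm_eq_abs, abs_of_nonneg (by positivity)]
    _ ≤ M ^ k * ‖q - p‖ + (‖q - p‖ * k * M ^ (k - 1)) * M := by gcongr
    _ = _ := by ring

variable [FiniteDimensional ℝ F] [MeasurableSpace F] [BorelSpace F]

/-- Caccioppoli-type estimate for difference quotients of the derivative of a conformal map. -/
lemma exists_integral_adjoint_fderiv_sub_le [Nontrivial F] (hd : 2 ≤ Module.finrank ℝ F) {f : F → F}
    (hf : ContDiff ℝ 1 f) {s : Set F} (hs : IsOpen s) (hinj : InjOn f s)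
    (hconf : ∀ x ∈ s, IsConformalMap (fderiv ℝ f x)) {m M L : ℝ} (hm : 0 < m)
    (hmf : ∀ x ∈ s, m ≤ ‖fderiv ℝ f x‖) (hMf : ∀ x ∈ s, ‖fderiv ℝ f x‖ ≤ M)
    (hL : ∀ x y, ‖f x - f y‖ ≤ L * ‖x - y‖)
    {η : F → ℝ} (hη : ContDiff ℝ 1 η) (hηc : HasCompactSupport η) {r : ℝ}
    (hηs : ∀ x ∈ tsupport η, ∀ h, ‖h‖ ≤ r → x + h ∈ s) :
    ∃ C, ∀ e : F, ‖e‖ = 1 → ∀ h : F, ‖h‖ ≤ r →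
      ∫ x, η x ^ 2 * ‖ContinuousLinearMap.adjoint (fderiv ℝ f (x + h)) e
        - ContinuousLinearMap.adjoint (fderiv ℝ f x) e‖ ^ 2 ≤ C * ‖h‖ ^ 2 := by
  classical
  set k := Module.finrank ℝ F - 2 with hk
  obtain ⟨N, hN⟩ := (hη.continuous_fderiv one_ne_zero).bounded_above_of_compact_support
    (hηc.fderiv ℝ)
  set C₁ := M ^ k + k * M ^ (k - 1) * M with hC₁
  refine ⟨2 / m ^ k * (2 * N ^ 2 * C₁ ^ 2 * L ^ 2 / m ^ k * volume.real (tsupport η)), ?_⟩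
  intro e he h hh
  set G : F → F := fun x => ContinuousLinearMap.adjoint (fderiv ℝ f x) e with hG
  have cdf : Continuous (fderiv ℝ f) := hf.continuous_fderiv one_ne_zero
  have cG : Continuous G := by
    have := (ContinuousLinearMap.adjoint (𝕜 := ℝ) (E := F) (F := F)).continuous.comp cdf
    exact this.clm_apply continuous_const
  set u : F → ℝ := fun x => ⟪e, f x⟫ with hu
  have hu1 : ContDiff ℝ 1 u := contDiff_const.inner ℝ hf
  have hud : ∀ x, HasFDerivAt u (innerSL ℝ (G x)) x := by
    intro x
    have h1 := (innerSL ℝ e).hasFDerivAt.comp x (hf.differentiable one_ne_zero x).hasFDerivAt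
    convert! h1 using 1
    ext v
    simp [hG, ContinuousLinearMap.adjoint_inner_left]
  set ζ : F → ℝ := fun x => η x ^ 2 * (u (x + h) - u x) with hζdef
  have hζ : ContDiff ℝ 1 ζ :=
    (hη.pow 2).mul ((hu1.comp (contDiff_id.add contDiff_const)).sub hu1)
  have hζsub : Function.support ζ ⊆ Function.support η := by
    intro x hx h0; apply hx; simp [hζdef, h0]
  have hζt : tsupport ζ ⊆ tsupport η := closure_mono hζsub
  have hζc : HasCompactSupport ζ := hηc.mono hζsub
  have hr : 0 ≤ r := (norm_nonneg h).trans hh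
  have hts : ∀ x ∈ tsupport η, x ∈ s := fun x hx => by simpa using hηs x hx 0 (by simpa using hr)
  have hζd : ∀ x v, fderiv ℝ ζ x v = 2 * η x * (fderiv ℝ η x v) * (u (x + h) - u x)
      + η x ^ 2 * ⟪G (x + h) - G x, v⟫ := by
    intro x v
    have h1 : HasFDerivAt (fun x => u (x + h)) (innerSL ℝ (G (x + h))) x := by
      exact (hasFDerivAt_comp_add_right h).2 (hud (x + h))
    have h2 := ((hη.differentiable one_ne_zero x).hasFDerivAt.pow 2).mul (h1.sub (hud x))
    have h3 : fderiv ℝ ζ x = _ := h2.fderiv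
    rw [h3]
    simp [inner_sub_left]
    ring
  have e1 : ∫ x, ‖fderiv ℝ f x‖ ^ k * fderiv ℝ ζ x (G x) = 0 :=
    integral_conformal_eq_zero hd hf hs hinj hconf hζ hζc (fun x hx => hts x (hζt hx)) e
  have e2 : ∫ x, ‖fderiv ℝ f (x + h)‖ ^ k * fderiv ℝ ζ x (G (x + h)) = 0 := by
    have hz : ContDiff ℝ 1 (fun x => ζ (x - h)) := hζ.comp (contDiff_id.sub contDiff_const)
    have hzt : tsupport (fun x => ζ (x - h)) ⊆ (fun x => x - h) ⁻¹' tsupport ζ := 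
      tsupport_comp_subset_preimage ζ (by fun_prop)
    have hzc : HasCompactSupport (fun x => ζ (x - h)) := 
      hζc.comp_homeomorph (Homeomorph.subRight h)
    have := integral_conformal_eq_zero hd hf hs hinj hconf hz hzc (fun x hx => by
      have := hηs _ (hζt (hzt hx)) h hh
      simpa using this) e
    rw [← integral_add_right_eq_self _ h] at this
    rw [← this]
    congr 1 with x
    rw [fderiv_comp_sub]
    simp [hG, hk]
  have cdζ : Continuous (fderiv ℝ ζ) := hζ.continuous_fderiv one_ne_zero
  have i1 : Integrable (fun x => ‖fderiv ℝ f x‖ ^ k * fderiv ℝ ζ x (G x)) := by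
    apply Continuous.integrable_of_hasCompactSupport
    · exact (cdf.norm.pow _).mul (cdζ.clm_apply cG)
    · apply HasCompactSupport.mul_left
      apply (hζc.fderiv ℝ).mono
      intro x hx h
      apply hx
      simp [h]
  have csh : Continuous (fun x : F => x + h) := by fun_prop
  have i2 : Integrable (fun x => ‖fderiv ℝ f (x + h)‖ ^ k * fderiv ℝ ζ x (G (x + h))) := by
    apply Continuous.integrable_of_hasCompactSupport
    · exact ((cdf.comp csh).norm.pow _).mul (cdζ.clm_apply (cG.comp csh))
    · apply HasCompactSupport.mul_left
      apply (hζc.fderiv ℝ).mono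
      intro x hx h
      apply hx
      simp [h]
  have e3 : ∫ x, (‖fderiv ℝ f (x + h)‖ ^ k * fderiv ℝ ζ x (G (x + h))
      - ‖fderiv ℝ f x‖ ^ k * fderiv ℝ ζ x (G x)) = 0 := by
    rw [integral_sub i2 i1, e1, e2, sub_zero]
  set B : ℝ := 2 * N ^ 2 * C₁ ^ 2 * L ^ 2 / m ^ k * ‖h‖ ^ 2 with hB
  have hmk : 0 < m ^ k := by positivity
  have hGn : ∀ x ∈ s, ‖G x‖ = ‖fderiv ℝ f x‖ := fun x hx => by
    rw [hG]; simp only; rw [(hconf x hx).norm_adjoint_apply, he, mul_one]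
  have hpt : ∀ x, m ^ k / 2 * (η x ^ 2 * ‖G (x + h) - G x‖ ^ 2)
      - (tsupport η).indicator (fun _ => B) x ≤
      ‖fderiv ℝ f (x + h)‖ ^ k * fderiv ℝ ζ x (G (x + h))
      - ‖fderiv ℝ f x‖ ^ k * fderiv ℝ ζ x (G x) := by
    intro x
    by_cases hx : x ∈ tsupport η
    · rw [indicator_of_mem hx]
      have hx0 := hts x hx
      have hx1 := hηs x hx h hh
      rw [← hGn x hx0, ← hGn _ hx1]
      set p := G x with hp
      set q := G (x + h) with hq
      have hp1 : ‖p‖ ≤ M := (hGn x hx0).le.trans (hMf x hx0)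
      have hq1 : ‖q‖ ≤ M := (hGn _ hx1).le.trans (hMf _ hx1)
      have hp2 : m ≤ ‖p‖ := (hmf x hx0).trans (hGn x hx0).ge
      have hq2 : m ≤ ‖q‖ := (hmf _ hx1).trans (hGn _ hx1).ge
      have a1 := inner_norm_pow_smul_sub_ge k p q
      have a2 := norm_norm_pow_smul_sub_le k hp1 hq1
      rw [← hC₁] at a2
      set a := ‖q‖ ^ k • q - ‖p‖ ^ k • p with ha
      have a3 : ‖q‖ ^ k * fderiv ℝ ζ x q - ‖p‖ ^ k * fderiv ℝ ζ x p = fderiv ℝ ζ x a := by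
        simp [ha]
      rw [a3, hζd, real_inner_comm]
      set D := ‖q - p‖ with hD
      have b1 : m ^ k * D ^ 2 ≤ ⟪a, q - p⟫ := by
        refine le_trans ?_ a1
        have : m ^ k ≤ ‖q‖ ^ k := by gcongr
        have : m ^ k ≤ ‖p‖ ^ k := by gcongr
        gcongr
        linarith
      have b2 : |u (x + h) - u x| ≤ L * ‖h‖ := by
        have : u (x + h) - u x = ⟪e, f (x + h) - f x⟫ := by simp [hu, inner_sub_right]
        rw [this]
        refine (abs_real_inner_le_norm _ _).trans ?_
        rw [he, one_mul]
        simpa using hL (x + h) x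
      have b3 : |fderiv ℝ η x a| ≤ N * (C₁ * D) := by
        refine ((fderiv ℝ η x).le_opNorm a).trans ?_
        have : 0 ≤ N := (norm_nonneg _).trans (hN x)
        gcongr
        exact hN x
      have b4 : |2 * η x * fderiv ℝ η x a * (u (x + h) - u x)| ≤
          2 * |η x| * (N * (C₁ * D)) * (L * ‖h‖) := by
        rw [abs_mul, abs_mul, abs_mul, abs_two]
        have : 0 ≤ N * (C₁ * D) := (abs_nonneg _).trans b3
        gcongr
      have b5 := neg_le_of_abs_le b4
      have b6 : η x ^ 2 * (m ^ k * D ^ 2) ≤ η x ^ 2 * ⟪a, q - p⟫ := by gcongr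
      have b7 : 2 * |η x| * (N * (C₁ * D)) * (L * ‖h‖) ≤ m ^ k / 2 * (η x ^ 2 * D ^ 2) + B := by
        have : 0 ≤ m ^ k / 2 * (|η x| * D - 2 * N * C₁ * L * ‖h‖ / m ^ k) ^ 2 := by positivity
        have h2 : m ^ k / 2 * (|η x| * D - 2 * N * C₁ * L * ‖h‖ / m ^ k) ^ 2 =
          m ^ k / 2 * (|η x| ^ 2 * D ^ 2) + B - 2 * |η x| * (N * (C₁ * D)) * (L * ‖h‖) := by
          rw [hB]; field_simp; ring
        rw [sq_abs] at h2
        linarith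
      linarith
    · rw [indicator_of_notMem hx]
      have h0 : η x = 0 := image_eq_zero_of_notMem_tsupport hx
      simp [hζd, h0]
  have i3 : Integrable (fun x => η x ^ 2 * ‖G (x + h) - G x‖ ^ 2) := by
    apply Continuous.integrable_of_hasCompactSupport
    · exact (hη.continuous.pow 2).mul (((cG.comp csh).sub cG).norm.pow 2)
    · apply HasCompactSupport.mul_right
      exact hηc.mono (fun x hx h => hx (by simp [h]))
  have i4 : Integrable ((tsupport η).indicator (fun _ => B)) := by
    rw [integrable_indicator_iff (isClosed_tsupport η).measurableSet]
    exact integrableOn_const hηc.isCompact.measure_lt_top.ne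
  have := integral_mono ((i3.const_mul (m ^ k / 2)).sub i4) (i2.sub i1) hpt
  simp only [Pi.sub_apply] at this
  rw [e3, integral_sub (i3.const_mul _) i4, integral_const_mul,
    integral_indicator (isClosed_tsupport η).measurableSet, setIntegral_const, smul_eq_mul] at this
  have h5 : ∫ x, η x ^ 2 * ‖G (x + h) - G x‖ ^ 2 ≤ 2 / m ^ k * (volume.real (tsupport η) * B) := by
    rw [div_mul_eq_mul_div, le_div_iff₀ hmk]
    linarith
  refine h5.trans (le_of_eq ?_)
  rw [hB]; ring

/-- The derivative of a conformal map has difference quotients bounded in `L²`. -/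
lemma exists_integral_fderiv_sub_le [Nontrivial F] (hd : 2 ≤ Module.finrank ℝ F) {f : F → F}
    (hf : ContDiff ℝ 1 f) {s : Set F} (hs : IsOpen s) (hinj : InjOn f s)
    (hconf : ∀ x ∈ s, IsConformalMap (fderiv ℝ f x)) {m M L : ℝ} (hm : 0 < m)
    (hmf : ∀ x ∈ s, m ≤ ‖fderiv ℝ f x‖) (hMf : ∀ x ∈ s, ‖fderiv ℝ f x‖ ≤ M)
    (hL : ∀ x y, ‖f x - f y‖ ≤ L * ‖x - y‖)
    {η : F → ℝ} (hη : ContDiff ℝ 1 η) (hηc : HasCompactSupport η) {r : ℝ}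
    (hηs : ∀ x ∈ tsupport η, ∀ h, ‖h‖ ≤ r → x + h ∈ s) :
    ∃ C, ∀ v : F, ‖v‖ = 1 → ∀ h : F, ‖h‖ ≤ r →
      ∫ x, η x ^ 2 * ‖fderiv ℝ f (x + h) v - fderiv ℝ f x v‖ ^ 2 ≤ C * ‖h‖ ^ 2 := by
  obtain ⟨C, hC⟩ := exists_integral_adjoint_fderiv_sub_le hd hf hs hinj hconf hm hmf hMf hL hη hηc
    hηs
  let b := stdOrthonormalBasis ℝ F
  refine ⟨∑ _i : Fin (Module.finrank ℝ F), C, fun v hv h hh => ?_⟩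
  have cdf : Continuous (fderiv ℝ f) := hf.continuous_fderiv one_ne_zero
  have cG : ∀ e, Continuous fun x => ContinuousLinearMap.adjoint (fderiv ℝ f x) e := fun e => by
    have := (ContinuousLinearMap.adjoint (𝕜 := ℝ) (E := F) (F := F)).continuous.comp cdf
    exact this.clm_apply continuous_const
  have csh : Continuous (fun x : F => x + h) := by fun_prop
  have hηc2 : HasCompactSupport (fun x => η x ^ 2) := hηc.mono (fun x hx h => hx (by simp [h]))
  have hi : ∀ e, Integrable (fun x => η x ^ 2 *
      ‖ContinuousLinearMap.adjoint (fderiv ℝ f (x + h)) e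
        - ContinuousLinearMap.adjoint (fderiv ℝ f x) e‖ ^ 2) := fun e => by
    apply Continuous.integrable_of_hasCompactSupport
    · exact (hη.continuous.pow 2).mul ((((cG e).comp csh).sub (cG e)).norm.pow 2)
    · exact hηc2.mul_right
  rw [Finset.sum_mul]
  refine le_trans ?_ (Finset.sum_le_sum fun i _ => hC (b i) (b.norm_eq_one i) h hh)
  rw [← integral_finsetSum _ fun i _ => hi (b i)]
  refine integral_mono ?_ (integrable_finsetSum _ fun i _ => hi (b i)) fun x => ?_
  · apply Continuous.integrable_of_hasCompactSupport
    · exact (hη.continuous.pow 2).mul ((((cdf.comp csh).clm_apply continuous_const).sub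
        (cdf.clm_apply continuous_const)).norm.pow 2)
    · exact hηc2.mul_right
  · simp only
    rw [← Finset.mul_sum, ← b.sum_sq_norm_inner_right]
    gcongr with i
    have : ⟪b i, fderiv ℝ f (x + h) v - fderiv ℝ f x v⟫ =
        ⟪ContinuousLinearMap.adjoint (fderiv ℝ f (x + h)) (b i)
        - ContinuousLinearMap.adjoint (fderiv ℝ f x) (b i), v⟫ := by
      simp [inner_sub_right, inner_sub_left, ContinuousLinearMap.adjoint_inner_left]
    rw [this]
    simpa [hv] using norm_inner_le_norm (𝕜 := ℝ) (ContinuousLinearMap.adjoint (fderiv ℝ f (x + h)) (b i)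
        - ContinuousLinearMap.adjoint (fderiv ℝ f x) (b i)) v

end Energy

/-- The derivative of `g` in the direction `v`. -/
noncomputable def dirDeriv {F E : Type*} [NormedAddCommGroup F] [NormedSpace ℝ F]
    [NormedAddCommGroup E] [NormedSpace ℝ E] (v : F) (g : F → E) : F → E :=
  fun x => fderiv ℝ g x v

section Mollify

variable {F : Type*} [NormedAddCommGroup F] [InnerProductSpace ℝ F]
  [FiniteDimensional ℝ F] [MeasurableSpace F] [BorelSpace F]

/-- Jensen's inequality for the square of the norm and a weight of total mass one. -/
lemma norm_sq_integral_smul_le {ρ : F → ℝ} (hρ : Continuous ρ) (hρc : HasCompactSupport ρ)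
    (hρ0 : ∀ x, 0 ≤ ρ x) (hρ1 : ∫ x, ρ x = 1) {h : F → F} (hh : Continuous h) :
    ‖∫ y, ρ y • h y‖ ^ 2 ≤ ∫ y, ρ y * ‖h y‖ ^ 2 := by
  set c := ∫ y, ρ y • h y with hc
  have i1 : Integrable (fun y => ρ y * ‖h y‖ ^ 2) :=
    (hρ.mul (hh.norm.pow 2)).integrable_of_hasCompactSupport hρc.mul_right
  have i2 : Integrable (fun y => ρ y • h y) :=
    (hρ.smul hh).integrable_of_hasCompactSupport hρc.smul_right
  have i3 : Integrable ρ := hρ.integrable_of_hasCompactSupport hρc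
  have i4 : Integrable (fun y => ⟪c, ρ y • h y⟫) := i2.const_inner c
  have h1 : 0 ≤ ∫ y, ρ y * ‖h y - c‖ ^ 2 :=
    integral_nonneg fun y => mul_nonneg (hρ0 y) (by positivity)
  have h2 : ∀ y, ρ y * ‖h y - c‖ ^ 2 = ρ y * ‖h y‖ ^ 2 - 2 * ⟪c, ρ y • h y⟫ + ρ y * ‖c‖ ^ 2 := by
    intro y
    rw [norm_sub_sq_real, inner_smul_right, real_inner_comm]
    ring
  simp_rw [h2] at h1
  have i5 : Integrable (fun y => ρ y * ‖h y‖ ^ 2 - 2 * ⟪c, ρ y • h y⟫) := i1.sub (i4.const_mul 2)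
  rw [integral_add i5 (i3.mul_const _), integral_sub i1 (i4.const_mul 2),
    integral_const_mul, integral_mul_const, integral_inner i2, hρ1, ← hc,
    real_inner_self_eq_norm_sq] at h1
  linarith

lemma integral_mul_norm_sq_convolution_le {ρ η₂ θ : F → ℝ} (hρ : Continuous ρ)
    (hρc : HasCompactSupport ρ) (hρ0 : ∀ x, 0 ≤ ρ x) (hρ1 : ∫ x, ρ x = 1)
    (hη : Continuous η₂) (hηc : HasCompactSupport η₂) (hη0 : ∀ x, 0 ≤ η₂ x)
    (hθ : Continuous θ) (hθc : HasCompactSupport θ)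
    (hle : ∀ x y, ρ y ≠ 0 → η₂ (x + y) ≤ θ x) {h : F → F} (hh : Continuous h) :
    ∫ x, η₂ x * ‖∫ y, ρ y • h (x - y)‖ ^ 2 ≤ ∫ x, θ x * ‖h x‖ ^ 2 := by
  have cK : Continuous (Function.uncurry fun x y : F => η₂ x * (ρ y * ‖h (x - y)‖ ^ 2)) := by
    unfold Function.uncurry
    fun_prop
  have sK : HasCompactSupport (Function.uncurry fun x y : F => η₂ x * (ρ y * ‖h (x - y)‖ ^ 2)) := by
    apply HasCompactSupport.intro (hηc.isCompact.prod hρc.isCompact)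
    rintro ⟨x, y⟩ hxy
    simp only [Function.uncurry, mul_eq_zero]
    by_contra! hcon
    exact hxy ⟨subset_tsupport _ hcon.1, subset_tsupport _ hcon.2.1⟩
  have i0 : ∫ x, η₂ x * ‖∫ y, ρ y • h (x - y)‖ ^ 2 ≤
      ∫ x, ∫ y, η₂ x * (ρ y * ‖h (x - y)‖ ^ 2) := by
    have hintegrable : Integrable (fun x => ∫ y, η₂ x * (ρ y * ‖h (x - y)‖ ^ 2)) :=
      (cK.integrable_of_hasCompactSupport sK).integral_prod_left
    have hpt : ∀ x, η₂ x * ‖∫ y, ρ y • h (x - y)‖ ^ 2 ≤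
        ∫ y, η₂ x * (ρ y * ‖h (x - y)‖ ^ 2) := by
      intro x
      rw [integral_const_mul]
      exact mul_le_mul_of_nonneg_left (norm_sq_integral_smul_le hρ hρc hρ0 hρ1
        (h := fun y => h (x - y)) (by fun_prop)) (hη0 x)
    exact integral_mono_of_nonneg (Eventually.of_forall fun x =>
      mul_nonneg (hη0 x) (by positivity)) hintegrable (Eventually.of_forall hpt)
  refine i0.trans ?_
  rw [integral_integral_swap_of_hasCompactSupport cK sK]
  have hθi : Integrable (fun x => θ x * ‖h x‖ ^ 2) :=
    (hθ.mul (hh.norm.pow 2)).integrable_of_hasCompactSupport hθc.mul_right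
  have hρi : Integrable ρ := hρ.integrable_of_hasCompactSupport hρc
  have hpt : ∀ y, ∫ x, η₂ x * (ρ y * ‖h (x - y)‖ ^ 2) ≤ ρ y * ∫ x, θ x * ‖h x‖ ^ 2 := by
    intro y
    by_cases hy : ρ y = 0
    · simp [hy]
    rw [← integral_add_right_eq_self _ y, ← integral_const_mul]
    refine integral_mono_of_nonneg (Eventually.of_forall fun x => ?_) (hθi.const_mul _)
      (Eventually.of_forall fun x => ?_)
    · exact mul_nonneg (hη0 _) (mul_nonneg (hρ0 _) (by positivity))
    · simp only [add_sub_cancel_right]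
      have h1 := hle x y hy
      have h2 := hρ0 y
      calc η₂ (x + y) * (ρ y * ‖h x‖ ^ 2) ≤ θ x * (ρ y * ‖h x‖ ^ 2) := by gcongr
        _ = _ := by ring
  calc _ ≤ ∫ y, ρ y * ∫ x, θ x * ‖h x‖ ^ 2 := by
        refine integral_mono_of_nonneg (Eventually.of_forall fun y => ?_) (hρi.mul_const _)
          (Eventually.of_forall hpt)
        exact integral_nonneg fun x => mul_nonneg (hη0 _) (mul_nonneg (hρ0 _) (by positivity))
    _ = _ := by rw [integral_mul_const, hρ1, one_mul]

/-- Difference quotients control derivatives in weighted `L²`. -/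
lemma integral_mul_norm_sq_dirDeriv_le {η₂ : F → ℝ} (hη : Continuous η₂)
    (hηc : HasCompactSupport η₂) (hη0 : ∀ x, 0 ≤ η₂ x) {g : F → F} (hg : ContDiff ℝ 1 g)
    (hgc : HasCompactSupport g) {C r : ℝ} (hr : 0 < r) {u : F} (hu : ‖u‖ = 1)
    (hC : ∀ t : ℝ, 0 < t → t ≤ r → ∫ x, η₂ x * ‖g (x + t • u) - g x‖ ^ 2 ≤ C * t ^ 2) :
    ∫ x, η₂ x * ‖dirDeriv u g x‖ ^ 2 ≤ C := by
  obtain ⟨K, hK⟩ := (hg.continuous_fderiv one_ne_zero).bounded_above_of_compact_support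
    (hgc.fderiv ℝ)
  have hLip : ∀ x (t : ℝ), 0 < t → ‖t⁻¹ • (g (x + t • u) - g x)‖ ≤ K := by
    intro x t ht
    have := convex_univ.norm_image_sub_le_of_norm_fderiv_le (𝕜 := ℝ) (f := g)
      (fun x _ => hg.differentiable one_ne_zero x) (fun x _ => hK x) (mem_univ x)
      (mem_univ (x + t • u))
    rw [add_sub_cancel_left, norm_smul, hu, mul_one, Real.norm_of_nonneg ht.le] at this
    rw [norm_smul, norm_inv, Real.norm_of_nonneg ht.le]
    rwa [inv_mul_le_iff₀ ht, mul_comm]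
  have hlim : Tendsto (fun t : ℝ => ∫ x, η₂ x * ‖t⁻¹ • (g (x + t • u) - g x)‖ ^ 2) (𝓝[>] 0)
      (𝓝 (∫ x, η₂ x * ‖dirDeriv u g x‖ ^ 2)) := by
    apply tendsto_integral_filter_of_dominated_convergence (fun x => η₂ x * K ^ 2)
    · refine Eventually.of_forall fun t => Continuous.aestronglyMeasurable ?_
      have := hg.continuous
      fun_prop
    · filter_upwards [self_mem_nhdsWithin] with t ht
      refine Eventually.of_forall fun x => ?_
      rw [norm_mul, Real.norm_of_nonneg (hη0 x), norm_pow, norm_norm]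
      have := hη0 x
      gcongr
      exact hLip x t ht
    · exact (hη.integrable_of_hasCompactSupport hηc).mul_const _
    · refine Eventually.of_forall fun x => ?_
      have h1 : HasLineDerivAt ℝ g (fderiv ℝ g x u) x u :=
        (hg.differentiable one_ne_zero x).hasFDerivAt.hasLineDerivAt u
      have h2 := h1.tendsto_slope_zero_right
      exact ((h2.norm).pow 2).const_mul _
  refine le_of_tendsto hlim ?_
  filter_upwards [Ioo_mem_nhdsGT hr] with t ht
  have h1 : ∀ x, η₂ x * ‖t⁻¹ • (g (x + t • u) - g x)‖ ^ 2 =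
      (t ^ 2)⁻¹ * (η₂ x * ‖g (x + t • u) - g x‖ ^ 2) := by
    intro x
    rw [norm_smul, norm_inv, Real.norm_of_nonneg ht.1.le]
    ring
  simp_rw [h1]
  rw [integral_const_mul, inv_mul_le_iff₀ (by have := ht.1; positivity), mul_comm]
  exact hC t ht.1 ht.2.le

/-- Smooth `C¹`-approximations with second derivatives bounded in weighted `L²`. -/
lemma exists_smooth_approx {f : F → F} (hf : ContDiff ℝ 1 f) (hfc : HasCompactSupport f)
    {η η₂ : F → ℝ} (hη : Continuous η) (hηc : HasCompactSupport η) (hη2 : Continuous η₂)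
    (hη2c : HasCompactSupport η₂) (hη20 : ∀ x, 0 ≤ η₂ x) {r C : ℝ} (hr : 0 < r)
    (hle : ∀ x y, ‖y‖ < r → η₂ (x + y) ≤ η x ^ 2)
    (hC : ∀ v : F, ‖v‖ = 1 → ∀ h : F, ‖h‖ ≤ r →
      ∫ x, η x ^ 2 * ‖fderiv ℝ f (x + h) v - fderiv ℝ f x v‖ ^ 2 ≤ C * ‖h‖ ^ 2)
    {δ : ℝ} (hδ : 0 < δ) :
    ∃ g : F → F, ContDiff ℝ ∞ g ∧ (∀ x, ‖g x - f x‖ ≤ δ) ∧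
      (∀ x, ‖fderiv ℝ g x - fderiv ℝ f x‖ ≤ δ) ∧
      ∀ u v : F, ‖u‖ = 1 → ‖v‖ = 1 → ∫ x, η₂ x * ‖dirDeriv u (dirDeriv v g) x‖ ^ 2 ≤ C := by
  have cdf : Continuous (fderiv ℝ f) := hf.continuous_fderiv one_ne_zero
  have uf := hfc.uniformContinuous_of_continuous hf.continuous
  have udf := (hfc.fderiv ℝ).uniformContinuous_of_continuous cdf
  obtain ⟨ε₁, hε₁, h₁⟩ := Metric.uniformContinuous_iff.1 uf δ hδ
  obtain ⟨ε₂, hε₂, h₂⟩ := Metric.uniformContinuous_iff.1 udf δ hδ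
  set ε := min r (min ε₁ ε₂) with hε
  have hε0 : 0 < ε := by positivity
  let φ : ContDiffBump (0 : F) := ⟨ε / 2, ε, by positivity, by linarith⟩
  let ρ := φ.normed (volume : Measure F)
  have hρ : Continuous ρ := φ.continuous_normed
  have hρc : HasCompactSupport ρ := φ.hasCompactSupport_normed
  have hρs : ContDiff ℝ ∞ ρ := φ.contDiff_normed
  have hρl : LocallyIntegrable ρ := hρ.locallyIntegrable
  let g : F → F := ρ ⋆[ContinuousLinearMap.lsmul ℝ ℝ, volume] f
  have hgs : ContDiff ℝ ∞ g :=
    hρc.contDiff_convolution_left _ hρs hf.continuous.locallyIntegrable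
  have hgc : HasCompactSupport g := hρc.convolution _ hfc
  have hgd : ∀ x, fderiv ℝ g x = ∫ t, ρ t • fderiv ℝ f (x - t) := by
    intro x
    exact (hfc.hasFDerivAt_convolution_right (ContinuousLinearMap.lsmul ℝ ℝ) hρl hf x).fderiv
  have hgd' : ∀ v x, dirDeriv v g x = ∫ t, ρ t • fderiv ℝ f (x - t) v := by
    intro v x
    unfold dirDeriv
    rw [hgd, ContinuousLinearMap.integral_apply]
    · simp
    · exact Continuous.integrable_of_hasCompactSupport (by fun_prop) hρc.smul_right
  refine ⟨g, hgs, fun x => ?_, fun x => ?_, fun u v hu hv => ?_⟩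
  · rw [← dist_eq_norm]
    refine φ.dist_normed_convolution_le hf.continuous.aestronglyMeasurable fun y hy => ?_
    refine (h₁ ?_).le
    exact (mem_ball.1 hy).trans_le ((min_le_right _ _).trans (min_le_left _ _))
  · rw [← dist_eq_norm, hgd]
    refine φ.dist_normed_convolution_le (g := fderiv ℝ f) cdf.aestronglyMeasurable fun y hy => ?_
    refine (h₂ ?_).le
    exact (mem_ball.1 hy).trans_le ((min_le_right _ _).trans (min_le_right _ _))
  · have hvs : ContDiff ℝ ∞ (dirDeriv v g) := by
      unfold dirDeriv
      exact (hgs.fderiv_right (m := ∞) (by simp)).clm_apply contDiff_const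
    have hvc : HasCompactSupport (dirDeriv v g) := by
      apply (hgc.fderiv ℝ).mono
      intro x hx h
      exact hx (by simp [dirDeriv, h])
    refine integral_mul_norm_sq_dirDeriv_le hη2 hη2c hη20 (hvs.of_le (by simp)) hvc hr hu ?_
    intro t ht htr
    have hn : ‖t • u‖ = t := by rw [norm_smul, hu, mul_one, Real.norm_of_nonneg ht.le]
    have hb := hC v hv (t • u) (by rw [hn]; exact htr)
    rw [hn] at hb
    refine le_trans ?_ hb
    have hdiff : ∀ x, dirDeriv v g (x + t • u) - dirDeriv v g x =
        ∫ y, ρ y • (fun z => fderiv ℝ f (z + t • u) v - fderiv ℝ f z v) (x - y) := by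
      intro x
      rw [hgd', hgd', ← integral_sub]
      · congr 1 with y
        rw [smul_sub, add_sub_right_comm]
      · exact Continuous.integrable_of_hasCompactSupport (by fun_prop) hρc.smul_right
      · exact Continuous.integrable_of_hasCompactSupport (by fun_prop) hρc.smul_right
    simp_rw [hdiff]
    refine integral_mul_norm_sq_convolution_le
      (h := fun z => fderiv ℝ f (z + t • u) v - fderiv ℝ f z v) hρ hρc (fun x => φ.nonneg_normed x)
      φ.integral_normed hη2 hη2c hη20 (hη.pow 2)
      (hηc.mono (fun x hx h => hx (by simp [h]))) (fun x y hy => ?_) (by fun_prop)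
    apply hle
    have : y ∈ ball (0 : F) ε := by
      rw [← φ.support_normed_eq (μ := volume)]; exact hy
    exact (mem_ball_zero_iff.1 this).trans_le (min_le_left _ _)

end Mollify

section AlmostMinimizers

/-- Almost minimizers of a quadratic functional over a decreasing sequence of convex sets form a
Cauchy sequence. -/
lemma exists_cauchy_almost_minimizers {V : Type*} [AddCommGroup V] [Module ℝ V] {Q : V → ℝ}
    {K : ℕ → Set V} (hK : Antitone K) (hQ0 : ∀ x, 0 ≤ Q x)
    (hQ : ∀ x ∈ K 0, ∀ y ∈ K 0, Q (x - y) = 2 * Q x + 2 * Q y - 4 * Q ((1 / 2 : ℝ) • (x + y)))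
    (hmid : ∀ n, ∀ x ∈ K n, ∀ y ∈ K n, (1 / 2 : ℝ) • (x + y) ∈ K n) {C : ℝ}
    (hC : ∀ n, ∃ x ∈ K n, Q x ≤ C) :
    ∃ g : ℕ → V, (∀ n, g n ∈ K n) ∧ (∀ n, Q (g n) ≤ C + 1) ∧
      ∀ ε > 0, ∃ N, ∀ n ≥ N, ∀ m ≥ N, Q (g n - g m) ≤ ε := by
  set q : ℕ → ℝ := fun n => sInf (Q '' K n) with hq
  have hbdd : ∀ n, BddBelow (Q '' K n) := fun n => ⟨0, by rintro _ ⟨x, -, rfl⟩; exact hQ0 x⟩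
  have hnon : ∀ n, (Q '' K n).Nonempty := fun n => by
    obtain ⟨x, hx, -⟩ := hC n; exact ⟨_, x, hx, rfl⟩
  have hqmono : Monotone q := fun n m hnm =>
    csInf_le_csInf (hbdd n) (hnon m) (image_mono (hK hnm))
  have hqC : ∀ n, q n ≤ C := fun n => by
    obtain ⟨x, hx, hxC⟩ := hC n
    exact (csInf_le (hbdd n) ⟨x, hx, rfl⟩).trans hxC
  have hex : ∀ n, ∃ x ∈ K n, Q x < q n + 1 / ((n : ℝ) + 1) := by
    intro n
    obtain ⟨_, ⟨x, hx, rfl⟩, hlt⟩ := exists_lt_of_csInf_lt (hnon n)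
      (lt_add_of_pos_right (q n) (Nat.one_div_pos_of_nat (α := ℝ) (n := n)))
    exact ⟨x, hx, hlt⟩
  choose g hgK hgQ using hex
  refine ⟨g, hgK, fun n => ?_, ?_⟩
  · have h1 : 1 / ((n : ℝ) + 1) ≤ 1 := by
      rw [div_le_one (by positivity)]; linarith [n.cast_nonneg (α := ℝ)]
    linarith [hgQ n, hqC n]
  · have hcauchy : CauchySeq q := by
      have : BddAbove (range q) := ⟨C, by rintro _ ⟨n, rfl⟩; exact hqC n⟩
      exact (tendsto_atTop_ciSup hqmono this).cauchySeq
    have key : ∀ n m, n ≤ m → Q (g n - g m) ≤ 2 * (q m - q n) + 4 * (1 / ((n : ℝ) + 1)) := by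
      intro n m hnm
      rw [hQ _ (hK (Nat.zero_le n) (hgK n)) _ (hK (Nat.zero_le m) (hgK m))]
      have h1 : q n ≤ Q ((1 / 2 : ℝ) • (g n + g m)) :=
        csInf_le (hbdd n) ⟨_, hmid n _ (hgK n) _ (hK hnm (hgK m)), rfl⟩
      have h2 : 1 / ((m : ℝ) + 1) ≤ 1 / ((n : ℝ) + 1) := Nat.one_div_le_one_div hnm
      linarith [hgQ n, hgQ m]
    have hsymm : ∀ n m, Q (g n - g m) = Q (g m - g n) := by
      intro n m
      rw [hQ _ (hK (Nat.zero_le n) (hgK n)) _ (hK (Nat.zero_le m) (hgK m)),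
        hQ _ (hK (Nat.zero_le m) (hgK m)) _ (hK (Nat.zero_le n) (hgK n)), add_comm (g n)]
      ring
    intro ε hε
    obtain ⟨N₁, hN₁⟩ := Metric.cauchySeq_iff.1 hcauchy (ε / 8) (by positivity)
    obtain ⟨N₂, hN₂⟩ := exists_nat_one_div_lt (show (0 : ℝ) < ε / 8 by positivity)
    have main : ∀ n ≥ max N₁ N₂, ∀ m ≥ n, Q (g n - g m) ≤ ε := by
      intro n hn m hm
      have h1 := hN₁ m ((le_max_left _ _).trans (hn.trans hm)) n ((le_max_left _ _).trans hn)
      rw [Real.dist_eq] at h1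
      have h2 := (le_abs_self _).trans h1.le
      have h3 : 1 / ((n : ℝ) + 1) ≤ 1 / ((N₂ : ℝ) + 1) :=
        Nat.one_div_le_one_div ((le_max_right _ _).trans hn)
      linarith [key n m hm]
    refine ⟨max N₁ N₂, fun n hn m hm => ?_⟩
    rcases le_total n m with h | h
    · exact main n hn m h
    · rw [hsymm]; exact main m hm n h

end AlmostMinimizers

section DirDeriv

variable {F E : Type*} [NormedAddCommGroup F] [NormedSpace ℝ F]
  [NormedAddCommGroup E] [NormedSpace ℝ E]

lemma ContDiff.dirDeriv {g : F → E} (hg : ContDiff ℝ ∞ g) (v : F) :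
    ContDiff ℝ ∞ (dirDeriv v g) :=
  (hg.fderiv_right (m := ∞) (by simp)).clm_apply contDiff_const

lemma ContDiff.smoothDifferentiableAt {g : F → E} (hg : ContDiff ℝ ∞ g) (x : F) :
    DifferentiableAt ℝ g x :=
  hg.differentiable (by simp) x

lemma dirDeriv_support_subset {g : F → E} (v : F) :
    Function.support (dirDeriv v g) ⊆ tsupport g := by
  intro x hx
  by_contra h
  apply hx
  have : fderiv ℝ g x = 0 :=
    image_eq_zero_of_notMem_tsupport fun h' => h (tsupport_fderiv_subset ℝ h')
  simp [dirDeriv, this]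

lemma tsupport_dirDeriv_subset {g : F → E} (v : F) : tsupport (dirDeriv v g) ⊆ tsupport g :=
  closure_minimal (dirDeriv_support_subset v) (isClosed_tsupport g)

lemma HasCompactSupport.dirDeriv {g : F → E} (hg : HasCompactSupport g) (v : F) :
    HasCompactSupport (dirDeriv v g) :=
  HasCompactSupport.of_support_subset_isCompact hg.isCompact (dirDeriv_support_subset v)

lemma dirDeriv_comm {g : F → E} (hg : ContDiff ℝ ∞ g) (u v : F) (x : F) :
    dirDeriv u (dirDeriv v g) x = dirDeriv v (dirDeriv u g) x := by
  have hd : DifferentiableAt ℝ (fderiv ℝ g) x :=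
    (hg.fderiv_right (m := ∞) (by simp)).smoothDifferentiableAt x
  have h : ∀ u v : F, dirDeriv u (dirDeriv v g) x = fderiv ℝ (fderiv ℝ g) x u v := by
    intro u v
    unfold dirDeriv
    rw [fderiv_clm_apply hd (differentiableAt_const v)]
    simp
  rw [h, h]
  have := (hg.contDiffAt (x := x)).isSymmSndFDerivAt (by
    simp only [minSmoothness_of_isRCLikeNormedField]
    exact WithTop.coe_le_coe.2 le_top)
  exact this u v

lemma dirDeriv_add {g h : F → E} {x : F} (hg : DifferentiableAt ℝ g x)
    (hh : DifferentiableAt ℝ h x) (v : F) :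
    dirDeriv v (fun y => g y + h y) x = dirDeriv v g x + dirDeriv v h x := by
  unfold dirDeriv
  rw [fderiv_fun_add hg hh]; rfl

lemma dirDeriv_sub {g h : F → E} {x : F} (hg : DifferentiableAt ℝ g x)
    (hh : DifferentiableAt ℝ h x) (v : F) :
    dirDeriv v (fun y => g y - h y) x = dirDeriv v g x - dirDeriv v h x := by
  unfold dirDeriv
  rw [fderiv_fun_sub hg hh]; rfl

lemma dirDeriv_const (c : E) (v : F) (x : F) : dirDeriv v (fun _ => c) x = 0 := by
  simp [dirDeriv]

lemma dirDeriv_const_smul {g : F → E} {x : F} (hg : DifferentiableAt ℝ g x) (c : ℝ) (v : F) :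
    dirDeriv v (fun y => c • g y) x = c • dirDeriv v g x := by
  unfold dirDeriv
  rw [fderiv_fun_const_smul hg]; rfl

lemma dirDeriv_smul {a : F → ℝ} {g : F → E} {x : F} (ha : DifferentiableAt ℝ a x)
    (hg : DifferentiableAt ℝ g x) (v : F) :
    dirDeriv v (fun y => a y • g y) x = a x • dirDeriv v g x + dirDeriv v a x • g x := by
  unfold dirDeriv
  rw [fderiv_fun_smul ha hg]; simp

lemma dirDeriv_mul {a g : F → ℝ} {x : F} (ha : DifferentiableAt ℝ a x)
    (hg : DifferentiableAt ℝ g x) (v : F) :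
    dirDeriv v (fun y => a y * g y) x = a x * dirDeriv v g x + dirDeriv v a x * g x := by
  simpa using dirDeriv_smul ha hg v

lemma dirDeriv_congr {g h : F → E} {x : F} (hgh : g =ᶠ[𝓝 x] h) (v : F) :
    dirDeriv v g x = dirDeriv v h x := by
  unfold dirDeriv; rw [hgh.fderiv_eq]

end DirDeriv

section DirDerivInner

variable {F E : Type*} [NormedAddCommGroup F] [NormedSpace ℝ F]
  [NormedAddCommGroup E] [InnerProductSpace ℝ E]

lemma dirDeriv_inner {g h : F → E} {x : F} (hg : DifferentiableAt ℝ g x)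
    (hh : DifferentiableAt ℝ h x) (v : F) :
    dirDeriv v (fun y => ⟪g y, h y⟫) x = ⟪g x, dirDeriv v h x⟫ + ⟪dirDeriv v g x, h x⟫ := by
  unfold dirDeriv
  rw [fderiv_inner_apply ℝ hg hh]

end DirDerivInner

section DirDerivIntegral

variable {F : Type*} [NormedAddCommGroup F] [NormedSpace ℝ F]
  [FiniteDimensional ℝ F] [MeasurableSpace F] [BorelSpace F] {μ : Measure F} [μ.IsAddHaarMeasure]

lemma integral_dirDeriv_eq_zero {h : F → ℝ} (hh : ContDiff ℝ 1 h) (hc : HasCompactSupport h)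
    (v : F) : ∫ x, dirDeriv v h x ∂μ = 0 := by
  have i1 : Integrable (fun x => fderiv ℝ h x v) μ :=
    ((hh.continuous_fderiv one_ne_zero).clm_apply continuous_const).integrable_of_hasCompactSupport
      (hc.dirDeriv v)
  have i2 : Integrable h μ := hh.continuous.integrable_of_hasCompactSupport hc
  have := integral_mul_fderiv_eq_neg_fderiv_mul_of_integrable (μ := μ) (f := fun _ : F => (1 : ℝ))
    (g := h) (v := v) (by simp) (by simpa using i1) (by simpa using i2)
    (fun x _ => differentiableAt_const _) (fun x _ => hh.differentiable one_ne_zero x)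
  simpa [dirDeriv] using this

/-- Integration by parts. -/
lemma integral_dirDeriv_mul {h k : F → ℝ} (hh : ContDiff ℝ ∞ h) (hk : ContDiff ℝ ∞ k)
    (hc : HasCompactSupport k) (v : F) :
    ∫ x, dirDeriv v h x * k x ∂μ = -∫ x, h x * dirDeriv v k x ∂μ := by
  have h1 : ∫ x, dirDeriv v (fun y => h y * k y) x ∂μ = 0 :=
    integral_dirDeriv_eq_zero ((hh.mul hk).of_le (by simp)) hc.mul_left v
  have h2 : ∀ x, dirDeriv v (fun y => h y * k y) x = h x * dirDeriv v k x + dirDeriv v h x * k x :=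
    fun x => dirDeriv_mul (hh.smoothDifferentiableAt x) (hk.smoothDifferentiableAt x) v
  simp_rw [h2] at h1
  rw [integral_add] at h1
  · linarith
  · exact (hh.continuous.mul (hk.dirDeriv v).continuous).integrable_of_hasCompactSupport
      (hc.dirDeriv v).mul_left
  · exact ((hh.dirDeriv v).continuous.mul hk.continuous).integrable_of_hasCompactSupport hc.mul_left

/-- If smooth functions tend to zero uniformly and their derivatives are Cauchy in weighted `L²`,
then the derivatives tend to zero in weighted `L²`. -/
lemma tendsto_integral_mul_dirDeriv_sq {η : F → ℝ} (hη : ContDiff ℝ ∞ η)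
    (hηc : HasCompactSupport η) (hη0 : ∀ x, 0 ≤ η x) {e : ℕ → F → ℝ}
    (he : ∀ n, ContDiff ℝ ∞ (e n)) {δ : ℕ → ℝ} (hδ : Tendsto δ atTop (𝓝 0))
    (hle : ∀ n, ∀ x ∈ tsupport η, |e n x| ≤ δ n) (v : F)
    (hcauchy : ∀ ε > 0, ∃ N, ∀ n ≥ N, ∀ m ≥ N,
      ∫ x, η x * (dirDeriv v (e n) x - dirDeriv v (e m) x) ^ 2 ∂μ ≤ ε) :
    Tendsto (fun n => ∫ x, η x * dirDeriv v (e n) x ^ 2 ∂μ) atTop (𝓝 0) := by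
  have c : ∀ n, Continuous (dirDeriv v (e n)) := fun n => ((he n).dirDeriv v).continuous
  have hnonneg : ∀ n, 0 ≤ ∫ x, η x * dirDeriv v (e n) x ^ 2 ∂μ := fun n =>
    integral_nonneg fun x => mul_nonneg (hη0 x) (sq_nonneg _)
  have hcross : ∀ n, Tendsto (fun m => ∫ x, η x * dirDeriv v (e n) x * dirDeriv v (e m) x ∂μ)
      atTop (𝓝 0) := by
    intro n
    have hk : ContDiff ℝ ∞ (fun x => η x * dirDeriv v (e n) x) := hη.mul ((he n).dirDeriv v)
    have hkc : HasCompactSupport (fun x => η x * dirDeriv v (e n) x) := hηc.mul_right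
    have h1 : ∀ m, ∫ x, η x * dirDeriv v (e n) x * dirDeriv v (e m) x ∂μ =
        -∫ x, e m x * dirDeriv v (fun x => η x * dirDeriv v (e n) x) x ∂μ := by
      intro m
      rw [← integral_dirDeriv_mul (he m) hk hkc v]
      congr 1 with x
      ring
    have i1 : Integrable (fun x => |dirDeriv v (fun x => η x * dirDeriv v (e n) x) x|) μ :=
      ((hk.dirDeriv v).continuous.integrable_of_hasCompactSupport (hkc.dirDeriv v)).abs
    apply squeeze_zero_norm (a := fun m => |δ m| *
      ∫ x, |dirDeriv v (fun x => η x * dirDeriv v (e n) x) x| ∂μ)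
    · intro m
      rw [h1, norm_neg, ← integral_const_mul]
      refine norm_integral_le_of_norm_le (i1.const_mul _) (Eventually.of_forall fun x => ?_)
      rw [norm_mul, Real.norm_eq_abs, Real.norm_eq_abs]
      by_cases hx : x ∈ tsupport η
      · exact mul_le_mul_of_nonneg_right ((hle m x hx).trans (le_abs_self _)) (abs_nonneg _)
      · have : dirDeriv v (fun x => η x * dirDeriv v (e n) x) x = 0 := by
          by_contra h
          apply hx
          have := dirDeriv_support_subset v (Function.mem_support.2 h)
          refine closure_mono (fun y hy => ?_) this
          rw [Function.mem_support] at hy ⊢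
          exact left_ne_zero_of_mul hy
        simp [this]
    · simpa using (hδ.abs).mul_const
        (∫ x, |dirDeriv v (fun x => η x * dirDeriv v (e n) x) x| ∂μ)
  rw [Metric.tendsto_atTop]
  intro ε hε
  obtain ⟨N, hN⟩ := hcauchy (ε / 4) (by positivity)
  refine ⟨N, fun n hn => ?_⟩
  rw [Real.dist_eq, sub_zero, abs_of_nonneg (hnonneg n)]
  obtain ⟨m, hm, hmN⟩ := (((hcross n).eventually (gt_mem_nhds (show (0 : ℝ) < ε / 8 by positivity))).and
    (eventually_ge_atTop N)).exists
  have hi : ∀ k : F → ℝ, Continuous k → Integrable (fun x => η x * k x) μ := fun k hk =>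
    (hη.continuous.mul hk).integrable_of_hasCompactSupport hηc.mul_right
  have h2 : ∫ x, η x * dirDeriv v (e n) x ^ 2 ∂μ ≤
      ∫ x, (η x * (dirDeriv v (e n) x - dirDeriv v (e m) x) ^ 2 +
        2 * (η x * dirDeriv v (e n) x * dirDeriv v (e m) x)) ∂μ := by
    have := c n
    have := c m
    refine integral_mono (hi _ (by fun_prop)) (((hi _ (by fun_prop)).add ?_)) fun x => ?_
    · refine Integrable.const_mul ?_ _
      simp_rw [mul_assoc]
      exact hi _ (by fun_prop)
    · simp only
      nlinarith [mul_nonneg (hη0 x) (sq_nonneg (dirDeriv v (e m) x))]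
  rw [integral_add, integral_const_mul] at h2
  · linarith [hN n hn m hmN]
  · have := c n
    have := c m
    exact hi _ (by fun_prop)
  · have := c n
    have := c m
    refine Integrable.const_mul ?_ _
    simp_rw [mul_assoc]
    exact hi _ (by fun_prop)

end DirDerivIntegral

section ConformalApprox

variable {F : Type*} [NormedAddCommGroup F] [InnerProductSpace ℝ F]
  [FiniteDimensional ℝ F] [MeasurableSpace F] [BorelSpace F] {ι : Type*} [Fintype ι]

/-- The squared norm of the second derivative in an orthonormal basis. -/
noncomputable def hessSq (b : OrthonormalBasis ι ℝ F) (g : F → F) (x : F) : ℝ :=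
  ∑ i, ∑ j, ‖dirDeriv (b i) (dirDeriv (b j) g) x‖ ^ 2

/-- Smooth approximations of a map which is conformal on the support of a cutoff function `η`,
converging in `C¹` and Cauchy in the second order Sobolev sense. -/
structure ConformalApprox (b : OrthonormalBasis ι ℝ F) (f : F → F) (η : F → ℝ)
    (g : ℕ → F → F) (m M C : ℝ) : Prop where
  smooth : ∀ n, ContDiff ℝ ∞ (g n)
  norm_sub_le : ∀ n x, ‖g n x - f x‖ ≤ 1 / ((n : ℝ) + 1)
  fderiv_sub_le : ∀ n x, ‖fderiv ℝ (g n) x - fderiv ℝ f x‖ ≤ 1 / ((n : ℝ) + 1)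
  smooth_cutoff : ContDiff ℝ ∞ η
  compact_cutoff : HasCompactSupport η
  cutoff_nonneg : ∀ x, 0 ≤ η x
  cutoff_le_one : ∀ x, η x ≤ 1
  pos : 0 < m
  le_norm : ∀ x ∈ tsupport η, m ≤ ‖fderiv ℝ f x‖
  norm_le : ∀ x ∈ tsupport η, ‖fderiv ℝ f x‖ ≤ M
  inner_eq : ∀ x ∈ tsupport η, ∀ u v, ⟪fderiv ℝ f x u, fderiv ℝ f x v⟫ =
    ‖fderiv ℝ f x‖ ^ 2 * ⟪u, v⟫
  energy : ∀ n, ∫ x, η x * hessSq b (g n) x ≤ C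
  cauchy : ∀ ε > 0, ∃ N, ∀ n ≥ N, ∀ l ≥ N, ∫ x, η x * hessSq b (g n - g l) x ≤ ε

omit [FiniteDimensional ℝ F] [MeasurableSpace F] [BorelSpace F] in
lemma continuous_hessSq (b : OrthonormalBasis ι ℝ F) {g : F → F} (hg : ContDiff ℝ ∞ g) :
    Continuous (hessSq b g) := by
  unfold hessSq
  refine continuous_finsetSum _ fun i _ => continuous_finsetSum _ fun j _ => ?_
  exact ((hg.dirDeriv (b j)).dirDeriv (b i)).continuous.norm.pow 2

omit [FiniteDimensional ℝ F] [MeasurableSpace F] [BorelSpace F] in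
lemma hessSq_nonneg (b : OrthonormalBasis ι ℝ F) (g : F → F) (x : F) : 0 ≤ hessSq b g x := by
  unfold hessSq; positivity

omit [FiniteDimensional ℝ F] [MeasurableSpace F] [BorelSpace F] in
lemma norm_dirDeriv_dirDeriv_sq_le (b : OrthonormalBasis ι ℝ F) (g : F → F) (x : F) (i j : ι) :
    ‖dirDeriv (b i) (dirDeriv (b j) g) x‖ ^ 2 ≤ hessSq b g x := by
  unfold hessSq
  refine le_trans ?_ (Finset.single_le_sum (f := fun i => ∑ j,
    ‖dirDeriv (b i) (dirDeriv (b j) g) x‖ ^ 2) (fun i _ => by positivity) (Finset.mem_univ i))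
  exact Finset.single_le_sum (f := fun j => ‖dirDeriv (b i) (dirDeriv (b j) g) x‖ ^ 2)
    (fun i _ => by positivity) (Finset.mem_univ j)

lemma dirDeriv_dirDeriv_sub {E E' : Type*} [NormedAddCommGroup E] [NormedSpace ℝ E]
    [NormedAddCommGroup E'] [NormedSpace ℝ E'] {g h : E → E'} (hg : ContDiff ℝ ∞ g)
    (hh : ContDiff ℝ ∞ h) (u v x : E) :
    dirDeriv u (dirDeriv v (g - h)) x =
      dirDeriv u (dirDeriv v g) x - dirDeriv u (dirDeriv v h) x := by
  have h1 : dirDeriv v (g - h) = fun y => dirDeriv v g y - dirDeriv v h y := by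
    funext y
    exact dirDeriv_sub (hg.smoothDifferentiableAt y) (hh.smoothDifferentiableAt y) v
  rw [h1]
  exact dirDeriv_sub ((hg.dirDeriv v).smoothDifferentiableAt x)
    ((hh.dirDeriv v).smoothDifferentiableAt x) u

lemma dirDeriv_dirDeriv_midpoint {E E' : Type*} [NormedAddCommGroup E] [NormedSpace ℝ E]
    [NormedAddCommGroup E'] [NormedSpace ℝ E'] {g h : E → E'} (hg : ContDiff ℝ ∞ g)
    (hh : ContDiff ℝ ∞ h) (c : ℝ) (u v x : E) :
    dirDeriv u (dirDeriv v (c • (g + h))) x =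
      c • (dirDeriv u (dirDeriv v g) x + dirDeriv u (dirDeriv v h) x) := by
  have h1 : dirDeriv v (c • (g + h)) = fun y => c • (dirDeriv v g y + dirDeriv v h y) := by
    funext y
    rw [← dirDeriv_add (hg.smoothDifferentiableAt y) (hh.smoothDifferentiableAt y) v]
    exact dirDeriv_const_smul ((hg.add hh).smoothDifferentiableAt y) c v
  rw [h1, ← dirDeriv_add ((hg.dirDeriv v).smoothDifferentiableAt x)
    ((hh.dirDeriv v).smoothDifferentiableAt x) u]
  exact dirDeriv_const_smul (((hg.dirDeriv v).add (hh.dirDeriv v)).smoothDifferentiableAt x) c u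

omit [FiniteDimensional ℝ F] [MeasurableSpace F] [BorelSpace F] in
lemma hessSq_sub (b : OrthonormalBasis ι ℝ F) {g h : F → F} (hg : ContDiff ℝ ∞ g)
    (hh : ContDiff ℝ ∞ h) (x : F) : hessSq b (g - h) x =
      2 * hessSq b g x + 2 * hessSq b h x - 4 * hessSq b ((1 / 2 : ℝ) • (g + h)) x := by
  unfold hessSq
  simp only [Finset.mul_sum, ← Finset.sum_add_distrib, ← Finset.sum_sub_distrib]
  refine Finset.sum_congr rfl fun i _ => Finset.sum_congr rfl fun j _ => ?_
  rw [dirDeriv_dirDeriv_sub hg hh, dirDeriv_dirDeriv_midpoint hg hh, norm_smul, mul_pow,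
    norm_sub_sq_real, norm_add_sq_real, Real.norm_of_nonneg (by norm_num)]
  ring

/-- Existence of conformal approximations. -/
lemma exists_conformalApprox (b : OrthonormalBasis ι ℝ F) {f : F → F} (hf : ContDiff ℝ 1 f)
    (hfc : HasCompactSupport f)
    {η η₂ : F → ℝ} (hη : Continuous η) (hηc : HasCompactSupport η) (hη2 : ContDiff ℝ ∞ η₂)
    (hη2c : HasCompactSupport η₂) (hη20 : ∀ x, 0 ≤ η₂ x) (hη21 : ∀ x, η₂ x ≤ 1)
    {r C : ℝ} (hr : 0 < r) (hle : ∀ x y, ‖y‖ < r → η₂ (x + y) ≤ η x ^ 2)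
    (hC : ∀ v : F, ‖v‖ = 1 → ∀ h : F, ‖h‖ ≤ r →
      ∫ x, η x ^ 2 * ‖fderiv ℝ f (x + h) v - fderiv ℝ f x v‖ ^ 2 ≤ C * ‖h‖ ^ 2)
    {m M : ℝ} (hm : 0 < m) (hmf : ∀ x ∈ tsupport η₂, m ≤ ‖fderiv ℝ f x‖)
    (hMf : ∀ x ∈ tsupport η₂, ‖fderiv ℝ f x‖ ≤ M)
    (hconf : ∀ x ∈ tsupport η₂, ∀ u v, ⟪fderiv ℝ f x u, fderiv ℝ f x v⟫ =
      ‖fderiv ℝ f x‖ ^ 2 * ⟪u, v⟫) :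
    ∃ g C', ConformalApprox b f η₂ g m M C' := by
  let K : ℕ → Set (F → F) := fun n => {g | ContDiff ℝ ∞ g ∧ (∀ x, ‖g x - f x‖ ≤ 1 / ((n : ℝ) + 1)) ∧
    ∀ x, ‖fderiv ℝ g x - fderiv ℝ f x‖ ≤ 1 / ((n : ℝ) + 1)}
  let Q : (F → F) → ℝ := fun g => ∫ x, η₂ x * hessSq b g x
  have hi : ∀ g, ContDiff ℝ ∞ g → Integrable (fun x => η₂ x * hessSq b g x) := fun g hg =>
    (hη2.continuous.mul (continuous_hessSq b hg)).integrable_of_hasCompactSupport hη2c.mul_right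
  have hK : Antitone K := by
    intro n n' hn g hg
    have h1 : 1 / ((n' : ℝ) + 1) ≤ 1 / ((n : ℝ) + 1) := Nat.one_div_le_one_div hn
    exact ⟨hg.1, fun x => (hg.2.1 x).trans h1, fun x => (hg.2.2 x).trans h1⟩
  obtain ⟨g, hgK, hgQ, hgC⟩ := exists_cauchy_almost_minimizers (Q := Q) hK
    (fun g => integral_nonneg fun x => mul_nonneg (hη20 x) (hessSq_nonneg b g x)) (C := ∑ _i : ι, ∑ _j : ι, C)
    (by
      rintro g ⟨hg, -⟩ h ⟨hh, -⟩
      have hgh : ContDiff ℝ ∞ ((1 / 2 : ℝ) • (g + h)) := (hg.add hh).const_smul _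
      simp only [Q]
      rw [← integral_const_mul, ← integral_const_mul, ← integral_const_mul, ← integral_add,
        ← integral_sub]
      · congr 1 with x
        rw [hessSq_sub b hg hh]; ring
      · exact ((hi g hg).const_mul 2).add ((hi h hh).const_mul 2)
      · exact (hi _ hgh).const_mul 4
      · exact (hi g hg).const_mul 2
      · exact (hi h hh).const_mul 2)
    (by
      rintro n g ⟨hg, hg1, hg2⟩ h ⟨hh, hh1, hh2⟩
      refine ⟨ContDiff.const_smul (1 / 2 : ℝ) (hg.add hh), fun x => ?_, fun x => ?_⟩
      · have h1 : ((1 / 2 : ℝ) • (g + h)) x - f x =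
            (1 / 2 : ℝ) • ((g x - f x) + (h x - f x)) := by
          simp only [Pi.smul_apply, Pi.add_apply]; module
        rw [h1, norm_smul, Real.norm_of_nonneg (by norm_num)]
        linarith [norm_add_le (g x - f x) (h x - f x), hg1 x, hh1 x]
      · have h0 : fderiv ℝ ((1 / 2 : ℝ) • (g + h)) x = (1 / 2 : ℝ) • (fderiv ℝ g x + fderiv ℝ h x) := by
          rw [fderiv_const_smul ((hg.smoothDifferentiableAt x).add (hh.smoothDifferentiableAt x)),
            fderiv_add (hg.smoothDifferentiableAt x) (hh.smoothDifferentiableAt x)]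
        have h1 : fderiv ℝ ((1 / 2 : ℝ) • (g + h)) x - fderiv ℝ f x =
            (1 / 2 : ℝ) • ((fderiv ℝ g x - fderiv ℝ f x) + (fderiv ℝ h x - fderiv ℝ f x)) := by
          rw [h0]; module
        rw [h1, norm_smul, Real.norm_of_nonneg (by norm_num)]
        linarith [norm_add_le (fderiv ℝ g x - fderiv ℝ f x) (fderiv ℝ h x - fderiv ℝ f x),
          hg2 x, hh2 x])
    (by
      intro n
      obtain ⟨g, h1, h2, h3, h4⟩ := exists_smooth_approx hf hfc hη hηc hη2.continuous hη2c hη20 hr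
        hle hC (Nat.one_div_pos_of_nat (α := ℝ) (n := n))
      refine ⟨g, ⟨h1, h2, h3⟩, ?_⟩
      have hii : ∀ i j, Integrable (fun x => η₂ x * ‖dirDeriv (b i) (dirDeriv (b j) g) x‖ ^ 2) :=
        fun i j => (hη2.continuous.mul (((h1.dirDeriv (b j)).dirDeriv (b i)).continuous.norm.pow
          2)).integrable_of_hasCompactSupport hη2c.mul_right
      simp only [Q, hessSq, Finset.mul_sum]
      rw [integral_finsetSum _ fun i _ => integrable_finsetSum _ fun j _ => hii i j]
      refine Finset.sum_le_sum fun i _ => ?_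
      rw [integral_finsetSum _ fun j _ => hii i j]
      exact Finset.sum_le_sum fun j _ => h4 _ _ (b.norm_eq_one i) (b.norm_eq_one j))
  exact ⟨g, _, ⟨fun n => (hgK n).1, fun n => (hgK n).2.1, fun n => (hgK n).2.2, hη2, hη2c, hη20,
    hη21, hm, hmf, hMf, hconf, hgQ, hgC⟩⟩

variable [DecidableEq ι]

/-- The defect of conformality of `g`, measured against the direction `b k`. -/
noncomputable def confDefect (b : OrthonormalBasis ι ℝ F) (k : ι) (g : F → F) (i j : ι) (x : F) : ℝ :=
  ⟪dirDeriv (b i) g x, dirDeriv (b j) g x⟫ -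
    (if i = j then 1 else 0) * ⟪dirDeriv (b k) g x, dirDeriv (b k) g x⟫

omit [FiniteDimensional ℝ F] [MeasurableSpace F] [BorelSpace F] in
lemma contDiff_confDefect (b : OrthonormalBasis ι ℝ F) (k : ι) {g : F → F} (hg : ContDiff ℝ ∞ g)
    (i j : ι) : ContDiff ℝ ∞ (confDefect b k g i j) :=
  ((hg.dirDeriv (b i)).inner ℝ (hg.dirDeriv (b j))).sub
    (contDiff_const.mul ((hg.dirDeriv (b k)).inner ℝ (hg.dirDeriv (b k))))

omit [FiniteDimensional ℝ F] [MeasurableSpace F] [BorelSpace F] in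
lemma dirDeriv_confDefect (b : OrthonormalBasis ι ℝ F) (k : ι) {g : F → F} (hg : ContDiff ℝ ∞ g)
    (i j l : ι) (x : F) : dirDeriv (b l) (confDefect b k g i j) x =
      ⟪dirDeriv (b i) g x, dirDeriv (b l) (dirDeriv (b j) g) x⟫ +
      ⟪dirDeriv (b l) (dirDeriv (b i) g) x, dirDeriv (b j) g x⟫ -
      (if i = j then 1 else 0) * (2 * ⟪dirDeriv (b l) (dirDeriv (b k) g) x, dirDeriv (b k) g x⟫) := by
  have hd : ∀ a, DifferentiableAt ℝ (dirDeriv (b a) g) x := fun a =>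
    (hg.dirDeriv (b a)).smoothDifferentiableAt x
  have hdi : ∀ a a', DifferentiableAt ℝ (fun y => ⟪dirDeriv (b a) g y, dirDeriv (b a') g y⟫) x :=
    fun a a' => (hd a).inner ℝ (hd a')
  unfold confDefect
  have hdk : DifferentiableAt ℝ (fun y => (if i = j then (1 : ℝ) else 0) *
      ⟪dirDeriv (b k) g y, dirDeriv (b k) g y⟫) x := (hdi k k).const_mul _
  rw [dirDeriv_sub (hdi i j) hdk, dirDeriv_inner (hd i) (hd j),
    dirDeriv_mul (differentiableAt_const _) (hdi k k), dirDeriv_inner (hd k) (hd k), dirDeriv_const,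
    real_inner_comm (dirDeriv (b k) g x)]
  ring

/-- The squared norm of the derivative of the conformality defect. -/
noncomputable def defectSq (b : OrthonormalBasis ι ℝ F) (k : ι) (g : F → F) (x : F) : ℝ :=
  ∑ l, ∑ i, ∑ j, dirDeriv (b l) (confDefect b k g i j) x ^ 2

omit [FiniteDimensional ℝ F] [MeasurableSpace F] [BorelSpace F] in
lemma defectSq_nonneg (b : OrthonormalBasis ι ℝ F) (k : ι) (g : F → F) (x : F) :
    0 ≤ defectSq b k g x := by
  unfold defectSq; positivity

omit [FiniteDimensional ℝ F] [MeasurableSpace F] [BorelSpace F] in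
lemma continuous_defectSq (b : OrthonormalBasis ι ℝ F) (k : ι) {g : F → F} (hg : ContDiff ℝ ∞ g) :
    Continuous (defectSq b k g) := by
  unfold defectSq
  refine continuous_finsetSum _ fun l _ => continuous_finsetSum _ fun i _ =>
    continuous_finsetSum _ fun j _ => ?_
  exact ((contDiff_confDefect b k hg i j).dirDeriv (b l)).continuous.pow 2

omit [FiniteDimensional ℝ F] [MeasurableSpace F] [BorelSpace F] in
lemma dirDeriv_confDefect_sq_le (b : OrthonormalBasis ι ℝ F) (k : ι) (g : F → F) (x : F)
    (l i j : ι) : dirDeriv (b l) (confDefect b k g i j) x ^ 2 ≤ defectSq b k g x := by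
  unfold defectSq
  refine le_trans ?_ (Finset.single_le_sum (f := fun l => ∑ i, ∑ j,
    dirDeriv (b l) (confDefect b k g i j) x ^ 2) (fun i _ => by positivity) (Finset.mem_univ l))
  refine le_trans ?_ (Finset.single_le_sum (f := fun i => ∑ j,
    dirDeriv (b l) (confDefect b k g i j) x ^ 2) (fun i _ => by positivity) (Finset.mem_univ i))
  exact Finset.single_le_sum (f := fun j => dirDeriv (b l) (confDefect b k g i j) x ^ 2)
    (fun i _ => by positivity) (Finset.mem_univ j)

namespace ConformalApprox

variable {b : OrthonormalBasis ι ℝ F} {f : F → F} {η : F → ℝ} {g : ℕ → F → F} {m M C : ℝ}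

omit [DecidableEq ι] in
lemma norm_dirDeriv_sub_le (h : ConformalApprox b f η g m M C) (n : ℕ) (x : F) (i : ι) :
    ‖dirDeriv (b i) (g n) x - fderiv ℝ f x (b i)‖ ≤ 1 / ((n : ℝ) + 1) := by
  have := (fderiv ℝ (g n) x - fderiv ℝ f x).le_opNorm (b i)
  rw [b.norm_eq_one, mul_one] at this
  exact this.trans (h.fderiv_sub_le n x)

omit [DecidableEq ι] in
lemma norm_dirDeriv_le (h : ConformalApprox b f η g m M C) (n : ℕ) {x : F} (hx : x ∈ tsupport η)
    (i : ι) : ‖dirDeriv (b i) (g n) x‖ ≤ M + 1 := by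
  have h1 := h.norm_dirDeriv_sub_le n x i
  have h2 : ‖fderiv ℝ f x (b i)‖ ≤ M := by
    have := (fderiv ℝ f x).le_opNorm (b i)
    rw [b.norm_eq_one, mul_one] at this
    exact this.trans (h.norm_le x hx)
  have h3 : 1 / ((n : ℝ) + 1) ≤ 1 := by
    rw [div_le_one (by positivity)]; linarith [n.cast_nonneg (α := ℝ)]
  have h4 := norm_le_norm_add_norm_sub' (dirDeriv (b i) (g n) x) (fderiv ℝ f x (b i))
  linarith

lemma abs_confDefect_le (h : ConformalApprox b f η g m M C) (k : ι) (n : ℕ) {x : F}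
    (hx : x ∈ tsupport η) (i j : ι) :
    |confDefect b k (g n) i j x| ≤ 2 * (2 * M + 1) * (1 / ((n : ℝ) + 1)) := by
  have hM : 0 ≤ M := (norm_nonneg _).trans (h.norm_le x hx)
  have key : ∀ a c, |⟪dirDeriv (b a) (g n) x, dirDeriv (b c) (g n) x⟫ -
      ⟪fderiv ℝ f x (b a), fderiv ℝ f x (b c)⟫| ≤ (2 * M + 1) * (1 / ((n : ℝ) + 1)) := by
    intro a c
    set p := dirDeriv (b a) (g n) x
    set q := dirDeriv (b c) (g n) x
    set p' := fderiv ℝ f x (b a)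
    set q' := fderiv ℝ f x (b c)
    have e1 : ⟪p, q⟫ - ⟪p', q'⟫ = ⟪p - p', q⟫ + ⟪p', q - q'⟫ := by
      simp only [inner_sub_left, inner_sub_right]; ring
    have h2 : ‖p'‖ ≤ M := by
      have := (fderiv ℝ f x).le_opNorm (b a)
      rw [b.norm_eq_one, mul_one] at this
      exact this.trans (h.norm_le x hx)
    rw [e1]
    calc _ ≤ ‖p - p'‖ * ‖q‖ + ‖p'‖ * ‖q - q'‖ := (abs_add_le _ _).trans
          (add_le_add (abs_real_inner_le_norm _ _) (abs_real_inner_le_norm _ _))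
      _ ≤ (1 / ((n : ℝ) + 1)) * (M + 1) + M * (1 / ((n : ℝ) + 1)) := by
          gcongr
          · exact h.norm_dirDeriv_sub_le n x a
          · exact h.norm_dirDeriv_le n hx c
          · exact h.norm_dirDeriv_sub_le n x c
      _ = _ := by ring
  have e0 : ⟪fderiv ℝ f x (b i), fderiv ℝ f x (b j)⟫ -
      (if i = j then 1 else 0) * ⟪fderiv ℝ f x (b k), fderiv ℝ f x (b k)⟫ = 0 := by
    rw [h.inner_eq x hx, h.inner_eq x hx, b.inner_eq_ite, b.inner_eq_ite]
    simp
  have e1 : confDefect b k (g n) i j x = (⟪dirDeriv (b i) (g n) x, dirDeriv (b j) (g n) x⟫ -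
      ⟪fderiv ℝ f x (b i), fderiv ℝ f x (b j)⟫) - (if i = j then 1 else 0) *
      (⟪dirDeriv (b k) (g n) x, dirDeriv (b k) (g n) x⟫ -
      ⟪fderiv ℝ f x (b k), fderiv ℝ f x (b k)⟫) := by
    unfold confDefect; linear_combination e0
  rw [e1]
  refine (abs_sub _ _).trans ?_
  rw [abs_mul]
  have h1 := key i j
  have h2 := key k k
  have h3 : |(if i = j then (1 : ℝ) else 0)| ≤ 1 := by split_ifs <;> simp
  have h4 := mul_le_mul h3 h2 (abs_nonneg _) zero_le_one
  linarith

/-- The derivative of the conformality defect tends to zero in weighted `L²`. -/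
lemma tendsto_integral_defectSq (h : ConformalApprox b f η g m M C) (k : ι) :
    Tendsto (fun n => ∫ x, η x * defectSq b k (g n) x) atTop (𝓝 0) := by
  have hi : ∀ q : F → ℝ, Continuous q → Integrable (fun x => η x * q x) := fun q hq =>
    (h.smooth_cutoff.continuous.mul hq).integrable_of_hasCompactSupport h.compact_cutoff.mul_right
  have hC0 : 0 ≤ C := (integral_nonneg fun x => mul_nonneg (h.cutoff_nonneg x)
    (hessSq_nonneg b _ x)).trans (h.energy 0)
  have main : ∀ l i j, Tendsto (fun n => ∫ x, η x * dirDeriv (b l) (confDefect b k (g n) i j) x ^ 2)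
      atTop (𝓝 0) := by
    intro l i j
    have hδ : Tendsto (fun n : ℕ => 2 * (2 * M + 1) * (1 / ((n : ℝ) + 1))) atTop (𝓝 0) := by
      simpa using tendsto_one_div_add_atTop_nhds_zero_nat.const_mul (2 * (2 * M + 1))
    refine tendsto_integral_mul_dirDeriv_sq h.smooth_cutoff h.compact_cutoff h.cutoff_nonneg
      (fun n => contDiff_confDefect b k (h.smooth n) i j) hδ
      (fun n x hx => h.abs_confDefect_le k n hx i j) (b l) ?_
    have hpt : ∀ n n' x, η x * (dirDeriv (b l) (confDefect b k (g n) i j) x -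
        dirDeriv (b l) (confDefect b k (g n') i j) x) ^ 2 ≤
        32 * (M + 1) ^ 2 * (η x * hessSq b (g n - g n') x) +
        32 * (1 / ((n : ℝ) + 1) + 1 / ((n' : ℝ) + 1)) ^ 2 * (η x * hessSq b (g n') x) := by
      intro n n' x
      by_cases hx : x ∈ tsupport η
      swap
      · simp [image_eq_zero_of_notMem_tsupport hx]
      set δ := 1 / ((n : ℝ) + 1) + 1 / ((n' : ℝ) + 1) with hδ
      have hδ0 : 0 ≤ δ := by positivity
      have hM : 0 ≤ M := (norm_nonneg _).trans (h.norm_le x hx)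
      set A := √(hessSq b (g n - g n') x) with hA
      set B := √(hessSq b (g n') x) with hB
      have key : ∀ a c, |⟪dirDeriv (b l) (dirDeriv (b a) (g n)) x, dirDeriv (b c) (g n) x⟫ -
          ⟪dirDeriv (b l) (dirDeriv (b a) (g n')) x, dirDeriv (b c) (g n') x⟫| ≤
          (M + 1) * A + δ * B := by
        intro a c
        set q := dirDeriv (b l) (dirDeriv (b a) (g n)) x with hq
        set q' := dirDeriv (b l) (dirDeriv (b a) (g n')) x with hq'
        set p := dirDeriv (b c) (g n) x with hp
        set p' := dirDeriv (b c) (g n') x with hp'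
        have e1 : ⟪q, p⟫ - ⟪q', p'⟫ = ⟪q - q', p⟫ + ⟪q', p - p'⟫ := by
          simp only [inner_sub_left, inner_sub_right]; ring
        have h1 : ‖q - q'‖ ≤ A := by
          apply Real.le_sqrt_of_sq_le
          rw [hq, hq', ← dirDeriv_dirDeriv_sub (h.smooth n) (h.smooth n')]
          exact norm_dirDeriv_dirDeriv_sq_le b _ x l a
        have h2 : ‖q'‖ ≤ B := Real.le_sqrt_of_sq_le (norm_dirDeriv_dirDeriv_sq_le b _ x l a)
        have h3 : ‖p - p'‖ ≤ δ := by
          have e2 : p - p' = (p - fderiv ℝ f x (b c)) - (p' - fderiv ℝ f x (b c)) := by abel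
          rw [e2]
          exact (_root_.norm_sub_le _ _).trans (add_le_add (h.norm_dirDeriv_sub_le n x c)
            (h.norm_dirDeriv_sub_le n' x c))
        rw [e1]
        calc _ ≤ ‖q - q'‖ * ‖p‖ + ‖q'‖ * ‖p - p'‖ := (abs_add_le _ _).trans
              (add_le_add (abs_real_inner_le_norm _ _) (abs_real_inner_le_norm _ _))
          _ ≤ A * (M + 1) + B * δ := by
              gcongr
              exact h.norm_dirDeriv_le n hx c
          _ = _ := by ring
      have k1 := key j i
      have k2 := key i j
      have k3 := key k k
      have hc : |(if i = j then (1 : ℝ) else 0)| ≤ 1 := by split_ifs <;> simp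
      have k4 : |dirDeriv (b l) (confDefect b k (g n) i j) x -
          dirDeriv (b l) (confDefect b k (g n') i j) x| ≤ 4 * ((M + 1) * A + δ * B) := by
        rw [dirDeriv_confDefect b k (h.smooth n), dirDeriv_confDefect b k (h.smooth n'),
          real_inner_comm _ (dirDeriv (b i) (g n) x), real_inner_comm _ (dirDeriv (b i) (g n') x)]
        have k5 := mul_le_mul hc k3 (abs_nonneg _) zero_le_one
        rw [← abs_mul, abs_le] at k5
        rw [abs_le] at k1 k2 ⊢
        constructor <;> linarith
      have k6 : (dirDeriv (b l) (confDefect b k (g n) i j) x -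
          dirDeriv (b l) (confDefect b k (g n') i j) x) ^ 2 ≤ 32 * (M + 1) ^ 2 *
          hessSq b (g n - g n') x + 32 * δ ^ 2 * hessSq b (g n') x := by
        rw [← sq_abs]
        have hA2 : A ^ 2 = hessSq b (g n - g n') x := Real.sq_sqrt (hessSq_nonneg _ _ _)
        have hB2 : B ^ 2 = hessSq b (g n') x := Real.sq_sqrt (hessSq_nonneg _ _ _)
        rw [← hA2, ← hB2]
        have := pow_le_pow_left₀ (abs_nonneg _) k4 2
        nlinarith [sq_nonneg ((M + 1) * A - δ * B)]
      have := mul_le_mul_of_nonneg_left k6 (h.cutoff_nonneg x)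
      linarith
    intro ε hε
    obtain ⟨N₁, hN₁⟩ := h.cauchy (ε / (2 * (32 * (M + 1) ^ 2 + 1))) (by positivity)
    obtain ⟨N₂, hN₂⟩ := exists_nat_one_div_lt (show (0 : ℝ) < min 1 (ε / (256 * (C + 1))) by
      positivity)
    refine ⟨max N₁ N₂, fun n hn n' hn' => ?_⟩
    set δ := 1 / ((n : ℝ) + 1) + 1 / ((n' : ℝ) + 1) with hδ
    have hδ0 : 0 ≤ δ := by positivity
    have d1 : 1 / ((n : ℝ) + 1) ≤ 1 / ((N₂ : ℝ) + 1) :=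
      Nat.one_div_le_one_div ((le_max_right _ _).trans hn)
    have d2 : 1 / ((n' : ℝ) + 1) ≤ 1 / ((N₂ : ℝ) + 1) :=
      Nat.one_div_le_one_div ((le_max_right _ _).trans hn')
    have d3 : δ ≤ 2 := by linarith [min_le_left (1 : ℝ) (ε / (256 * (C + 1)))]
    have d4 : δ ≤ 2 * (ε / (256 * (C + 1))) := by
      linarith [min_le_right (1 : ℝ) (ε / (256 * (C + 1)))]
    have d5 : δ ^ 2 ≤ 4 * (ε / (256 * (C + 1))) := by nlinarith
    have i1 : Integrable (fun x => η x * hessSq b (g n - g n') x) :=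
      hi _ (continuous_hessSq b ((h.smooth n).sub (h.smooth n')))
    have i2 : Integrable (fun x => η x * hessSq b (g n') x) :=
      hi _ (continuous_hessSq b (h.smooth n'))
    have c1 := ((contDiff_confDefect b k (h.smooth n) i j).dirDeriv (b l)).continuous
    have c2 := ((contDiff_confDefect b k (h.smooth n') i j).dirDeriv (b l)).continuous
    have := integral_mono (hi _ ((c1.sub c2).pow 2))
      ((i1.const_mul (32 * (M + 1) ^ 2)).add (i2.const_mul (32 * δ ^ 2))) (hpt n n')
    refine this.trans ?_
    simp only [Pi.add_apply]
    rw [integral_add (i1.const_mul _) (i2.const_mul _), integral_const_mul, integral_const_mul]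
    have j1 := hN₁ n ((le_max_left _ _).trans hn) n' ((le_max_left _ _).trans hn')
    have j2 := h.energy n'
    have j3 : 32 * (M + 1) ^ 2 * ∫ x, η x * hessSq b (g n - g n') x ≤ ε / 2 := by
      calc _ ≤ (32 * (M + 1) ^ 2 + 1) * (ε / (2 * (32 * (M + 1) ^ 2 + 1))) :=
            mul_le_mul (by linarith) j1 (integral_nonneg fun x => mul_nonneg (h.cutoff_nonneg x)
              (hessSq_nonneg _ _ _)) (by positivity)
        _ = _ := by field_simp
    have j4 : 32 * δ ^ 2 * ∫ x, η x * hessSq b (g n') x ≤ ε / 2 := by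
      calc _ ≤ 32 * (4 * (ε / (256 * (C + 1)))) * (C + 1) :=
            mul_le_mul (by linarith) (by linarith) (integral_nonneg fun x =>
              mul_nonneg (h.cutoff_nonneg x) (hessSq_nonneg _ _ _)) (by positivity)
        _ = _ := by field_simp; norm_num
    linarith
  have hsum : ∀ n, ∫ x, η x * defectSq b k (g n) x =
      ∑ l, ∑ i, ∑ j, ∫ x, η x * dirDeriv (b l) (confDefect b k (g n) i j) x ^ 2 := by
    intro n
    have hii : ∀ l i j, Integrable
        (fun x => η x * dirDeriv (b l) (confDefect b k (g n) i j) x ^ 2) := fun l i j =>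
      hi _ (((contDiff_confDefect b k (h.smooth n) i j).dirDeriv (b l)).continuous.pow 2)
    simp only [defectSq, Finset.mul_sum]
    rw [integral_finsetSum _ fun l _ => integrable_finsetSum _ fun i _ =>
      integrable_finsetSum _ fun j _ => hii l i j]
    refine Finset.sum_congr rfl fun l _ => ?_
    rw [integral_finsetSum _ fun i _ => integrable_finsetSum _ fun j _ => hii l i j]
    refine Finset.sum_congr rfl fun i _ => ?_
    rw [integral_finsetSum _ fun j _ => hii l i j]
  simp_rw [hsum]
  have := tendsto_finsetSum (Finset.univ : Finset ι) fun l _ =>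
    tendsto_finsetSum (Finset.univ : Finset ι) fun i _ =>
      tendsto_finsetSum (Finset.univ : Finset ι) fun j _ => main l i j
  simpa using this

end ConformalApprox

end ConformalApprox

section PointwiseDefect

variable {F : Type*} [NormedAddCommGroup F] [InnerProductSpace ℝ F] {ι : Type*} [Fintype ι]
  [DecidableEq ι]

omit [Fintype ι] in
/-- Pointwise algebra behind the estimate of the off-diagonal part of the Hessian of a nearly
conformal map: `p a` and `q a c` play the role of first and second derivatives, `de l i j` of
the derivative of the conformality defect, and `W` is the inverse of the conformal factor. -/
lemma abs_inner_offDiagonal_le {p : ι → F} {q : ι → ι → F} (hq : ∀ a c, q a c = q c a) {k : ι}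
    {W w₀ P τ ε h : ℝ} (hW : W ^ 2 * ⟪p k, p k⟫ = 1) (hw : |W| ≤ w₀)
    {V : ι → ℝ} (hV : ∀ a, V a = -W ^ 3 * ⟪q a k, p k⟫)
    (hVb : ∀ a, |V a| ≤ w₀ ^ 3 * P * h)
    (hde : ∀ l i j, |⟪p i, q l j⟫ + ⟪q l i, p j⟫ -
      (if i = j then 1 else 0) * (2 * ⟪q l k, p k⟫)| ≤ τ)
    (he : ∀ i j, |⟪p i, p j⟫ - (if i = j then 1 else 0) * ⟪p k, p k⟫| ≤ ε)
    {i j : ι} (hij : i ≠ j) (l : ι) :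
    |⟪W • q i j + V i • p j + V j • p i, p l⟫| ≤ 2 * w₀ * τ + 2 * (w₀ ^ 3 * P * h) * ε := by
  have hτ : 0 ≤ τ := (abs_nonneg _).trans (hde i i i)
  have hε : 0 ≤ ε := (abs_nonneg _).trans (he i i)
  have hw0 : 0 ≤ w₀ := (abs_nonneg _).trans hw
  have hmulW : ∀ {t : ℝ}, |t| ≤ τ → |W * t| ≤ w₀ * τ := fun {t} ht => by
    rw [abs_mul]; exact mul_le_mul hw ht (abs_nonneg _) hw0
  have hmulV : ∀ a {t : ℝ}, |t| ≤ ε → |V a * t| ≤ (w₀ ^ 3 * P * h) * ε := fun a {t} ht => by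
    rw [abs_mul]; exact mul_le_mul (hVb a) ht (abs_nonneg _) ((abs_nonneg _).trans (hVb a))
  have hwτ : 0 ≤ w₀ * τ := by positivity
  -- the case in which `l` is the second index
  have diag : ∀ {i j : ι}, i ≠ j → |⟪W • q i j + V i • p j + V j • p i, p j⟫| ≤
      2 * w₀ * τ + 2 * (w₀ ^ 3 * P * h) * ε := by
    intro i j hij
    have h1 := abs_le.1 (hmulW (hde i j j))
    have h2 := abs_le.1 (hmulV i (he j j))
    have h3 := abs_le.1 (hmulV j (he i j))
    rw [if_pos rfl] at h1 h2
    rw [if_neg hij] at h3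
    have e : ⟪W • q i j + V i • p j + V j • p i, p j⟫ =
        (1 / 2) * (W * (⟪p j, q i j⟫ + ⟪q i j, p j⟫ - 1 * (2 * ⟪q i k, p k⟫))) +
        V i * (⟪p j, p j⟫ - 1 * ⟪p k, p k⟫) + V j * (⟪p i, p j⟫ - 0 * ⟪p k, p k⟫) := by
      simp only [inner_add_left, inner_smul_left, RCLike.conj_to_real]
      rw [real_inner_comm (q i j) (p j)]
      have := hV i
      linear_combination (-W * ⟪q i k, p k⟫) * hW + ⟪p k, p k⟫ * this
    rw [e, abs_le]
    constructor <;> linarith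
  by_cases hlj : l = j
  · subst hlj; exact diag hij
  by_cases hli : l = i
  · subst hli
    have := diag hij.symm
    rwa [hq j l, add_right_comm] at this
  have h1 := abs_le.1 (hmulW (hde i j l))
  have h2 := abs_le.1 (hmulW (hde j i l))
  have h3 := abs_le.1 (hmulW (hde l i j))
  have h4 := abs_le.1 (hmulV i (he j l))
  have h5 := abs_le.1 (hmulV j (he i l))
  rw [if_neg (Ne.symm hlj)] at h1 h4
  rw [if_neg (Ne.symm hli)] at h2 h5
  rw [if_neg hij] at h3
  have e : ⟪W • q i j + V i • p j + V j • p i, p l⟫ =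
      (1 / 2) * (W * (⟪p j, q i l⟫ + ⟪q i j, p l⟫ - 0 * (2 * ⟪q i k, p k⟫)) +
        W * (⟪p i, q j l⟫ + ⟪q j i, p l⟫ - 0 * (2 * ⟪q j k, p k⟫)) -
        W * (⟪p i, q l j⟫ + ⟪q l i, p j⟫ - 0 * (2 * ⟪q l k, p k⟫))) +
        V i * (⟪p j, p l⟫ - 0 * ⟪p k, p k⟫) + V j * (⟪p i, p l⟫ - 0 * ⟪p k, p k⟫) := by
    simp only [inner_add_left, inner_smul_left, RCLike.conj_to_real]
    rw [hq j i, hq l j, hq l i, real_inner_comm (p j) (q i l)]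
    ring
  rw [e, abs_le]
  constructor <;> linarith

omit [DecidableEq ι] in
/-- A vector whose inner products with a nearly conformal frame are small is small. -/
lemma norm_le_of_abs_inner_frame_le {p f : ι → F} {m δ D : ℝ} (hm : 0 < m) {s : F} (hD : 0 ≤ D)
    (hf : m ^ 2 * ‖s‖ ^ 2 ≤ ∑ l, ⟪s, f l⟫ ^ 2) (hpf : ∀ l, ‖p l - f l‖ ≤ δ)
    (hδ : 4 * Fintype.card ι * δ ^ 2 ≤ m ^ 2) (hs : ∀ l, |⟪s, p l⟫| ≤ D) :
    ‖s‖ ≤ 2 * Fintype.card ι / m * D := by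
  have h1 : ∀ l, ⟪s, f l⟫ ^ 2 ≤ 2 * D ^ 2 + 2 * (δ ^ 2 * ‖s‖ ^ 2) := by
    intro l
    have e : ⟪s, f l⟫ = ⟪s, p l⟫ - ⟪s, p l - f l⟫ := by rw [inner_sub_right]; ring
    have a1 : ⟪s, p l⟫ ^ 2 ≤ D ^ 2 := by
      rw [← sq_abs]; exact pow_le_pow_left₀ (abs_nonneg _) (hs l) 2
    have a2 : ⟪s, p l - f l⟫ ^ 2 ≤ δ ^ 2 * ‖s‖ ^ 2 := by
      rw [← sq_abs, ← mul_pow]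
      refine pow_le_pow_left₀ (abs_nonneg _) ((abs_real_inner_le_norm _ _).trans ?_) 2
      rw [mul_comm]
      exact mul_le_mul_of_nonneg_right (hpf l) (norm_nonneg _)
    rw [e]
    nlinarith [sq_nonneg (⟪s, p l⟫ + ⟪s, p l - f l⟫)]
  have h2 := hf.trans (Finset.sum_le_sum fun l _ => h1 l)
  rw [Finset.sum_const, Finset.card_univ, nsmul_eq_mul] at h2
  set N : ℝ := (Fintype.card ι : ℝ)
  have hN : N = 0 ∨ 1 ≤ N := by
    rcases Nat.eq_zero_or_pos (Fintype.card ι) with h | h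
    · left; simp [N, h]
    · right; exact Nat.one_le_cast.2 h
  have h3 : m ^ 2 * ‖s‖ ^ 2 ≤ 4 * N * D ^ 2 := by
    have := mul_le_mul_of_nonneg_right hδ (sq_nonneg ‖s‖)
    nlinarith
  have h4 : m ^ 2 * ‖s‖ ^ 2 ≤ (2 * N * D) ^ 2 := by
    rcases hN with h | h
    · rw [h] at h3 ⊢; simpa using h3
    · nlinarith [mul_nonneg (mul_nonneg (by linarith : (0:ℝ) ≤ N) (sub_nonneg.2 h)) (sq_nonneg D)]
  have h5 : m * ‖s‖ ≤ 2 * N * D := by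
    rw [← mul_pow] at h4
    refine (pow_le_pow_iff_left₀ (by positivity) ?_ two_ne_zero).1 h4
    rcases hN with h | h
    · simp [h]
    · have : 0 ≤ N := by linarith
      positivity
  rw [div_mul_eq_mul_div, le_div_iff₀ hm]
  linarith

end PointwiseDefect

section ConformalWeight

variable {F : Type*} [NormedAddCommGroup F] [InnerProductSpace ℝ F]
  [FiniteDimensional ℝ F] [MeasurableSpace F] [BorelSpace F] {ι : Type*} [Fintype ι]

/-- A smooth positive function equal to the inverse of the norm of the `b k`-derivative of `g`
where the cutoff `η` is one. -/
noncomputable def confWeight (b : OrthonormalBasis ι ℝ F) (k : ι) (η : F → ℝ) (g : F → F)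
    (x : F) : ℝ :=
  (√(⟪dirDeriv (b k) g x, dirDeriv (b k) g x⟫ + (1 - η x)))⁻¹

/-- The off-diagonal part of the Hessian of `g`, corrected by the derivatives of the weight `W`.
It vanishes for Möbius transformations `g` with inverse conformal factor `W`. -/
noncomputable def offDiagHess (b : OrthonormalBasis ι ℝ F) (W : F → ℝ) (g : F → F) (i j : ι)
    (x : F) : F :=
  W x • dirDeriv (b i) (dirDeriv (b j) g) x + dirDeriv (b i) W x • dirDeriv (b j) g x +
    dirDeriv (b j) W x • dirDeriv (b i) g x

variable [DecidableEq ι]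

namespace ConformalApprox

variable {b : OrthonormalBasis ι ℝ F} {f : F → F} {η : F → ℝ} {g : ℕ → F → F} {m M C : ℝ}

omit [MeasurableSpace F] [BorelSpace F] [DecidableEq ι] [FiniteDimensional ℝ F] in
lemma confWeight_eq_inv {k : ι} {u : F → F} {x : F} (hx : η x = 1) :
    confWeight b k η u x = ‖dirDeriv (b k) u x‖⁻¹ := by
  unfold confWeight
  rw [hx, sub_self, add_zero, real_inner_self_eq_norm_sq, Real.sqrt_sq (norm_nonneg _)]

omit [DecidableEq ι] in
lemma norm_fderiv_apply_basis (h : ConformalApprox b f η g m M C) {x : F} (hx : x ∈ tsupport η)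
    (k : ι) : ‖fderiv ℝ f x (b k)‖ = ‖fderiv ℝ f x‖ := by
  have := h.inner_eq x hx (b k) (b k)
  rw [real_inner_self_eq_norm_sq, real_inner_self_eq_norm_sq, b.norm_eq_one, one_pow, mul_one] at this
  exact (pow_left_inj₀ (norm_nonneg _) (norm_nonneg _) two_ne_zero).1 this

omit [DecidableEq ι] in
lemma sq_mul_norm_sq_le_sum (h : ConformalApprox b f η g m M C) {x : F} (hx : x ∈ tsupport η)
    (s : F) : m ^ 2 * ‖s‖ ^ 2 ≤ ∑ l, ⟪s, fderiv ℝ f x (b l)⟫ ^ 2 := by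
  have hm := h.pos
  have hl := h.le_norm x hx
  have hinner := h.inner_eq x hx
  set A := fderiv ℝ f x
  have hnorm : ∀ u, ‖A u‖ ^ 2 = ‖A‖ ^ 2 * ‖u‖ ^ 2 := fun u => by
    have := hinner u u
    rwa [real_inner_self_eq_norm_sq, real_inner_self_eq_norm_sq] at this
  have hinj : Function.Injective (A : F →ₗ[ℝ] F) := by
    rw [injective_iff_map_eq_zero]
    intro u hu
    have h1 := hnorm u
    have h2 : A u = 0 := hu
    rw [h2, norm_zero] at h1
    have h3 : ‖u‖ ^ 2 = 0 := by
      have : 0 < ‖A‖ ^ 2 := by have : 0 < ‖A‖ := by linarith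
                               positivity
      nlinarith [sq_nonneg ‖u‖]
    simpa using h3
  obtain ⟨t, ht⟩ := LinearMap.surjective_of_injective hinj s
  have ht : A t = s := ht
  have h1 : ∑ l, ⟪s, A (b l)⟫ ^ 2 = ‖A‖ ^ 2 * ‖s‖ ^ 2 := by
    rw [← ht, hnorm, ← b.sum_sq_norm_inner_left t, Finset.mul_sum, Finset.mul_sum]
    refine Finset.sum_congr rfl fun l _ => ?_
    rw [hinner, Real.norm_eq_abs, sq_abs]; ring
  rw [h1]
  gcongr

omit [DecidableEq ι] in
lemma exists_le_norm_dirDeriv (h : ConformalApprox b f η g m M C) :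
    ∃ N : ℕ, ∀ n ≥ N, 4 * Fintype.card ι * (1 / ((n : ℝ) + 1)) ^ 2 ≤ m ^ 2 ∧
      ∀ x ∈ tsupport η, ∀ k, m / 2 ≤ ‖dirDeriv (b k) (g n) x‖ := by
  have hm := h.pos
  obtain ⟨N, hN⟩ := exists_nat_one_div_lt (show (0 : ℝ) <
    m / (4 * (Fintype.card ι + 1)) by positivity)
  refine ⟨N, fun n hn => ?_⟩
  have h1 : 1 / ((n : ℝ) + 1) ≤ m / (4 * (Fintype.card ι + 1)) :=
    (Nat.one_div_le_one_div hn).trans hN.le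
  have hc : (0 : ℝ) ≤ Fintype.card ι := Nat.cast_nonneg _
  have h2 : 1 / ((n : ℝ) + 1) ≤ m / 4 := by
    refine h1.trans ?_
    gcongr; linarith
  constructor
  · have h0 : (0 : ℝ) ≤ 1 / ((n : ℝ) + 1) := by positivity
    rw [le_div_iff₀ (by positivity)] at h1
    nlinarith [mul_nonneg hc h0]
  · intro x hx k
    have h3 := h.norm_dirDeriv_sub_le n x k
    have h4 := h.norm_fderiv_apply_basis hx k
    have h5 := h.le_norm x hx
    have h6 := norm_le_norm_add_norm_sub (dirDeriv (b k) (g n) x) (fderiv ℝ f x (b k))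
    linarith

omit [DecidableEq ι] in
lemma contDiff_confWeight (h : ConformalApprox b f η g m M C) {n : ℕ} {k : ι}
    (hn : ∀ x ∈ tsupport η, m / 2 ≤ ‖dirDeriv (b k) (g n) x‖) :
    ContDiff ℝ ∞ (confWeight b k η (g n)) := by
  have hpos : ∀ x, 0 < ⟪dirDeriv (b k) (g n) x, dirDeriv (b k) (g n) x⟫ + (1 - η x) := by
    intro x
    rw [real_inner_self_eq_norm_sq]
    by_cases hx : x ∈ tsupport η
    · have := h.pos
      have h1 : 0 < ‖dirDeriv (b k) (g n) x‖ := by linarith [hn x hx]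
      have := h.cutoff_le_one x
      nlinarith [pow_pos h1 2]
    · rw [image_eq_zero_of_notMem_tsupport hx]; positivity
  have hg := (h.smooth n).dirDeriv (b k)
  refine ContDiff.inv (ContDiff.sqrt ?_ fun x => (hpos x).ne') fun x => (Real.sqrt_pos.2 (hpos x)).ne'
  exact (hg.inner ℝ hg).add (contDiff_const.sub h.smooth_cutoff)

omit [DecidableEq ι] in
lemma dirDeriv_confWeight (h : ConformalApprox b f η g m M C) {n : ℕ} {k : ι}
    (hn : ∀ x ∈ tsupport η, m / 2 ≤ ‖dirDeriv (b k) (g n) x‖) {x : F} (hx : η =ᶠ[𝓝 x] 1)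
    (v : F) : dirDeriv v (confWeight b k η (g n)) x = - confWeight b k η (g n) x ^ 3 *
      ⟪dirDeriv v (dirDeriv (b k) (g n)) x, dirDeriv (b k) (g n) x⟫ := by
  have hW := (h.contDiff_confWeight hn).smoothDifferentiableAt x
  have hp := ((h.smooth n).dirDeriv (b k)).smoothDifferentiableAt x
  have h1 : (fun y => (confWeight b k η (g n) y * confWeight b k η (g n) y) *
      ⟪dirDeriv (b k) (g n) y, dirDeriv (b k) (g n) y⟫) =ᶠ[𝓝 x] fun _ => (1 : ℝ) := by
    filter_upwards [hx] with y hy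
    have hy' : y ∈ tsupport η := subset_tsupport _ (by simp [Function.mem_support, hy])
    have h0 : ‖dirDeriv (b k) (g n) y‖ ≠ 0 := by
      have := hn y hy'; have := h.pos; intro h; linarith
    rw [confWeight_eq_inv hy, real_inner_self_eq_norm_sq]
    field_simp
  have h2 := dirDeriv_congr h1 v
  have h3 := h1.eq_of_nhds
  rw [dirDeriv_const, dirDeriv_mul (hW.fun_mul hW) (hp.inner ℝ hp), dirDeriv_mul hW hW,
    dirDeriv_inner hp hp, real_inner_comm] at h2
  set W := confWeight b k η (g n) x
  linear_combination (- dirDeriv v (confWeight b k η (g n)) x) * h3 + W / 2 * h2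

/-- Uniform pointwise bounds for the weight and the off-diagonal Hessian of a conformal
approximation. -/
lemma exists_bounds (h : ConformalApprox b f η g m M C) (k : ι) : ∃ (K : ℝ) (N : ℕ), 1 ≤ K ∧
    ∀ n ≥ N, ContDiff ℝ ∞ (confWeight b k η (g n)) ∧ ∀ x, η =ᶠ[𝓝 x] 1 →
      confWeight b k η (g n) x ^ 2 * ⟪dirDeriv (b k) (g n) x, dirDeriv (b k) (g n) x⟫ = 1 ∧
      |confWeight b k η (g n) x| ≤ K ∧ (∀ a, ‖dirDeriv (b a) (g n) x‖ ≤ K) ∧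
      (∀ a, |dirDeriv (b a) (confWeight b k η (g n)) x| ≤ K * √(hessSq b (g n) x)) ∧
      (∀ a c, |confDefect b k (g n) a c x| ≤ K * (1 / ((n : ℝ) + 1))) ∧
      ∀ i j, i ≠ j → ‖offDiagHess b (confWeight b k η (g n)) (g n) i j x‖ ≤
        K * (√(defectSq b k (g n) x) + 1 / ((n : ℝ) + 1) * √(hessSq b (g n) x)) := by
  obtain ⟨N, hN⟩ := h.exists_le_norm_dirDeriv
  have hm := h.pos
  set w := 2 / m with hw
  have hw0 : 0 < w := by positivity
  set P := |M| + 1 with hP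
  have hP1 : 1 ≤ P := by linarith [abs_nonneg M]
  set c₁ := 2 * (2 * |M| + 1) with hc₁
  have hc₁0 : 0 ≤ c₁ := by positivity
  set Q := 2 * (Fintype.card ι : ℝ) / m with hQ
  have hQ0 : 0 ≤ Q := by positivity
  set K := 1 + w + P + w ^ 3 * P + c₁ + Q * (2 * w) + Q * (2 * (w ^ 3 * P) * c₁) with hK
  have p1 : 0 ≤ w ^ 3 * P := by positivity
  have p2 : 0 ≤ Q * (2 * w) := by positivity
  have p3 : 0 ≤ Q * (2 * (w ^ 3 * P) * c₁) := by positivity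
  refine ⟨K, N, by linarith, fun n hn => ?_⟩
  obtain ⟨hn1, hn2⟩ := hN n hn
  have hnk := fun x hx => hn2 x hx k
  refine ⟨h.contDiff_confWeight hnk, fun x hx => ?_⟩
  set W := confWeight b k η (g n) with hWdef
  set δ := 1 / ((n : ℝ) + 1) with hδ
  have hδ0 : 0 ≤ δ := by positivity
  have hx1 : η x = 1 := hx.eq_of_nhds
  have hxt : x ∈ tsupport η := subset_tsupport _ (by simp [Function.mem_support, hx1])
  have hM : M ≤ |M| := le_abs_self M
  have hpk := hnk x hxt
  have hWx : W x = ‖dirDeriv (b k) (g n) x‖⁻¹ := confWeight_eq_inv hx1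
  have b1 : W x ^ 2 * ⟪dirDeriv (b k) (g n) x, dirDeriv (b k) (g n) x⟫ = 1 := by
    rw [hWx, real_inner_self_eq_norm_sq]
    have : ‖dirDeriv (b k) (g n) x‖ ≠ 0 := by intro h0; linarith
    field_simp
  have b2 : |W x| ≤ w := by
    rw [hWx, abs_inv, abs_norm, hw, ← inv_div]
    exact inv_anti₀ (by positivity) hpk
  have b3 : ∀ a, ‖dirDeriv (b a) (g n) x‖ ≤ P := fun a => by
    linarith [h.norm_dirDeriv_le n hxt a]
  have hq : ∀ a c, ‖dirDeriv (b a) (dirDeriv (b c) (g n)) x‖ ≤ √(hessSq b (g n) x) := fun a c =>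
    Real.le_sqrt_of_sq_le (norm_dirDeriv_dirDeriv_sq_le b _ x a c)
  have hV := fun a => h.dirDeriv_confWeight hnk hx (b a)
  have b4 : ∀ a, |dirDeriv (b a) W x| ≤ w ^ 3 * P * √(hessSq b (g n) x) := by
    intro a
    rw [hV a, abs_mul, abs_neg, abs_pow]
    calc _ ≤ w ^ 3 * (√(hessSq b (g n) x) * P) := by
          gcongr
          exact (abs_real_inner_le_norm _ _).trans (mul_le_mul (hq _ _) (b3 k) (norm_nonneg _)
            (Real.sqrt_nonneg _))
      _ = _ := by ring
  have b5 : ∀ a c, |confDefect b k (g n) a c x| ≤ c₁ * δ := by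
    intro a c
    refine (h.abs_confDefect_le k n hxt a c).trans ?_
    exact mul_le_mul_of_nonneg_right (by linarith) hδ0
  have hT : ∀ l i j, |dirDeriv (b l) (confDefect b k (g n) i j) x| ≤ √(defectSq b k (g n) x) :=
    fun l i j => Real.abs_le_sqrt (dirDeriv_confDefect_sq_le b k (g n) x l i j)
  have hH := Real.sqrt_nonneg (hessSq b (g n) x)
  have hT0 := Real.sqrt_nonneg (defectSq b k (g n) x)
  refine ⟨b1, by linarith, fun a => by linarith [b3 a], fun a => (b4 a).trans ?_,
    fun a c => (b5 a c).trans ?_, fun i j hij => ?_⟩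
  · gcongr; linarith
  · gcongr; linarith
  have b6 := fun l => abs_inner_offDiagonal_le (p := fun a => dirDeriv (b a) (g n) x)
    (q := fun a c => dirDeriv (b a) (dirDeriv (b c) (g n)) x)
    (fun a c => dirDeriv_comm (h.smooth n) _ _ _) b1 b2 (V := fun a => dirDeriv (b a) W x) hV b4
    (fun l i j => by rw [← dirDeriv_confDefect b k (h.smooth n)]; exact hT l i j) b5 hij l
  have b7 := norm_le_of_abs_inner_frame_le (p := fun a => dirDeriv (b a) (g n) x)
    (f := fun a => fderiv ℝ f x (b a)) hm (s := offDiagHess b W (g n) i j x) (by positivity)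
    (h.sq_mul_norm_sq_le_sum hxt _) (fun l => h.norm_dirDeriv_sub_le n x l) hn1 b6
  refine b7.trans ?_
  calc _ = (Q * (2 * w)) * √(defectSq b k (g n) x) +
        (Q * (2 * (w ^ 3 * P) * c₁)) * (δ * √(hessSq b (g n) x)) := by ring
    _ ≤ K * √(defectSq b k (g n) x) + K * (δ * √(hessSq b (g n) x)) := by
        gcongr <;> linarith
    _ = _ := by ring

end ConformalApprox

end ConformalWeight

section WeakHessian

variable {F : Type*} [NormedAddCommGroup F] [InnerProductSpace ℝ F]
  [FiniteDimensional ℝ F] [MeasurableSpace F] [BorelSpace F] {ι : Type*} [Fintype ι]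
  [DecidableEq ι]

namespace ConformalApprox

variable {b : OrthonormalBasis ι ℝ F} {f : F → F} {η : F → ℝ} {g : ℕ → F → F} {m M C : ℝ}

/-- Integrals controlled by the conformality defect are eventually small. -/
lemma exists_abs_integral_le (h : ConformalApprox b f η g m M C) (k : ι) (K : ℝ) {ε : ℝ}
    (hε : 0 < ε) : ∃ N : ℕ, ∀ n ≥ N, ∀ R : F → ℝ, (∀ x, |R x| ≤ K * (η x *
      (1 / ((n : ℝ) + 1) * (1 + √(hessSq b (g n) x)) ^ 2 +
        √(defectSq b k (g n) x) * (1 + √(hessSq b (g n) x))))) → |∫ x, R x| ≤ ε := by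
  have hi : ∀ q : F → ℝ, Continuous q → Integrable (fun x => η x * q x) := fun q hq =>
    (h.smooth_cutoff.continuous.mul hq).integrable_of_hasCompactSupport h.compact_cutoff.mul_right
  have hC0 : 0 ≤ C := (integral_nonneg fun x => mul_nonneg (h.cutoff_nonneg x)
    (hessSq_nonneg b _ x)).trans (h.energy 0)
  have hη0 : 0 ≤ ∫ x, η x := integral_nonneg h.cutoff_nonneg
  have hηi : Integrable η :=
    h.smooth_cutoff.continuous.integrable_of_hasCompactSupport h.compact_cutoff
  set K' := |K| + 1 with hK'
  have hK'0 : 0 < K' := by positivity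
  set S := (∫ x, η x) + C + 1 with hS
  have hS0 : 0 < S := by positivity
  set t := ε / (8 * K' * S) with ht
  have ht0 : 0 < t := by positivity
  obtain ⟨N₁, hN₁⟩ := exists_nat_one_div_lt ht0
  obtain ⟨N₂, hN₂⟩ := eventually_atTop.1 ((h.tendsto_integral_defectSq k).eventually
    (ge_mem_nhds (show (0 : ℝ) < t * ε / (2 * K') by positivity)))
  refine ⟨max N₁ N₂, fun n hn R hR => ?_⟩
  set δ := 1 / ((n : ℝ) + 1) with hδ
  have hδ0 : 0 ≤ δ := by positivity
  have hδt : δ ≤ t := (Nat.one_div_le_one_div ((le_max_left _ _).trans hn)).trans hN₁.le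
  have hT := hN₂ n ((le_max_right _ _).trans hn)
  have cH := continuous_hessSq b (h.smooth n)
  have cT := continuous_defectSq b k (h.smooth n)
  have hb : ∀ x, ‖R x‖ ≤ K' * ((4 * t) * (η x + η x * hessSq b (g n) x) +
      1 / t * (η x * defectSq b k (g n) x)) := by
    intro x
    have hη := h.cutoff_nonneg x
    set u := √(hessSq b (g n) x) with hu
    set τ := √(defectSq b k (g n) x) with hτ
    have hu2 : u ^ 2 = hessSq b (g n) x := Real.sq_sqrt (hessSq_nonneg _ _ _)
    have hτ2 : τ ^ 2 = defectSq b k (g n) x := Real.sq_sqrt (defectSq_nonneg _ _ _ _)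
    have hu0 : 0 ≤ u := Real.sqrt_nonneg _
    have hτ0 : 0 ≤ τ := Real.sqrt_nonneg _
    rw [← hu2, ← hτ2]
    have h1 : τ * (1 + u) ≤ 1 / t * τ ^ 2 + t * (1 + u) ^ 2 := by
      have h1 : 1 / t * τ ^ 2 + t * (1 + u) ^ 2 - 2 * (τ * (1 + u)) =
          1 / t * (τ - t * (1 + u)) ^ 2 := by field_simp; ring
      have h2 : 0 ≤ 1 / t * (τ - t * (1 + u)) ^ 2 := by positivity
      have h3 : 0 ≤ τ * (1 + u) := by positivity
      linarith
    have h2 : (1 + u) ^ 2 ≤ 2 * (1 + u ^ 2) := by nlinarith [sq_nonneg (u - 1)]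
    have h3 : δ * (1 + u) ^ 2 + τ * (1 + u) ≤ 4 * t * (1 + u ^ 2) + 1 / t * τ ^ 2 := by
      have := mul_le_mul hδt h2 (by positivity) ht0.le
      nlinarith
    have h4 : 0 ≤ η x * (δ * (1 + u) ^ 2 + τ * (1 + u)) := by positivity
    calc ‖R x‖ ≤ K * (η x * (δ * (1 + u) ^ 2 + τ * (1 + u))) := hR x
      _ ≤ K' * (η x * (δ * (1 + u) ^ 2 + τ * (1 + u))) := by
          gcongr; linarith [le_abs_self K]
      _ ≤ K' * (η x * (4 * t * (1 + u ^ 2) + 1 / t * τ ^ 2)) := by gcongr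
      _ = _ := by ring
  have i1 := hi _ cH
  have i2 := hi _ cT
  have := norm_integral_le_of_norm_le ((((hηi.add i1).const_mul (4 * t)).add
    (i2.const_mul (1 / t))).const_mul K') (ae_of_all _ hb)
  rw [Real.norm_eq_abs] at this
  refine this.trans ?_
  have i3 : Integrable (fun x => η x + η x * hessSq b (g n) x) := hηi.add i1
  simp only [Pi.add_apply]
  rw [integral_const_mul, integral_add (i3.const_mul _) (i2.const_mul _),
    integral_const_mul, integral_const_mul, integral_add hηi i1]
  have j1 := h.energy n
  have j2 : (∫ x, η x) + ∫ x, η x * hessSq b (g n) x ≤ S := by linarith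
  calc _ ≤ K' * (4 * t * S + 1 / t * (t * ε / (2 * K'))) := by gcongr
    _ = ε := by rw [ht]; field_simp; ring

omit [MeasurableSpace F] [BorelSpace F] [FiniteDimensional ℝ F] in
/-- The key pointwise commutator identity. -/
lemma commutator_identity {G : F → F} {W ξ : F → ℝ} (hG : ContDiff ℝ ∞ G) (hW : ContDiff ℝ ∞ W)
    (hξ : ContDiff ℝ ∞ ξ) {i j k : ι} (hik : i ≠ k)
    (hWξ : ∀ x, W x * W x * ξ x * ⟪dirDeriv (b k) G x, dirDeriv (b k) G x⟫ = ξ x) (x : F) :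
    dirDeriv (b j) W x * dirDeriv (b i) ξ x -
      (dirDeriv (b k) (fun y => ⟪dirDeriv (b i) (fun z => W z • dirDeriv (b j) G z) y,
          (W y * W y * ξ y) • dirDeriv (b k) G y⟫) x -
        dirDeriv (b i) (fun y => ⟪dirDeriv (b k) (fun z => W z • dirDeriv (b j) G z) y,
          (W y * W y * ξ y) • dirDeriv (b k) G y⟫) x) =
      dirDeriv (b j) W x * dirDeriv (b k) (fun y => (W y * W y * ξ y) * confDefect b k G i k y) x -
      ⟪offDiagHess b W G i j x, dirDeriv (b k) (fun y => (W y * W y * ξ y) • dirDeriv (b k) G y) x⟫ +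
      ⟪offDiagHess b W G k j x, dirDeriv (b i) (fun y => (W y * W y * ξ y) • dirDeriv (b k) G y) x⟫ := by
  have hω : ContDiff ℝ ∞ (fun y => W y * W y * ξ y) := (hW.mul hW).mul hξ
  have hζ : ContDiff ℝ ∞ (fun y => (W y * W y * ξ y) • dirDeriv (b k) G y) :=
    hω.smul (hG.dirDeriv (b k))
  have hP : ContDiff ℝ ∞ (fun z => W z • dirDeriv (b j) G z) := hW.smul (hG.dirDeriv (b j))
  set ζ := fun y => (W y * W y * ξ y) • dirDeriv (b k) G y with hζdef
  have hd : ∀ {u : F → ℝ}, ContDiff ℝ ∞ u → DifferentiableAt ℝ u x :=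
    fun hu => hu.smoothDifferentiableAt x
  have hv : ∀ {u : F → F}, ContDiff ℝ ∞ u → DifferentiableAt ℝ u x :=
    fun hu => hu.smoothDifferentiableAt x
  have e1 : ∀ a, dirDeriv (b a) (fun z => W z • dirDeriv (b j) G z) x =
      offDiagHess b W G a j x - dirDeriv (b j) W x • dirDeriv (b a) G x := by
    intro a
    rw [dirDeriv_smul (hd hW) (hv (hG.dirDeriv (b j)))]
    unfold offDiagHess; abel
  have e2 : (fun y => ⟪dirDeriv (b k) G y, ζ y⟫) = ξ := by
    funext y
    simp only [hζdef, inner_smul_right]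
    exact hWξ y
  have e3 : (fun y => ⟪dirDeriv (b i) G y, ζ y⟫) =
      fun y => (W y * W y * ξ y) * confDefect b k G i k y := by
    funext y
    simp only [hζdef, inner_smul_right, confDefect, if_neg hik]
    ring
  have e4 := dirDeriv_inner (hv (hG.dirDeriv (b k))) (hv hζ) (b i)
  have e5 := dirDeriv_inner (hv (hG.dirDeriv (b i))) (hv hζ) (b k)
  rw [e2] at e4
  rw [e3] at e5
  rw [dirDeriv_inner (hv (hP.dirDeriv (b i))) (hv hζ),
    dirDeriv_inner (hv (hP.dirDeriv (b k))) (hv hζ), dirDeriv_comm hP (b k) (b i), e1, e1, e4, e5,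
    dirDeriv_comm hG (b k) (b i)]
  simp only [inner_sub_left, inner_smul_left, RCLike.conj_to_real]
  ring

/-- The derivatives of the weight have asymptotically vanishing off-diagonal distributional
derivatives. -/
lemma exists_abs_integral_dirDeriv_weight_le (h : ConformalApprox b f η g m M C) {i j k : ι}
    (hik : i ≠ k) (hij : i ≠ j) (hkj : k ≠ j) (A : ℝ) {ε : ℝ} (hε : 0 < ε) :
    ∃ N : ℕ, ∀ n ≥ N, ∀ ξ : F → ℝ, ContDiff ℝ ∞ ξ → HasCompactSupport ξ →
      (∀ x ∈ tsupport ξ, η =ᶠ[𝓝 x] 1) → (∀ x, |ξ x| ≤ A) →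
      (∀ x a, |dirDeriv (b a) ξ x| ≤ A) →
      |∫ x, dirDeriv (b j) (confWeight b k η (g n)) x * dirDeriv (b i) ξ x| ≤ ε := by
  obtain ⟨K, N₀, hK1, hN₀⟩ := h.exists_bounds k
  obtain ⟨N₁, hN₁⟩ := h.exists_abs_integral_le k (8 * A * K ^ 4) hε
  refine ⟨max N₀ N₁, fun n hn ξ hξ hξc hξη hξA hdξA => ?_⟩
  obtain ⟨hW, hbd⟩ := hN₀ n ((le_max_left _ _).trans hn)
  have hG := h.smooth n
  set W := confWeight b k η (g n) with hWdef
  set G := g n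
  have hA : 0 ≤ A := (abs_nonneg _).trans (hξA 0)
  have hω : ContDiff ℝ ∞ (fun y => W y * W y * ξ y) := (hW.mul hW).mul hξ
  have hωc : HasCompactSupport (fun y => W y * W y * ξ y) := hξc.mul_left
  have hζ : ContDiff ℝ ∞ (fun y => (W y * W y * ξ y) • dirDeriv (b k) G y) :=
    hω.smul (hG.dirDeriv (b k))
  have hζc : HasCompactSupport (fun y => (W y * W y * ξ y) • dirDeriv (b k) G y) := hωc.smul_right
  have hP : ContDiff ℝ ∞ (fun z => W z • dirDeriv (b j) G z) := hW.smul (hG.dirDeriv (b j))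
  have hWξ : ∀ x, W x * W x * ξ x * ⟪dirDeriv (b k) G x, dirDeriv (b k) G x⟫ = ξ x := by
    intro x
    by_cases hx : x ∈ tsupport ξ
    · linear_combination ξ x * (hbd x (hξη x hx)).1
    · simp [image_eq_zero_of_notMem_tsupport hx]
  have hD : ∀ a c, ContDiff ℝ ∞ (fun y => ⟪dirDeriv (b a) (fun z => W z • dirDeriv (b c) G z) y,
      (W y * W y * ξ y) • dirDeriv (b k) G y⟫) := fun a c =>
    ((hW.smul (hG.dirDeriv (b c))).dirDeriv (b a)).inner ℝ hζ
  have hDc : ∀ a c, HasCompactSupport (fun y => ⟪dirDeriv (b a) (fun z => W z • dirDeriv (b c) G z) y,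
      (W y * W y * ξ y) • dirDeriv (b k) G y⟫) := fun a c => by
    refine hζc.mono' ?_
    refine Function.support_subset_iff'.2 fun x hx => ?_
    rw [image_eq_zero_of_notMem_tsupport hx, inner_zero_right]
  have hDi : ∀ v a c, Integrable (dirDeriv v (fun y => ⟪dirDeriv (b a) (fun z => W z • dirDeriv (b c) G z) y,
      (W y * W y * ξ y) • dirDeriv (b k) G y⟫)) := fun v a c =>
    ((hD a c).dirDeriv v).continuous.integrable_of_hasCompactSupport ((hDc a c).dirDeriv v)
  have hintegrable : Integrable (fun x => dirDeriv (b j) W x * dirDeriv (b i) ξ x) :=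
    ((hW.dirDeriv _).continuous.mul (hξ.dirDeriv _).continuous).integrable_of_hasCompactSupport
      (hξc.dirDeriv _).mul_left
  have key : ∫ x, dirDeriv (b j) W x * dirDeriv (b i) ξ x = ∫ x, (dirDeriv (b j) W x * dirDeriv (b i) ξ x -
      (dirDeriv (b k) (fun y => ⟪dirDeriv (b i) (fun z => W z • dirDeriv (b j) G z) y,
          (W y * W y * ξ y) • dirDeriv (b k) G y⟫) x -
        dirDeriv (b i) (fun y => ⟪dirDeriv (b k) (fun z => W z • dirDeriv (b j) G z) y,
          (W y * W y * ξ y) • dirDeriv (b k) G y⟫) x)) := by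
    rw [integral_sub hintegrable (by exact (hDi _ _ _).sub (hDi _ _ _)), integral_sub (hDi _ _ _) (hDi _ _ _),
      integral_dirDeriv_eq_zero ((hD _ _).of_le (by simp)) (hDc _ _),
      integral_dirDeriv_eq_zero ((hD _ _).of_le (by simp)) (hDc _ _)]
    ring
  rw [key]
  refine hN₁ n ((le_max_right _ _).trans hn) _ fun x => ?_
  rw [commutator_identity hG hW hξ hik hWξ x]
  have hd : ∀ {u : F → ℝ}, ContDiff ℝ ∞ u → DifferentiableAt ℝ u x :=
    fun hu => hu.smoothDifferentiableAt x
  have hv : ∀ {u : F → F}, ContDiff ℝ ∞ u → DifferentiableAt ℝ u x :=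
    fun hu => hu.smoothDifferentiableAt x
  rw [dirDeriv_mul (hd hω) (hd (contDiff_confDefect b k hG i k)),
    dirDeriv_smul (hd hω) (hv (hG.dirDeriv (b k))), dirDeriv_smul (hd hω) (hv (hG.dirDeriv (b k)))]
  by_cases hx : x ∈ tsupport ξ
  swap
  · have h0 : (fun y => W y * W y * ξ y) x = 0 := by simp [image_eq_zero_of_notMem_tsupport hx]
    have h1 : ∀ a, dirDeriv (b a) (fun y => W y * W y * ξ y) x = 0 := fun a => by
      rw [dirDeriv_mul (hd (hW.mul hW)) (hd hξ), image_eq_zero_of_notMem_tsupport hx,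
        image_eq_zero_of_notMem_tsupport (fun h' => hx (tsupport_dirDeriv_subset _ h'))]
      simp
    simp only at h0
    simp only [h0, h1, zero_smul, zero_mul, add_zero, inner_zero_right, mul_zero, sub_zero, abs_zero]
    have := h.cutoff_nonneg x
    positivity
  obtain ⟨-, b1, b2, b3, b4, b5⟩ := hbd x (hξη x hx)
  have hη1 : η x = 1 := (hξη x hx).eq_of_nhds
  set u := √(hessSq b G x) with hu
  set τ := √(defectSq b k G x) with hτ
  set δ := 1 / ((n : ℝ) + 1) with hδ
  have hδ0 : 0 ≤ δ := by positivity
  have hu0 : 0 ≤ u := Real.sqrt_nonneg _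
  have hτ0 : 0 ≤ τ := Real.sqrt_nonneg _
  have hq : ∀ a c, ‖dirDeriv (b a) (dirDeriv (b c) G) x‖ ≤ u := fun a c =>
    Real.le_sqrt_of_sq_le (norm_dirDeriv_dirDeriv_sq_le b _ x a c)
  have hT : ∀ l i j, |dirDeriv (b l) (confDefect b k G i j) x| ≤ τ :=
    fun l i j => Real.abs_le_sqrt (dirDeriv_confDefect_sq_le b k G x l i j)
  have hK0 : 0 ≤ K := by linarith
  have hω1 : |W x * W x * ξ x| ≤ K * K * A := by
    rw [abs_mul, abs_mul]
    gcongr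
    exact hξA x
  have hω2 : ∀ a, |dirDeriv (b a) (fun y => W y * W y * ξ y) x| ≤ 2 * K ^ 2 * A * (1 + u) := by
    intro a
    rw [dirDeriv_mul (hd (hW.mul hW)) (hd hξ), dirDeriv_mul (hd hW) (hd hW)]
    have c1 : |W x * W x * dirDeriv (b a) ξ x| ≤ K * K * A := by
      rw [abs_mul, abs_mul]
      gcongr
      exact hdξA x a
    have c2 : |W x * dirDeriv (b a) W x * ξ x| ≤ K * (K * u) * A := by
      rw [abs_mul, abs_mul]
      gcongr
      · exact b3 a
      · exact hξA x
    have c3 := abs_add_three (W x * W x * dirDeriv (b a) ξ x) (W x * dirDeriv (b a) W x * ξ x)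
      (W x * dirDeriv (b a) W x * ξ x)
    have c4 : W x * W x * dirDeriv (b a) ξ x + (W x * dirDeriv (b a) W x + dirDeriv (b a) W x * W x) * ξ x
      = W x * W x * dirDeriv (b a) ξ x + W x * dirDeriv (b a) W x * ξ x +
        W x * dirDeriv (b a) W x * ξ x := by ring
    rw [c4]
    have c5 : 0 ≤ K * K * A := by positivity
    linarith
  have hζ2 : ∀ a, ‖(W x * W x * ξ x) • dirDeriv (b a) (dirDeriv (b k) G) x +
      dirDeriv (b a) (fun y => W y * W y * ξ y) x • dirDeriv (b k) G x‖ ≤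
      3 * K ^ 3 * A * (1 + u) := by
    intro a
    calc _ ≤ (K * K * A) * u + (2 * K ^ 2 * A * (1 + u)) * K := by
          refine (norm_add_le _ _).trans ?_
          rw [norm_smul, norm_smul]
          refine add_le_add (mul_le_mul hω1 (hq a k) (norm_nonneg _) (by positivity))
            (mul_le_mul (hω2 a) (b2 k) (norm_nonneg _) (by positivity))
      _ ≤ (K * K * A) * (K * (1 + u)) + (2 * K ^ 2 * A * (1 + u)) * K := by
          gcongr; nlinarith
      _ = _ := by ring
  have t1 : |dirDeriv (b j) W x * (W x * W x * ξ x * dirDeriv (b k) (confDefect b k G i k) x +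
      dirDeriv (b k) (fun y => W y * W y * ξ y) x * confDefect b k G i k x)| ≤
      (K * u) * ((K * K * A) * τ + 2 * K ^ 2 * A * (1 + u) * (K * δ)) := by
    rw [abs_mul]
    refine mul_le_mul (b3 j) ((abs_add_le _ _).trans ?_) (abs_nonneg _) (by positivity)
    rw [abs_mul, abs_mul (dirDeriv _ _ _)]
    exact add_le_add (mul_le_mul hω1 (hT _ _ _) (abs_nonneg _) (by positivity))
      (mul_le_mul (hω2 k) (b4 i k) (abs_nonneg _) (by positivity))
  have t2 : ∀ a c, a ≠ j → |⟪offDiagHess b W G a j x, (W x * W x * ξ x) • dirDeriv (b c) (dirDeriv (b k) G) x +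
      dirDeriv (b c) (fun y => W y * W y * ξ y) x • dirDeriv (b k) G x⟫| ≤
      (K * (τ + δ * u)) * (3 * K ^ 3 * A * (1 + u)) := fun a c hac =>
    (abs_real_inner_le_norm _ _).trans (mul_le_mul (b5 a j hac) (hζ2 c) (norm_nonneg _)
      (by positivity))
  have t3 := t2 i k hij
  have t4 := t2 k i hkj
  refine (abs_add_le _ _).trans ((add_le_add (abs_sub _ _) le_rfl).trans ?_)
  rw [hη1, one_mul]
  refine (add_le_add (add_le_add t1 t3) t4).trans ?_
  have f1 : K ^ 3 ≤ K ^ 4 := pow_le_pow_right₀ hK1 (by norm_num)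
  have f2 : A * K ^ 3 * (u * τ) ≤ A * K ^ 4 * (u * τ) := by gcongr
  have f3 : 0 ≤ A * K ^ 4 := by positivity
  have f4 : 2 * (δ * (u * (1 + u))) + u * τ + 6 * ((τ + δ * u) * (1 + u)) ≤
      8 * (δ * (1 + u) ^ 2 + τ * (1 + u)) := by
    nlinarith [mul_nonneg hδ0 hu0, mul_nonneg hτ0 hu0]
  have f5 := mul_le_mul_of_nonneg_left f4 f3
  linarith

end ConformalApprox

end WeakHessian

section WeakHessianLimit

variable {F : Type*} [NormedAddCommGroup F] [InnerProductSpace ℝ F]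
  [FiniteDimensional ℝ F] [MeasurableSpace F] [BorelSpace F] {ι : Type*} [Fintype ι]
  [DecidableEq ι]

omit [FiniteDimensional ℝ F] [MeasurableSpace F] [BorelSpace F] in
lemma dirDeriv_dirDeriv_weight_mul (b : OrthonormalBasis ι ℝ F) {G : F → F} {W : F → ℝ}
    (hG : ContDiff ℝ ∞ G) (hW : ContDiff ℝ ∞ W) (c : F) (k : ι) {i j : ι} (hij : i ≠ j) (x : F) :
    dirDeriv (b j) (dirDeriv (b i) (fun y => W y * ⟪G y - c, G y - c⟫)) x =
      dirDeriv (b j) (dirDeriv (b i) W) x * ⟪G x - c, G x - c⟫ +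
        (2 * ⟪offDiagHess b W G i j x, G x - c⟫ + 2 * W x * confDefect b k G i j x) := by
  have hu : ContDiff ℝ ∞ (fun y => G y - c) := hG.sub contDiff_const
  have hφ : ContDiff ℝ ∞ (fun y => ⟪G y - c, G y - c⟫) := hu.inner ℝ hu
  have du : ∀ v y, dirDeriv v (fun y => G y - c) y = dirDeriv v G y := fun v y => by
    rw [dirDeriv_sub (hG.smoothDifferentiableAt y) (differentiableAt_const c), dirDeriv_const, sub_zero]
  have dφ : ∀ v y, dirDeriv v (fun y => ⟪G y - c, G y - c⟫) y = 2 * ⟪dirDeriv v G y, G y - c⟫ := by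
    intro v y
    rw [dirDeriv_inner (hu.smoothDifferentiableAt y) (hu.smoothDifferentiableAt y), du,
      real_inner_comm]
    ring
  have e1 : dirDeriv (b i) (fun y => W y * ⟪G y - c, G y - c⟫) = fun y =>
      W y * (2 * ⟪dirDeriv (b i) G y, G y - c⟫) + dirDeriv (b i) W y * ⟪G y - c, G y - c⟫ := by
    funext y
    rw [dirDeriv_mul (hW.smoothDifferentiableAt y) (hφ.smoothDifferentiableAt y), dφ]
  have hpi := hG.dirDeriv (b i)
  have h1 : ContDiff ℝ ∞ (fun y => ⟪dirDeriv (b i) G y, G y - c⟫) := hpi.inner ℝ hu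
  have h2 : ContDiff ℝ ∞ (fun y => 2 * ⟪dirDeriv (b i) G y, G y - c⟫) := contDiff_const.mul h1
  have h3 := hW.dirDeriv (b i)
  rw [e1, dirDeriv_add ((hW.mul h2).smoothDifferentiableAt x) ((h3.mul hφ).smoothDifferentiableAt x),
    dirDeriv_mul (hW.smoothDifferentiableAt x) (h2.smoothDifferentiableAt x),
    dirDeriv_mul (differentiableAt_const 2) (h1.smoothDifferentiableAt x),
    dirDeriv_mul (h3.smoothDifferentiableAt x) (hφ.smoothDifferentiableAt x), dirDeriv_const,
    dirDeriv_inner (hpi.smoothDifferentiableAt x) (hu.smoothDifferentiableAt x), du, dφ,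
    dirDeriv_comm hG (b j) (b i)]
  simp only [offDiagHess, confDefect, inner_add_left, inner_smul_left, RCLike.conj_to_real, if_neg hij]
  ring

namespace ConformalApprox

variable {b : OrthonormalBasis ι ℝ F} {f : F → F} {η : F → ℝ} {g : ℕ → F → F} {m M C : ℝ}

lemma exists_abs_integral_weight_mul_le (h : ConformalApprox b f η g m M C) (hf : Continuous f)
    {i j k : ι} (hik : i ≠ k) (hij : i ≠ j) (hkj : k ≠ j) (c : F) {ξ : F → ℝ}
    (hξ : ContDiff ℝ ∞ ξ) (hξc : HasCompactSupport ξ) (hξη : ∀ x ∈ tsupport ξ, η =ᶠ[𝓝 x] 1)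
    {ε : ℝ} (hε : 0 < ε) :
    ∃ N : ℕ, ∀ n ≥ N, |∫ x, confWeight b k η (g n) x * ⟪g n x - c, g n x - c⟫ *
      dirDeriv (b i) (dirDeriv (b j) ξ) x| ≤ ε := by
  obtain ⟨K, N₀, hK1, hN₀⟩ := h.exists_bounds k
  obtain ⟨A, hA⟩ : ∃ A : ℝ, 0 ≤ A ∧ (∀ x, |ξ x| ≤ A) ∧ ∀ x a, |dirDeriv (b a) ξ x| ≤ A := by
    obtain ⟨A₀, h0⟩ := hξc.exists_bound_of_continuous hξ.continuous
    have h1 := fun a => (hξc.dirDeriv (b a)).exists_bound_of_continuous (hξ.dirDeriv (b a)).continuous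
    choose A₁ h1 using h1
    have h2 : ∀ a, 0 ≤ A₁ a := fun a => (norm_nonneg _).trans (h1 a 0)
    have h3 : 0 ≤ A₀ := (norm_nonneg _).trans (h0 0)
    refine ⟨A₀ + ∑ a, A₁ a, add_nonneg h3 (Finset.sum_nonneg fun a _ => h2 a), fun x => ?_, fun x a => ?_⟩
    · exact (h0 x).trans (by linarith [Finset.sum_nonneg fun a (_ : a ∈ Finset.univ) => h2 a])
    · refine (h1 a x).trans ?_
      linarith [Finset.single_le_sum (fun a _ => h2 a) (Finset.mem_univ a)]
  obtain ⟨hA0, hξA, hdξA⟩ := hA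
  obtain ⟨B₀, hB₀⟩ := hξc.isCompact.exists_bound_of_continuousOn hf.continuousOn
  set B := |B₀| + 1 + ‖c‖ with hB
  have hB1 : 1 ≤ B := by linarith [abs_nonneg B₀, norm_nonneg c]
  have hK0 : 0 ≤ K := by linarith
  have hB0 : 0 ≤ B := by linarith
  obtain ⟨N₁, hN₁⟩ := h.exists_abs_integral_le k (2 * K ^ 2 * A * (B + 1)) (half_pos hε)
  obtain ⟨N₂, hN₂⟩ := h.exists_abs_integral_dirDeriv_weight_le hkj.symm hij.symm hik.symm
    (B * B * A + 2 * (K * B) * A) (half_pos hε)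
  refine ⟨max N₀ (max N₁ N₂), fun n hn => ?_⟩
  obtain ⟨hW, hbd⟩ := hN₀ n ((le_max_left _ _).trans hn)
  have hn1 := hN₁ n (((le_max_left _ _).trans (le_max_right _ _)).trans hn)
  have hn2 := hN₂ n (((le_max_right _ _).trans (le_max_right _ _)).trans hn)
  have hG := h.smooth n
  have hGB : ∀ x ∈ tsupport ξ, ‖g n x - c‖ ≤ B := by
    intro x hx
    have h1 := h.norm_sub_le n x
    have h2 := hB₀ x hx
    have h3 : 1 / ((n : ℝ) + 1) ≤ 1 := by
      rw [div_le_one (by positivity)]; linarith [n.cast_nonneg (α := ℝ)]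
    have h4 : g n x - c = (g n x - f x) + f x - c := by abel
    rw [h4]
    refine (_root_.norm_sub_le _ _).trans ?_
    have := norm_add_le (g n x - f x) (f x)
    linarith [le_abs_self B₀]
  set W := confWeight b k η (g n) with hWdef
  set G := g n
  set δ := 1 / ((n : ℝ) + 1) with hδ
  have hδ0 : 0 ≤ δ := by positivity
  have hu : ContDiff ℝ ∞ (fun y => G y - c) := hG.sub contDiff_const
  have hφ : ContDiff ℝ ∞ (fun y => ⟪G y - c, G y - c⟫) := hu.inner ℝ hu
  have hV : ContDiff ℝ ∞ (fun y => W y * ⟪G y - c, G y - c⟫) := hW.mul hφ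
  have hψ : ContDiff ℝ ∞ (fun y => ⟪G y - c, G y - c⟫ * ξ y) := hφ.mul hξ
  have hψc : HasCompactSupport (fun y => ⟪G y - c, G y - c⟫ * ξ y) := hξc.mul_left
  have dφ : ∀ v y, dirDeriv v (fun y => ⟪G y - c, G y - c⟫) y = 2 * ⟪dirDeriv v G y, G y - c⟫ := by
    intro v y
    rw [dirDeriv_inner (hu.smoothDifferentiableAt y) (hu.smoothDifferentiableAt y),
      dirDeriv_sub (hG.smoothDifferentiableAt y) (differentiableAt_const c), dirDeriv_const, sub_zero,
      real_inner_comm]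
    ring
  have hφB : ∀ x ∈ tsupport ξ, |⟪G x - c, G x - c⟫| ≤ B * B := fun x hx =>
    (abs_real_inner_le_norm _ _).trans (mul_le_mul (hGB x hx) (hGB x hx) (norm_nonneg _) hB0)
  set R := fun x => (2 * ⟪offDiagHess b W G i j x, G x - c⟫ + 2 * W x * confDefect b k G i j x) * ξ x
    with hR
  have key : ∫ x, W x * ⟪G x - c, G x - c⟫ * dirDeriv (b i) (dirDeriv (b j) ξ) x =
      - (∫ x, dirDeriv (b i) W x * dirDeriv (b j) (fun y => ⟪G y - c, G y - c⟫ * ξ y) x) +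
        ∫ x, R x := by
    have e1 := integral_dirDeriv_mul (μ := volume) hV (hξ.dirDeriv (b j)) (hξc.dirDeriv (b j)) (b i)
    have e2 := integral_dirDeriv_mul (μ := volume) (hV.dirDeriv (b i)) hξ hξc (b j)
    have e3 := integral_dirDeriv_mul (μ := volume) (hW.dirDeriv (b i)) hψ hψc (b j)
    have i1 : Integrable (fun x => dirDeriv (b j) (dirDeriv (b i) W) x * (⟪G x - c, G x - c⟫ * ξ x)) :=
      (((hW.dirDeriv _).dirDeriv _).continuous.mul hψ.continuous).integrable_of_hasCompactSupport
        hψc.mul_left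
    have i2 : Integrable (fun x => dirDeriv (b j) (dirDeriv (b i)
        (fun y => W y * ⟪G y - c, G y - c⟫)) x * ξ x) :=
      (((hV.dirDeriv _).dirDeriv _).continuous.mul hξ.continuous).integrable_of_hasCompactSupport
        hξc.mul_left
    have e4 : ∫ x, R x = (∫ x, dirDeriv (b j) (dirDeriv (b i)
        (fun y => W y * ⟪G y - c, G y - c⟫)) x * ξ x) -
        ∫ x, dirDeriv (b j) (dirDeriv (b i) W) x * (⟪G x - c, G x - c⟫ * ξ x) := by
      rw [← integral_sub i2 i1]
      congr 1 with x
      rw [dirDeriv_dirDeriv_weight_mul b hG hW c k hij x, hR]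
      ring
    linarith
  rw [key]
  have t1 := hn2 _ hψ hψc (fun x hx => hξη x (by
      refine closure_mono ?_ hx
      exact Function.support_mul_subset_right _ _)) (fun x => by
      by_cases hx : x ∈ tsupport ξ
      · rw [abs_mul]
        calc _ ≤ B * B * A := mul_le_mul (hφB x hx) (hξA x) (abs_nonneg _) (by positivity)
          _ ≤ _ := le_add_of_nonneg_right (by positivity)
      · rw [image_eq_zero_of_notMem_tsupport hx, mul_zero, abs_zero]; positivity) (fun x a => by
      rw [dirDeriv_mul (hφ.smoothDifferentiableAt x) (hξ.smoothDifferentiableAt x), dφ]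
      by_cases hx : x ∈ tsupport ξ
      · obtain ⟨-, b1, b2, b3, b4, b5⟩ := hbd x (hξη x hx)
        refine (abs_add_le _ _).trans (add_le_add ?_ ?_)
        · rw [abs_mul]; exact mul_le_mul (hφB x hx) (hdξA x a) (abs_nonneg _) (by positivity)
        · rw [abs_mul, abs_mul, abs_two]
          refine mul_le_mul (mul_le_mul_of_nonneg_left ?_ two_pos.le) (hξA x) (abs_nonneg _)
            (by positivity)
          exact (abs_real_inner_le_norm _ _).trans (mul_le_mul (b2 a) (hGB x hx) (norm_nonneg _) hK0)
      · rw [image_eq_zero_of_notMem_tsupport hx,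
          image_eq_zero_of_notMem_tsupport (fun h' => hx (tsupport_dirDeriv_subset _ h'))]
        simp only [mul_zero, add_zero, abs_zero]; positivity)
  have t2 := hn1 R (fun x => by
    have hη0 := h.cutoff_nonneg x
    by_cases hx : x ∈ tsupport ξ
    swap
    · simp only [hR, image_eq_zero_of_notMem_tsupport hx, mul_zero, abs_zero]
      positivity
    obtain ⟨-, b1, b2, b3, b4, b5⟩ := hbd x (hξη x hx)
    rw [(hξη x hx).eq_of_nhds, Pi.one_apply, one_mul]
    set u := √(hessSq b G x) with hu
    set τ := √(defectSq b k G x) with hτ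
    have hu0 : 0 ≤ u := Real.sqrt_nonneg _
    have hτ0 : 0 ≤ τ := Real.sqrt_nonneg _
    have c1 : |⟪offDiagHess b W G i j x, G x - c⟫| ≤ K * (τ + δ * u) * B :=
      (abs_real_inner_le_norm _ _).trans (mul_le_mul (b5 i j hij) (hGB x hx) (norm_nonneg _)
        (by positivity))
    have c2 : |W x * confDefect b k G i j x| ≤ K * (K * δ) := by
      rw [abs_mul]; exact mul_le_mul b1 (b4 i j) (abs_nonneg _) hK0
    have c3 : |2 * ⟪offDiagHess b W G i j x, G x - c⟫ + 2 * W x * confDefect b k G i j x| ≤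
        2 * (K * (τ + δ * u) * B) + 2 * (K * (K * δ)) := by
      rw [abs_le] at c1 c2 ⊢; constructor <;> linarith
    simp only [hR, abs_mul]
    refine (mul_le_mul c3 (hξA x) (abs_nonneg _) (by positivity)).trans ?_
    have d1 : K ≤ K ^ 2 := by nlinarith
    have d2 : τ + δ * u ≤ δ * (1 + u) ^ 2 + τ * (1 + u) := by
      nlinarith [mul_nonneg hδ0 hu0, mul_nonneg hτ0 hu0, mul_nonneg hδ0 (sq_nonneg u)]
    have d3 : δ ≤ δ * (1 + u) ^ 2 + τ * (1 + u) := by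
      nlinarith [mul_nonneg hδ0 hu0, mul_nonneg hτ0 hu0, mul_nonneg hδ0 (sq_nonneg u)]
    set Z := δ * (1 + u) ^ 2 + τ * (1 + u)
    have hZ : 0 ≤ Z := hδ0.trans d3
    calc _ ≤ (2 * (K ^ 2 * Z * B) + 2 * (K * (K * Z))) * A := by gcongr
      _ = _ := by ring)
  refine (abs_add_le _ _).trans ?_
  rw [abs_neg]
  linarith

/-- The weak off-diagonal Hessian of `‖f - c‖² / ‖f'‖` vanishes. -/
lemma integral_mul_dirDeriv_dirDeriv_eq_zero (h : ConformalApprox b f η g m M C)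
    (hf : ContDiff ℝ 1 f)
    {i j k : ι} (hik : i ≠ k) (hij : i ≠ j) (hkj : k ≠ j) (c : F) {ξ : F → ℝ}
    (hξ : ContDiff ℝ ∞ ξ) (hξc : HasCompactSupport ξ) (hξη : ∀ x ∈ tsupport ξ, η =ᶠ[𝓝 x] 1) :
    ∫ x, ‖fderiv ℝ f x‖⁻¹ * ⟪f x - c, f x - c⟫ * dirDeriv (b i) (dirDeriv (b j) ξ) x = 0 := by
  set D := dirDeriv (b i) (dirDeriv (b j) ξ) with hD
  have hDs : ContDiff ℝ ∞ D := (hξ.dirDeriv _).dirDeriv _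
  have hDc : HasCompactSupport D := (hξc.dirDeriv _).dirDeriv _
  have hD0 : ∀ x, x ∉ tsupport ξ → D x = 0 := fun x hx => image_eq_zero_of_notMem_tsupport
    fun h' => hx (tsupport_dirDeriv_subset _ (tsupport_dirDeriv_subset _ h'))
  obtain ⟨K, N₀, hK1, hN₀⟩ := h.exists_bounds k
  have hδ := tendsto_one_div_add_atTop_nhds_zero_nat (𝕜 := ℝ)
  have lim1 : Tendsto (fun n => ∫ x, confWeight b k η (g n) x * ⟪g n x - c, g n x - c⟫ * D x) atTop
      (𝓝 (∫ x, ‖fderiv ℝ f x‖⁻¹ * ⟪f x - c, f x - c⟫ * D x)) := by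
    refine tendsto_integral_filter_of_dominated_convergence
      (fun x => K * ((‖f x‖ + 1 + ‖c‖) * (‖f x‖ + 1 + ‖c‖)) * |D x|) ?_ ?_ ?_ ?_
    · filter_upwards [eventually_ge_atTop N₀] with n hn
      have hu : Continuous (fun y => g n y - c) := (h.smooth n).continuous.sub continuous_const
      exact (((hN₀ n hn).1.continuous.mul (hu.inner hu)).mul hDs.continuous).aestronglyMeasurable
    · filter_upwards [eventually_ge_atTop N₀] with n hn
      refine ae_of_all _ fun x => ?_
      by_cases hx : x ∈ tsupport ξ
      swap
      · simp [hD0 x hx]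
      obtain ⟨-, b1, -⟩ := (hN₀ n hn).2 x (hξη x hx)
      have hb : ‖g n x - c‖ ≤ ‖f x‖ + 1 + ‖c‖ := by
        have h1 := h.norm_sub_le n x
        have h3 : 1 / ((n : ℝ) + 1) ≤ 1 := by
          rw [div_le_one (by positivity)]; linarith [n.cast_nonneg (α := ℝ)]
        have h4 : g n x - c = (g n x - f x) + f x - c := by abel
        rw [h4]
        refine (_root_.norm_sub_le _ _).trans ?_
        have := norm_add_le (g n x - f x) (f x)
        linarith
      rw [norm_mul, norm_mul, Real.norm_eq_abs, Real.norm_eq_abs, Real.norm_eq_abs]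
      refine mul_le_mul_of_nonneg_right (mul_le_mul b1 ((abs_real_inner_le_norm _ _).trans
        (mul_le_mul hb hb (norm_nonneg _) (by positivity))) (abs_nonneg _) (by linarith)) (abs_nonneg _)
    · have hfc := hf.continuous
      have : Continuous (fun x => K * ((‖f x‖ + 1 + ‖c‖) * (‖f x‖ + 1 + ‖c‖)) * |D x|) := by
        have := hDs.continuous
        fun_prop
      refine this.integrable_of_hasCompactSupport ?_
      exact HasCompactSupport.mul_left (hDc.comp_left abs_zero)
    · refine ae_of_all _ fun x => ?_
      by_cases hx : x ∈ tsupport ξ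
      swap
      · simp [hD0 x hx]
      have hη1 : η x = 1 := (hξη x hx).eq_of_nhds
      have hxt : x ∈ tsupport η := subset_tsupport _ (by simp [Function.mem_support, hη1])
      have hg : Tendsto (fun n => g n x) atTop (𝓝 (f x)) :=
        tendsto_iff_norm_sub_tendsto_zero.2 (squeeze_zero (fun n => norm_nonneg _)
          (fun n => h.norm_sub_le n x) hδ)
      have hp : Tendsto (fun n => dirDeriv (b k) (g n) x) atTop (𝓝 (fderiv ℝ f x (b k))) :=
        tendsto_iff_norm_sub_tendsto_zero.2 (squeeze_zero (fun n => norm_nonneg _)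
          (fun n => h.norm_dirDeriv_sub_le n x k) hδ)
      have hw : Tendsto (fun n => confWeight b k η (g n) x) atTop (𝓝 ‖fderiv ℝ f x‖⁻¹) := by
        have h0 : ‖fderiv ℝ f x‖ ≠ 0 := by
          have := h.le_norm x hxt; have := h.pos; intro h0; linarith
        rw [← h.norm_fderiv_apply_basis hxt k] at h0 ⊢
        simp only [confWeight_eq_inv hη1]
        exact hp.norm.inv₀ h0
      have hu := hg.sub_const c
      exact (hw.mul (hu.inner hu)).mul_const _
  have lim2 : Tendsto (fun n => ∫ x, confWeight b k η (g n) x * ⟪g n x - c, g n x - c⟫ * D x) atTop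
      (𝓝 0) := by
    rw [Metric.tendsto_atTop]
    intro ε hε
    obtain ⟨N, hN⟩ := h.exists_abs_integral_weight_mul_le hf.continuous hik hij hkj c hξ hξc hξη (half_pos hε)
    refine ⟨N, fun n hn => ?_⟩
    rw [Real.dist_0_eq_abs]
    exact (hN n hn).trans_lt (half_lt_self hε)
  exact tendsto_nhds_unique lim1 lim2

end ConformalApprox

end WeakHessianLimit

section LocalWeakHessian

variable {F : Type*} [NormedAddCommGroup F] [InnerProductSpace ℝ F]
  [FiniteDimensional ℝ F] [MeasurableSpace F] [BorelSpace F]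

omit [MeasurableSpace F] [BorelSpace F] in
/-- In dimension at least three, two orthonormal vectors are part of an orthonormal basis with a
third member. -/
lemma exists_orthonormalBasis_pair (hd : 3 ≤ Module.finrank ℝ F) {u v : F} (hu : ‖u‖ = 1)
    (hv : ‖v‖ = 1) (huv : ⟪u, v⟫ = 0) :
    ∃ (s : Finset F) (b : OrthonormalBasis s ℝ F) (i j k : s), b i = u ∧ b j = v ∧ i ≠ j ∧ i ≠ k ∧
      k ≠ j := by
  classical
  have hne : u ≠ v := by
    rintro rfl
    rw [real_inner_self_eq_norm_sq, hu] at huv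
    norm_num at huv
  have ho : Orthonormal ℝ ((↑) : ({u, v} : Set F) → F) := by
    rw [orthonormal_subtype_iff_ite]
    rintro x (rfl | rfl) y (rfl | rfl)
    · simp [hu]
    · simp [huv, hne]
    · simp [(real_inner_comm _ _).trans huv, hne.symm]
    · simp [hv]
  obtain ⟨s, b, hs, hb⟩ := ho.exists_orthonormalBasis_extension
  have hus : u ∈ s := hs (by simp)
  have hvs : v ∈ s := hs (by simp)
  have hcard : ({⟨u, hus⟩, ⟨v, hvs⟩} : Finset s).card < Fintype.card s := by
    rw [← Module.finrank_eq_card_basis b.toBasis]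
    exact lt_of_le_of_lt Finset.card_le_two (by omega)
  obtain ⟨k, hk⟩ : ∃ k, k ∉ ({⟨u, hus⟩, ⟨v, hvs⟩} : Finset s) := by
    by_contra! h
    exact absurd (Finset.card_eq_iff_eq_univ _ |>.2 (Finset.eq_univ_of_forall h)) hcard.ne
  simp only [Finset.mem_insert, Finset.mem_singleton, not_or] at hk
  refine ⟨s, b, ⟨u, hus⟩, ⟨v, hvs⟩, k, by simp [hb], by simp [hb], ?_, Ne.symm hk.1, hk.2⟩
  simpa using hne

lemma exists_ball_weak_hessian_eq_zero [Nontrivial F] (hd : 3 ≤ Module.finrank ℝ F) {f : F → F}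
    {U : Set F} (hU : IsOpen U) (hf : ContDiffOn ℝ 1 f U) (hinj : InjOn f U)
    (hconf : ∀ x ∈ U, ConformalAt f x) {x₀ : F} (hx₀ : x₀ ∈ U) :
    ∃ R > 0, ball x₀ R ⊆ U ∧ ∀ u v : F, ‖u‖ = 1 → ‖v‖ = 1 → ⟪u, v⟫ = 0 → ∀ (c : F) (ξ : F → ℝ),
      ContDiff ℝ ∞ ξ → HasCompactSupport ξ → tsupport ξ ⊆ ball x₀ R →
      ∫ x, ‖fderiv ℝ f x‖⁻¹ * ⟪f x - c, f x - c⟫ * dirDeriv u (dirDeriv v ξ) x = 0 := by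
  classical
  obtain ⟨ε, hε, hεU⟩ := Metric.isOpen_iff.1 hU x₀ hx₀
  set δ := ε / 8 with hδ
  have hδ0 : 0 < δ := by positivity
  let χ : ContDiffBump x₀ := ⟨6 * δ, 7 * δ, by positivity, by linarith⟩
  let η : ContDiffBump x₀ := ⟨3 * δ, 4 * δ, by positivity, by linarith⟩
  let η₂ : ContDiffBump x₀ := ⟨δ, 2 * δ, by positivity, by linarith⟩
  have hχU : closedBall x₀ (7 * δ) ⊆ U := (closedBall_subset_ball (by linarith)).trans hεU
  let f' : F → F := fun x => χ x • f x
  have hf'c : HasCompactSupport f' := χ.hasCompactSupport.smul_right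
  have hf' : ContDiff ℝ 1 f' := by
    rw [contDiff_iff_contDiffAt]
    intro x
    by_cases hx : x ∈ U
    · exact χ.contDiffAt.smul (hf.contDiffAt (hU.mem_nhds hx))
    · have hx' : x ∉ tsupport f' := fun h => hx (hχU (by
        have := closure_mono (Function.support_smul_subset_left χ f) h
        have h2 := χ.tsupport_eq
        rw [tsupport] at h2
        rw [h2] at this
        exact this))
      exact (contDiffAt_const (c := (0 : F))).congr_of_eventuallyEq
        (notMem_tsupport_iff_eventuallyEq.1 hx')
  have heq : ∀ x ∈ ball x₀ (6 * δ), f' =ᶠ[𝓝 x] f := by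
    intro x hx
    filter_upwards [isOpen_ball.mem_nhds hx] with y hy
    have : χ y = 1 := χ.one_of_mem_closedBall (ball_subset_closedBall hy)
    simp [f', this]
  have hUb : ball x₀ (6 * δ) ⊆ U := (ball_subset_ball (by linarith)).trans hεU
  have hcf : ∀ x ∈ ball x₀ (6 * δ), IsConformalMap (fderiv ℝ f' x) := by
    intro x hx
    rw [(heq x hx).fderiv_eq]
    exact conformalAt_iff_isConformalMap_fderiv.1 (hconf x (hUb hx))
  have h56 : closedBall x₀ (5 * δ) ⊆ ball x₀ (6 * δ) := closedBall_subset_ball (by linarith)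
  have cdf : Continuous (fderiv ℝ f') := hf'.continuous_fderiv one_ne_zero
  obtain ⟨xm, hxm, hm⟩ := (isCompact_closedBall x₀ (5 * δ)).exists_isMinOn
    ⟨x₀, mem_closedBall_self (by positivity)⟩ cdf.norm.continuousOn
  obtain ⟨xM, hxM, hM⟩ := (isCompact_closedBall x₀ (5 * δ)).exists_isMaxOn
    ⟨x₀, mem_closedBall_self (by positivity)⟩ cdf.norm.continuousOn
  have hm0 : 0 < ‖fderiv ℝ f' xm‖ := norm_pos_iff.2 (hcf xm (h56 hxm)).ne_zero
  obtain ⟨L, hL⟩ := hf'.lipschitzWith_of_hasCompactSupport hf'c one_ne_zero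
  obtain ⟨C, hC⟩ := exists_integral_fderiv_sub_le (by omega) hf' (s := ball x₀ (5 * δ)) isOpen_ball
    (fun x hx y hy hxy => by
      have hx' := h56 (ball_subset_closedBall hx)
      have hy' := h56 (ball_subset_closedBall hy)
      rw [(heq x hx').eq_of_nhds, (heq y hy').eq_of_nhds] at hxy
      exact hinj (hUb hx') (hUb hy') hxy)
    (fun x hx => hcf x (h56 (ball_subset_closedBall hx))) hm0
    (fun x hx => hm (ball_subset_closedBall hx)) (fun x hx => hM (ball_subset_closedBall hx))
    (fun x y => by simpa [dist_eq_norm] using hL.dist_le_mul x y)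
    (η := η) (r := δ / 2) η.contDiff η.hasCompactSupport (fun x hx h hh => by
      rw [η.tsupport_eq, mem_closedBall, dist_eq_norm] at hx
      rw [mem_ball, dist_eq_norm, add_sub_right_comm]
      have := norm_add_le (x - x₀) h
      have : ‖x - x₀‖ ≤ 4 * δ := hx
      linarith)
  have hη₂s : tsupport η₂ ⊆ closedBall x₀ (5 * δ) := by
    rw [η₂.tsupport_eq]
    exact closedBall_subset_closedBall (show 2 * δ ≤ 5 * δ by linarith)
  refine ⟨δ, hδ0, (ball_subset_ball (by linarith)).trans hεU, ?_⟩
  intro u v hu hv huv c ξ hξ hξc hξs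
  obtain ⟨s, b, i, j, k, rfl, rfl, hij, hik, hkj⟩ := exists_orthonormalBasis_pair hd hu hv huv
  obtain ⟨g, C', hg⟩ := exists_conformalApprox b hf' hf'c (η := η) (η₂ := η₂) η.continuous
    η.hasCompactSupport η₂.contDiff η₂.hasCompactSupport (fun x => η₂.nonneg) (fun x => η₂.le_one)
    (r := δ / 2) (by positivity) (fun x y hy => by
      by_cases hxy : x + y ∈ ball x₀ (2 * δ)
      · have : η x = 1 := η.one_of_mem_closedBall (by
          rw [mem_ball, dist_eq_norm] at hxy
          rw [mem_closedBall, dist_eq_norm]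
          have h1 := norm_sub_le (x + y - x₀) y
          have h2 : x + y - x₀ - y = x - x₀ := by abel
          rw [h2] at h1
          show ‖x - x₀‖ ≤ 3 * δ
          linarith)
        rw [this, one_pow]
        exact η₂.le_one
      · have : η₂ (x + y) = 0 := η₂.zero_of_le_dist (not_lt.1 hxy)
        rw [this]
        positivity) hC hm0 (fun x hx => hm (hη₂s hx)) (fun x hx => hM (hη₂s hx))
    (fun x hx u v => (hcf x (h56 (hη₂s hx))).inner_map_map u v)
  have := hg.integral_mul_dirDeriv_dirDeriv_eq_zero hf' hik hij hkj c hξ hξc (fun x hx => by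
    filter_upwards [isOpen_ball.mem_nhds (hξs hx)] with y hy
    exact η₂.one_of_mem_closedBall (ball_subset_closedBall hy))
  rw [← this]
  congr 1 with x
  by_cases hx : x ∈ tsupport ξ
  · have hx' := heq x (ball_subset_ball (by linarith) (hξs hx))
    rw [hx'.eq_of_nhds, hx'.fderiv_eq]
  · rw [image_eq_zero_of_notMem_tsupport (f := dirDeriv (b i) (dirDeriv (b j) ξ))
      fun h' => hx (tsupport_dirDeriv_subset _ (tsupport_dirDeriv_subset _ h'))]
    simp

end LocalWeakHessian

section Umbilic

variable {F : Type*} [NormedAddCommGroup F] [InnerProductSpace ℝ F]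

/-- `q` agrees on `s` with a polynomial of degree at most two whose quadratic part is a multiple of
the squared norm. -/
def IsSphericalOn (q : F → ℝ) (s : Set F) : Prop :=
  ∃ (a : ℝ) (β : F) (c : ℝ), ∀ x ∈ s, q x = a * ‖x‖ ^ 2 + ⟪β, x⟫ + c

lemma exists_eq_const_of_dirDeriv_eq_zero {ι : Type*} [Fintype ι] (b : OrthonormalBasis ι ℝ F)
    {s : Set F} (hs : IsOpen s) (hsc : IsPreconnected s) {g : F → ℝ} (hg : ContDiff ℝ ∞ g)
    (h : ∀ i, ∀ x ∈ s, dirDeriv (b i) g x = 0) : ∃ c, ∀ x ∈ s, g x = c := by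
  refine hs.exists_is_const_of_fderiv_eq_zero hsc (fun x _ =>
    (hg.smoothDifferentiableAt x).differentiableWithinAt) (fun x hx => ?_)
  ext v
  have : fderiv ℝ g x = 0 := by
    apply ContinuousLinearMap.coe_injective
    exact b.toBasis.ext fun i => by simpa [dirDeriv] using h i x hx
  simp [this]

lemma dirDeriv_eq_zero_of_eqOn_const {s : Set F} (hs : IsOpen s) {g : F → ℝ} {c : ℝ}
    (h : ∀ x ∈ s, g x = c) (v : F) : ∀ x ∈ s, dirDeriv v g x = 0 := fun x hx => by
  have : g =ᶠ[𝓝 x] fun _ => c := by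
    filter_upwards [hs.mem_nhds hx] with y hy using h y hy
  rw [dirDeriv_congr this, dirDeriv_const]

lemma dirDeriv_basis_eq_of_orthogonal {ι : Type*} [Fintype ι] [DecidableEq ι]
    (b : OrthonormalBasis ι ℝ F) {g : F → ℝ} (hg : ContDiff ℝ ∞ g) {x : F}
    (h : ∀ u v : F, ‖u‖ = 1 → ‖v‖ = 1 → ⟪u, v⟫ = 0 → dirDeriv u (dirDeriv v g) x = 0) (i j : ι) :
    dirDeriv (b i) (dirDeriv (b i) g) x = dirDeriv (b j) (dirDeriv (b j) g) x := by
  by_cases hij : i = j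
  · rw [hij]
  have h2 : (√2)⁻¹ ^ 2 = (1 / 2 : ℝ) := by rw [inv_pow, Real.sq_sqrt (by norm_num)]; norm_num
  have hbi : ⟪b i, b j⟫ = 0 := by rw [b.inner_eq_ite, if_neg hij]
  have hbj : ⟪b j, b i⟫ = 0 := by rw [b.inner_eq_ite, if_neg (Ne.symm hij)]
  have hu : ‖(√2)⁻¹ • (b i + b j)‖ = 1 := by
    rw [← sq_eq_sq₀ (norm_nonneg _) zero_le_one, norm_smul, mul_pow, Real.norm_eq_abs, sq_abs, h2,
      norm_add_sq_real, hbi]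
    simp
    norm_num
  have hv : ‖(√2)⁻¹ • (b i - b j)‖ = 1 := by
    rw [← sq_eq_sq₀ (norm_nonneg _) zero_le_one, norm_smul, mul_pow, Real.norm_eq_abs, sq_abs, h2,
      norm_sub_sq_real, hbi]
    simp
    norm_num
  have huv : ⟪(√2)⁻¹ • (b i + b j), (√2)⁻¹ • (b i - b j)⟫ = 0 := by
    rw [inner_smul_left, inner_smul_right, inner_add_left, inner_sub_right, inner_sub_right, hbi, hbj]
    simp
  have key := h _ _ hu hv huv
  have hsm : ∀ (v : F) (c : ℝ) (G : F → ℝ) y, dirDeriv (c • v) G y = c * dirDeriv v G y := by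
    intro v c G y; simp [dirDeriv]
  have had : ∀ (u v : F) (G : F → ℝ) y, dirDeriv (u + v) G y = dirDeriv u G y + dirDeriv v G y := by
    intro u v G y; simp [dirDeriv]
  have hsb : ∀ (u v : F) (G : F → ℝ) y, dirDeriv (u - v) G y = dirDeriv u G y - dirDeriv v G y := by
    intro u v G y; simp [dirDeriv]
  have e : dirDeriv ((√2)⁻¹ • (b i - b j)) g =
      fun y => (√2)⁻¹ • (dirDeriv (b i) g y - dirDeriv (b j) g y) := by
    funext y
    rw [hsm, hsb, smul_eq_mul]
  rw [e, dirDeriv_const_smul (((hg.dirDeriv _).smoothDifferentiableAt x).fun_sub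
    ((hg.dirDeriv _).smoothDifferentiableAt x)), dirDeriv_sub ((hg.dirDeriv _).smoothDifferentiableAt x)
    ((hg.dirDeriv _).smoothDifferentiableAt x), hsm, hsm, had, had, dirDeriv_comm hg (b j) (b i),
    smul_eq_mul] at key
  have : (√2)⁻¹ ≠ (0 : ℝ) := by positivity
  have k2 := (mul_eq_zero.1 key).resolve_left this
  rw [← mul_sub] at k2
  have k3 := (mul_eq_zero.1 k2).resolve_left this
  linarith

/-- A smooth function whose Hessian is everywhere a multiple of the identity is spherical. -/
lemma isSphericalOn_of_dirDeriv_dirDeriv_eq_zero [FiniteDimensional ℝ F]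
    (hd : 2 ≤ Module.finrank ℝ F) {s : Set F}
    (hs : IsOpen s) (hsc : IsPreconnected s) {g : F → ℝ} (hg : ContDiff ℝ ∞ g)
    (h : ∀ u v : F, ‖u‖ = 1 → ‖v‖ = 1 → ⟪u, v⟫ = 0 → ∀ x ∈ s, dirDeriv u (dirDeriv v g) x = 0) :
    IsSphericalOn g s := by
  classical
  let b := stdOrthonormalBasis ℝ F
  have : Nontrivial (Fin (Module.finrank ℝ F)) := Fin.nontrivial_iff_two_le.2 hd
  have hoff : ∀ i j, i ≠ j → ∀ x ∈ s, dirDeriv (b i) (dirDeriv (b j) g) x = 0 := fun i j hij x hx =>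
    h _ _ (b.norm_eq_one i) (b.norm_eq_one j) (by rw [b.inner_eq_ite, if_neg hij]) x hx
  have hdiag : ∀ i j, ∀ x ∈ s,
      dirDeriv (b i) (dirDeriv (b i) g) x = dirDeriv (b j) (dirDeriv (b j) g) x := fun i j x hx =>
    dirDeriv_basis_eq_of_orthogonal b hg (fun u v hu hv huv => h u v hu hv huv x hx) i j
  let i₀ : Fin (Module.finrank ℝ F) := ⟨0, by omega⟩
  have hthird : ∀ k, ∀ x ∈ s, dirDeriv (b k) (dirDeriv (b i₀) (dirDeriv (b i₀) g)) x = 0 := by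
    intro k x hx
    obtain ⟨j, hj⟩ := exists_ne k
    have e1 : dirDeriv (b i₀) (dirDeriv (b i₀) g) =ᶠ[𝓝 x] dirDeriv (b j) (dirDeriv (b j) g) := by
      filter_upwards [hs.mem_nhds hx] with y hy using hdiag i₀ j y hy
    rw [dirDeriv_congr e1, dirDeriv_comm (hg.dirDeriv _)]
    exact dirDeriv_eq_zero_of_eqOn_const hs (fun y hy => hoff k j hj.symm y hy) _ x hx
  obtain ⟨a, ha⟩ := exists_eq_const_of_dirDeriv_eq_zero b hs hsc ((hg.dirDeriv _).dirDeriv _) hthird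
  have hnormd : ∀ i x, dirDeriv (b i) (fun y : F => (a / 2) * ⟪y, y⟫) x = a * ⟪b i, x⟫ := by
    intro i x
    have := dirDeriv_mul (x := x) (differentiableAt_const (a / 2))
      ((differentiableAt_id (𝕜 := ℝ) (x := x)).inner ℝ (differentiableAt_id (𝕜 := ℝ) (x := x))) (b i)
    simp only [id] at this
    rw [this, dirDeriv_const]
    have h2 := dirDeriv_inner (differentiableAt_id (𝕜 := ℝ) (x := x))
      (differentiableAt_id (𝕜 := ℝ) (x := x)) (b i)
    simp only [id] at h2
    rw [h2]
    have h3 : dirDeriv (b i) (id : F → F) x = b i := by simp [dirDeriv]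
    rw [h3, real_inner_comm]
    ring
  have hlin : ∀ (β : F) i x, dirDeriv (b i) (fun y : F => ⟪β, y⟫) x = ⟪β, b i⟫ := by
    intro β i x
    have h2 := dirDeriv_inner (differentiableAt_const β)
      (differentiableAt_id (𝕜 := ℝ) (x := x)) (b i)
    simp only [id] at h2
    rw [h2, dirDeriv_const]
    simp [dirDeriv]
  have hβ : ∀ j, ∃ c, ∀ x ∈ s, dirDeriv (b j) g x - a * ⟪b j, x⟫ = c := by
    intro j
    have hsm : ContDiff ℝ ∞ (fun x : F => a * ⟪b j, x⟫) :=
      contDiff_const.mul (contDiff_const.inner ℝ contDiff_id)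
    refine exists_eq_const_of_dirDeriv_eq_zero b hs hsc ((hg.dirDeriv _).sub hsm) fun i x hx => ?_
    rw [dirDeriv_sub ((hg.dirDeriv _).smoothDifferentiableAt x) (hsm.smoothDifferentiableAt x)]
    have e : dirDeriv (b i) (fun x : F => a * ⟪b j, x⟫) x = a * ⟪b j, b i⟫ := by
      have hd : DifferentiableAt ℝ (fun y : F => ⟪b j, y⟫) x :=
        (differentiableAt_const (b j)).inner ℝ differentiableAt_id
      have := dirDeriv_const_smul hd a (b i)
      rw [hlin] at this
      exact this
    rw [e, b.inner_eq_ite]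
    by_cases hij : i = j
    · subst hij
      simp [hdiag i i₀ x hx, ha x hx]
    · simp [Ne.symm hij, hoff i j hij x hx]
  choose B hB using hβ
  have hB' : ∀ i, ⟪∑ j, B j • b j, b i⟫ = B i := fun i => by
    simp [sum_inner, inner_smul_left, b.inner_eq_ite]
  have s1 : ContDiff ℝ ∞ (fun y : F => (a / 2) * ⟪y, y⟫) :=
    contDiff_const.mul (contDiff_id.inner ℝ contDiff_id)
  have s2 : ContDiff ℝ ∞ (fun y : F => ⟪∑ j, B j • b j, y⟫) := contDiff_const.inner ℝ contDiff_id
  obtain ⟨c, hc⟩ := exists_eq_const_of_dirDeriv_eq_zero b hs hsc ((hg.sub s1).sub s2)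
    fun i x hx => by
      rw [dirDeriv_sub ((hg.sub s1).smoothDifferentiableAt x) (s2.smoothDifferentiableAt x),
        dirDeriv_sub (hg.smoothDifferentiableAt x) (s1.smoothDifferentiableAt x), hnormd, hlin, hB',
        hB i x hx, sub_self]
  refine ⟨a / 2, ∑ j, B j • b j, c, fun x hx => ?_⟩
  have := hc x hx
  rw [← real_inner_self_eq_norm_sq]
  linarith

/-- Pointwise limits of spherical functions are spherical. -/
lemma isSphericalOn_of_tendsto [FiniteDimensional ℝ F] {s : Set F} {g : ℕ → F → ℝ} {q : F → ℝ}
    (hg : ∀ᶠ n in atTop, IsSphericalOn (g n) s)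
    (hq : ∀ x ∈ s, Tendsto (fun n => g n x) atTop (𝓝 (q x))) : IsSphericalOn q s := by
  let T : (ℝ × F × ℝ) →ₗ[ℝ] (s → ℝ) :=
    { toFun := fun p x => p.1 * ‖(x : F)‖ ^ 2 + ⟪p.2.1, (x : F)⟫ + p.2.2
      map_add' := fun p p' => by
        funext x
        simp only [Prod.fst_add, Prod.snd_add, inner_add_left, Pi.add_apply]
        ring
      map_smul' := fun c p => by
        funext x
        simp only [Prod.smul_fst, Prod.smul_snd, inner_smul_left, Pi.smul_apply, smul_eq_mul,
          RingHom.id_apply, conj_trivial]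
        ring }
  have hcl : IsClosed (LinearMap.range T : Set (s → ℝ)) := Submodule.closed_of_finiteDimensional _
  have hmem : (fun x : s => q x) ∈ (LinearMap.range T : Set (s → ℝ)) := by
    refine hcl.mem_of_tendsto (f := fun n (x : s) => g n x) (b := atTop)
      (tendsto_pi_nhds.2 fun x => hq x x.2) ?_
    filter_upwards [hg] with n hn
    obtain ⟨a, β, c, h⟩ := hn
    exact ⟨(a, β, c), funext fun x => (h x x.2).symm⟩
  obtain ⟨⟨a, β, c⟩, h⟩ := hmem
  exact ⟨a, β, c, fun x hx => (congrFun h ⟨x, hx⟩).symm⟩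

end Umbilic

section WeakUmbilic

variable {F : Type*} [NormedAddCommGroup F] [InnerProductSpace ℝ F] [FiniteDimensional ℝ F]
  [MeasurableSpace F] [BorelSpace F]

lemma dirDeriv_convolution {q g : F → ℝ} (hq : Continuous q) (hg : ContDiff ℝ ∞ g)
    (hgc : HasCompactSupport g) (v : F) :
    dirDeriv v (q ⋆[ContinuousLinearMap.mul ℝ ℝ, volume] g) =
      q ⋆[ContinuousLinearMap.mul ℝ ℝ, volume] dirDeriv v g := by
  funext x
  have h1 : ContDiff ℝ 1 g := hg.of_le (by norm_cast)
  rw [dirDeriv, (hgc.hasFDerivAt_convolution_right (ContinuousLinearMap.mul ℝ ℝ)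
    hq.locallyIntegrable h1 x).fderiv]
  exact convolution_precompR_apply _ hq.locallyIntegrable (hgc.fderiv (𝕜 := ℝ))
    (h1.continuous_fderiv one_ne_zero) x v

omit [FiniteDimensional ℝ F] [MeasurableSpace F] [BorelSpace F] in
lemma dirDeriv_comp_const_sub {g : F → ℝ} (hg : ContDiff ℝ ∞ g) (x v : F) :
    dirDeriv v (fun t => g (x - t)) = fun t => - dirDeriv v g (x - t) := by
  funext t
  have h := (hg.smoothDifferentiableAt (x - t)).hasFDerivAt.comp t
    ((hasFDerivAt_id t).const_sub x)
  have e : fderiv ℝ (fun t => g (x - t)) t = _ := h.fderiv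
  simp [dirDeriv, e]

/-- A continuous function whose weak Hessian is a multiple of the identity is spherical. -/
lemma isSphericalOn_of_weak_hessian (hd : 2 ≤ Module.finrank ℝ F) {q : F → ℝ} {x₀ : F} {R : ℝ}
    (hR : 0 < R) (hq : ContinuousOn q (ball x₀ R))
    (hw : ∀ u v : F, ‖u‖ = 1 → ‖v‖ = 1 → ⟪u, v⟫ = 0 → ∀ ξ : F → ℝ, ContDiff ℝ ∞ ξ →
      HasCompactSupport ξ → tsupport ξ ⊆ ball x₀ R → ∫ x, q x * dirDeriv u (dirDeriv v ξ) x = 0) :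
    IsSphericalOn q (ball x₀ (R / 4)) := by
  let χ : ContDiffBump x₀ := ⟨R / 2, 3 * R / 4, by positivity, by linarith⟩
  let q' : F → ℝ := fun x => χ x * q x
  have hχt : tsupport χ ⊆ ball x₀ R := by
    rw [χ.tsupport_eq]
    exact closedBall_subset_ball (show 3 * R / 4 < R by linarith)
  have hq' : Continuous q' := by
    rw [continuous_iff_continuousAt]
    intro x
    by_cases hx : x ∈ ball x₀ R
    · exact χ.continuous.continuousAt.mul (hq.continuousAt (isOpen_ball.mem_nhds hx))
    · have : q' =ᶠ[𝓝 x] fun _ => 0 := by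
        filter_upwards [notMem_tsupport_iff_eventuallyEq.1 fun h => hx (hχt h)] with y hy
        simp only [q', hy, Pi.zero_apply, zero_mul]
      exact continuousAt_const.congr this.symm
  have heq : ∀ x ∈ closedBall x₀ (R / 2), q' x = q x := fun x hx => by
    have : χ x = 1 := χ.one_of_mem_closedBall hx
    simp [q', this]
  let φ : ℕ → ContDiffBump (0 : F) := fun n =>
    ⟨R / 4 / (n + 1) / 2, R / 4 / (n + 1), by positivity, by
      have : 0 < R / 4 / ((n : ℝ) + 1) := by positivity
      linarith⟩
  have hφ : Tendsto (fun n => (φ n).rOut) atTop (𝓝 0) := by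
    have := (tendsto_one_div_add_atTop_nhds_zero_nat (𝕜 := ℝ)).const_mul (R / 4)
    rw [mul_zero] at this
    refine this.congr fun n => ?_
    show R / 4 * (1 / ((n : ℝ) + 1)) = R / 4 / (n + 1)
    ring
  let g : ℕ → F → ℝ := fun n => q' ⋆[ContinuousLinearMap.mul ℝ ℝ, volume] (φ n).normed volume
  refine isSphericalOn_of_tendsto (g := g) ?_ ?_
  · refine Eventually.of_forall fun n => ?_
    have hk : ContDiff ℝ ∞ ((φ n).normed volume) := (φ n).contDiff_normed
    have hkc : HasCompactSupport ((φ n).normed (volume : Measure F)) := (φ n).hasCompactSupport_normed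
    refine isSphericalOn_of_dirDeriv_dirDeriv_eq_zero hd isOpen_ball
      (convex_ball x₀ (R / 4)).isPreconnected
      (hkc.contDiff_convolution_right _ hq'.locallyIntegrable hk) fun u v hu hv huv x hx => ?_
    rw [dirDeriv_convolution hq' hk hkc, dirDeriv_convolution hq' (hk.dirDeriv _) (hkc.dirDeriv _)]
    let ξ : F → ℝ := fun t => (φ n).normed volume (x - t)
    have hξ : ContDiff ℝ ∞ ξ := hk.comp (contDiff_const.sub contDiff_id)
    have hsub : ∀ t, ξ t ≠ 0 → t ∈ closedBall x (R / 4) := by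
      intro t ht
      have h1 : x - t ∈ Function.support ((φ n).normed volume) := ht
      rw [(φ n).support_normed_eq, mem_ball_zero_iff] at h1
      have h2 : (φ n).rOut ≤ R / 4 := div_le_self (by positivity) (by linarith [n.cast_nonneg (α := ℝ)])
      rw [mem_closedBall, dist_comm, dist_eq_norm]
      linarith
    have hts : tsupport ξ ⊆ closedBall x (R / 4) := closure_minimal hsub isClosed_closedBall
    have hξc : HasCompactSupport ξ := HasCompactSupport.of_support_subset_isCompact
      (isCompact_closedBall x (R / 4)) hsub
    have hin : closedBall x (R / 4) ⊆ ball x₀ (R / 2) := by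
      intro t ht
      rw [mem_ball] at hx ⊢
      rw [mem_closedBall] at ht
      linarith [dist_triangle t x x₀]
    have := hw u v hu hv huv ξ hξ hξc ((hts.trans hin).trans (ball_subset_ball (by linarith)))
    rw [convolution_def, ← this]
    congr 1 with t
    have e1 : dirDeriv u (dirDeriv v ξ) t = dirDeriv u (dirDeriv v ((φ n).normed volume)) (x - t) := by
      rw [dirDeriv_comp_const_sub hk]
      have : dirDeriv u (fun t => (-1 : ℝ) • dirDeriv v ((φ n).normed volume) (x - t)) t = _ :=
        dirDeriv_const_smul (((hk.dirDeriv v).comp (contDiff_const.sub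
          contDiff_id)).smoothDifferentiableAt t) (-1 : ℝ) u
      simp only [neg_smul, one_smul] at this
      rw [this, Function.comp_def]
      have h2 := congrFun (dirDeriv_comp_const_sub (hk.dirDeriv v) x u) t
      simp only [id]
      rw [h2, neg_neg]
    rw [← e1, ContinuousLinearMap.mul_apply']
    by_cases ht : t ∈ tsupport ξ
    · rw [heq t (ball_subset_closedBall (hin (hts ht)))]
    · rw [image_eq_zero_of_notMem_tsupport (f := dirDeriv u (dirDeriv v ξ))
        fun h' => ht (tsupport_dirDeriv_subset _ (tsupport_dirDeriv_subset _ h'))]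
      simp
  · intro x hx
    have := ContDiffBump.convolution_tendsto_right_of_continuous (μ := volume) hφ hq' x
    rw [heq x (closedBall_subset_closedBall (by linarith) (ball_subset_closedBall hx))] at this
    refine this.congr fun n => ?_
    simp only [g]
    rw [← convolution_flip]
    congr 1
    ext
    simp

end WeakUmbilic

section Spherical

variable {F : Type*} [NormedAddCommGroup F] [InnerProductSpace ℝ F]

namespace IsSphericalOn

lemma add {p q : F → ℝ} {s : Set F} (hp : IsSphericalOn p s) (hq : IsSphericalOn q s) :
    IsSphericalOn (fun x => p x + q x) s := by
  obtain ⟨a, β, c, h⟩ := hp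
  obtain ⟨a', β', c', h'⟩ := hq
  refine ⟨a + a', β + β', c + c', fun x hx => ?_⟩
  beta_reduce
  rw [h x hx, h' x hx, inner_add_left]
  ring

lemma const_mul {q : F → ℝ} {s : Set F} (hq : IsSphericalOn q s) (r : ℝ) :
    IsSphericalOn (fun x => r * q x) s := by
  obtain ⟨a, β, c, h⟩ := hq
  refine ⟨r * a, r • β, r * c, fun x hx => ?_⟩
  beta_reduce
  rw [h x hx, inner_smul_left]
  simp only [conj_trivial]
  ring

lemma congr {p q : F → ℝ} {s : Set F} (hp : IsSphericalOn p s) (h : ∀ x ∈ s, q x = p x) :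
    IsSphericalOn q s := by
  obtain ⟨a, β, c, h'⟩ := hp
  exact ⟨a, β, c, fun x hx => (h x hx).trans (h' x hx)⟩

lemma continuousOn {q : F → ℝ} {s : Set F} (hq : IsSphericalOn q s) : ContinuousOn q s := by
  obtain ⟨a, β, c, h⟩ := hq
  refine ContinuousOn.congr (Continuous.continuousOn ?_) h
  fun_prop

lemma exists_recenter {q : F → ℝ} {s : Set F} (hq : IsSphericalOn q s) {z : F} (hz : z ∈ s) :
    ∃ (a : ℝ) (γ : F), ∀ x ∈ s, q x = q z + ⟪γ, x - z⟫ + a * ‖x - z‖ ^ 2 := by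
  obtain ⟨a, β, c, h⟩ := hq
  refine ⟨a, β + (2 * a) • z, fun x hx => ?_⟩
  rw [h x hx, h z hz, inner_add_left, inner_smul_left, inner_sub_right, inner_sub_right,
    norm_sub_sq_real, real_inner_self_eq_norm_sq, real_inner_comm x z]
  simp only [conj_trivial]
  ring

/-- A locally spherical function on a connected open set is spherical. -/
lemma of_locally {q : F → ℝ} {U : Set F} (hU : IsOpen U) (hUc : IsPreconnected U)
    (h : ∀ x ∈ U, ∃ R > 0, IsSphericalOn q (ball x R)) : IsSphericalOn q U := by
  have han : ∀ (a : ℝ) (β : F) (c : ℝ) (x : F),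
      AnalyticAt ℝ (fun x => a * ‖x‖ ^ 2 + ⟪β, x⟫ + c) x := by
    intro a β c x
    have h1 : AnalyticAt ℝ (fun x : F => ‖x‖ ^ 2) x :=
      (contDiff_norm_sq ℝ (E := F) (n := ω)).contDiffAt.analyticAt
    have h2 : AnalyticAt ℝ (fun x : F => ⟪β, x⟫) x := (innerSL ℝ β).analyticAt x
    exact ((analyticAt_const.mul h1).add h2).add analyticAt_const
  rcases U.eq_empty_or_nonempty with rfl | ⟨x₀, hx₀⟩
  · exact ⟨0, 0, 0, by simp⟩
  have hq : AnalyticOnNhd ℝ q U := by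
    intro x hx
    obtain ⟨R, hR, a, β, c, h'⟩ := h x hx
    refine (han a β c x).congr ?_
    filter_upwards [ball_mem_nhds x hR] with y hy using (h' y hy).symm
  obtain ⟨R, hR, a, β, c, h'⟩ := h x₀ hx₀
  refine ⟨a, β, c, hq.eqOn_of_preconnected_of_eventuallyEq (fun x _ => han a β c x) hUc hx₀ ?_⟩
  filter_upwards [ball_mem_nhds x₀ hR] with y hy using h' y hy

end IsSphericalOn

/-- If `w • (f - f z)` and its companions are spherical, then `f` distorts distances as a Möbius map. -/
lemma exists_isometry_of_spherical [FiniteDimensional ℝ F] [Nontrivial F] {f : F → F} {w : F → ℝ}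
    {U : Set F} (hU : IsOpen U) (hwpos : ∀ x ∈ U, 0 < w x) (hw : IsSphericalOn w U)
    (hwf : ∀ c, IsSphericalOn (fun x => w x * ‖f x - c‖ ^ 2) U)
    (hwv : ∀ v, IsSphericalOn (fun x => w x * ⟪f x, v⟫) U) {z : F} (hz : z ∈ U) {A : F →L[ℝ] F}
    (hA : HasFDerivAt f A z) (hAw : ∀ e, w z * ‖A e‖ = ‖e‖) :
    (∀ x ∈ U, w x * w z * ‖f x - f z‖ ^ 2 = ‖x - z‖ ^ 2) ∧
      ∃ (L : F →ₗ[ℝ] F) (β : F), (∀ h, ‖L h‖ = ‖h‖) ∧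
        ∀ x ∈ U, w x • (f x - f z) = L (x - z) + ‖x - z‖ ^ 2 • β := by
  have hline : ∀ e : F, Tendsto (fun t : ℝ => z + t • e) (𝓝[≠] 0) (𝓝 z) := by
    intro e
    have : Continuous (fun t : ℝ => z + t • e) := by fun_prop
    have h := this.tendsto 0
    simp only [zero_smul, add_zero] at h
    exact h.mono_left nhdsWithin_le_nhds
  have hmem : ∀ e : F, ∀ᶠ t in 𝓝[≠] (0 : ℝ), z + t • e ∈ U := fun e =>
    (hline e).eventually (hU.mem_nhds hz)
  have hwl : ∀ e : F, Tendsto (fun t : ℝ => w (z + t • e)) (𝓝[≠] 0) (𝓝 (w z)) := fun e =>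
    ((hw.continuousOn.continuousAt (hU.mem_nhds hz)).tendsto).comp (hline e)
  have hne : ∀ᶠ t in 𝓝[≠] (0 : ℝ), t ≠ 0 := eventually_mem_nhdsWithin
  have hz0 : 0 < w z := hwpos z hz
  have hstar : ∀ x ∈ U, w x * w z * ‖f x - f z‖ ^ 2 = ‖x - z‖ ^ 2 := by
    obtain ⟨a, γ, hq⟩ := (hwf (f z)).exists_recenter hz
    simp only [sub_self, norm_zero] at hq
    have hk : ∀ e : F, Tendsto (fun t : ℝ => w (z + t • e) * ‖t⁻¹ • (f (z + t • e) - f z)‖ ^ 2)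
        (𝓝[≠] 0) (𝓝 (w z * ‖A e‖ ^ 2)) := fun e =>
      (hwl e).mul (((hA.hasLineDerivAt e).tendsto_slope_zero).norm.pow 2)
    have hk' : ∀ e : F, ∀ᶠ t in 𝓝[≠] (0 : ℝ), t * (t * (w (z + t • e) *
        ‖t⁻¹ • (f (z + t • e) - f z)‖ ^ 2)) = t * ⟪γ, e⟫ + t * t * (a * ‖e‖ ^ 2) := by
      intro e
      filter_upwards [hmem e, hne] with t ht ht0
      have := hq _ ht
      rw [add_sub_cancel_left, inner_smul_right, norm_smul, mul_pow, Real.norm_eq_abs, sq_abs] at this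
      rw [norm_smul, mul_pow, norm_inv, Real.norm_eq_abs, inv_pow, sq_abs]
      field_simp
      linarith
    have hγ : ∀ e, ⟪γ, e⟫ = 0 := by
      intro e
      have hid : Tendsto (fun t : ℝ => t) (𝓝[≠] 0) (𝓝 0) := tendsto_id.mono_left nhdsWithin_le_nhds
      have l1 := hid.mul (hk e)
      have l2 : Tendsto (fun t : ℝ => ⟪γ, e⟫ + t * (a * ‖e‖ ^ 2)) (𝓝[≠] 0)
          (𝓝 (⟪γ, e⟫ + 0 * (a * ‖e‖ ^ 2))) := tendsto_const_nhds.add (hid.mul_const _)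
      have l3 := l1.congr' (f₂ := fun t : ℝ => ⟪γ, e⟫ + t * (a * ‖e‖ ^ 2)) (by
        filter_upwards [hk' e, hne] with t ht ht0
        have : t * (t * (w (z + t • e) * ‖t⁻¹ • (f (z + t • e) - f z)‖ ^ 2)) =
          t * (⟪γ, e⟫ + t * (a * ‖e‖ ^ 2)) := by rw [ht]; ring
        exact mul_left_cancel₀ ht0 this)
      have := tendsto_nhds_unique l3 l2
      linarith
    have ha : ∀ e, w z * ‖A e‖ ^ 2 = a * ‖e‖ ^ 2 := by
      intro e
      refine tendsto_nhds_unique (hk e) (tendsto_const_nhds.congr' ?_)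
      filter_upwards [hk' e, hne] with t ht ht0
      rw [hγ, mul_zero, zero_add, mul_assoc] at ht
      exact (mul_left_cancel₀ ht0 (mul_left_cancel₀ ht0 ht)).symm
    obtain ⟨e, he⟩ := exists_ne (0 : F)
    have ha' : w z * a = 1 := by
      have h1 := ha e
      have h2 := hAw e
      have h3 : 0 < ‖e‖ := norm_pos_iff.2 he
      have : w z * a * ‖e‖ ^ 2 = 1 * ‖e‖ ^ 2 := by
        calc w z * a * ‖e‖ ^ 2 = w z * (a * ‖e‖ ^ 2) := by ring
          _ = (w z * ‖A e‖) ^ 2 := by rw [← h1]; ring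
          _ = _ := by rw [h2]; ring
      exact mul_right_cancel₀ (by positivity) this
    intro x hx
    have := hq x hx
    rw [hγ] at this
    calc w x * w z * ‖f x - f z‖ ^ 2 = w z * (w x * ‖f x - f z‖ ^ 2) := by ring
      _ = (w z * a) * ‖x - z‖ ^ 2 := by rw [this]; ring
      _ = _ := by rw [ha', one_mul]
  refine ⟨hstar, ?_⟩
  let b := stdOrthonormalBasis ℝ F
  have hcoord : ∀ i, ∃ (a : ℝ) (γ : F), ∀ x ∈ U,
      ⟪b i, w x • (f x - f z)⟫ = ⟪γ, x - z⟫ + a * ‖x - z‖ ^ 2 := by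
    intro i
    have : IsSphericalOn (fun x => ⟪b i, w x • (f x - f z)⟫) U := by
      refine ((hwv (b i)).add (hw.const_mul (-⟪b i, f z⟫))).congr fun x _ => ?_
      rw [inner_smul_right, inner_sub_right, real_inner_comm (f x)]
      ring
    obtain ⟨a, γ, h⟩ := this.exists_recenter hz
    refine ⟨a, γ, fun x hx => ?_⟩
    have := h x hx
    simpa using this
  choose a γ haγ using hcoord
  let L : F →ₗ[ℝ] F := ∑ i, ((innerSL ℝ (γ i)).toLinearMap).smulRight (b i)
  have hL : ∀ x ∈ U, w x • (f x - f z) = L (x - z) + ‖x - z‖ ^ 2 • ∑ i, a i • b i := by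
    intro x hx
    rw [← b.sum_repr (w x • (f x - f z)), Finset.smul_sum]
    simp only [L, LinearMap.sum_apply, LinearMap.smulRight_apply]
    rw [← Finset.sum_add_distrib]
    refine Finset.sum_congr rfl fun i _ => ?_
    rw [b.repr_apply_apply, haγ i x hx, smul_smul, ← add_smul]
    congr 1
    simp
    ring
  refine ⟨L, ∑ i, a i • b i, fun e => ?_, hL⟩
  have l1 : Tendsto (fun t : ℝ => ‖L e + t • ‖e‖ ^ 2 • ∑ i, a i • b i‖ ^ 2) (𝓝[≠] 0)
      (𝓝 (‖L e‖ ^ 2)) := by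
    have : Continuous (fun t : ℝ => ‖L e + t • ‖e‖ ^ 2 • ∑ i, a i • b i‖ ^ 2) := by fun_prop
    have h := this.tendsto 0
    simp only [zero_smul, add_zero] at h
    exact h.mono_left nhdsWithin_le_nhds
  have l2 : Tendsto (fun t : ℝ => w (z + t • e) / w z * ‖e‖ ^ 2) (𝓝[≠] 0)
      (𝓝 (w z / w z * ‖e‖ ^ 2)) := ((hwl e).div_const _).mul_const _
  have l3 := l1.congr' (f₂ := fun t : ℝ => w (z + t • e) / w z * ‖e‖ ^ 2) (by
    filter_upwards [hmem e, hne] with t ht ht0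
    have h1 := congrArg (fun y => ‖y‖ ^ 2) (hL _ ht)
    have h2 := hstar _ ht
    simp only [add_sub_cancel_left, map_smul, norm_smul, mul_pow, Real.norm_eq_abs, sq_abs] at h1 h2
    have h3 : t • L e + (t ^ 2 * ‖e‖ ^ 2) • ∑ i, a i • b i =
        t • (L e + t • ‖e‖ ^ 2 • ∑ i, a i • b i) := by
      rw [smul_add, smul_smul, smul_smul]
      congr 2
      ring
    rw [h3, norm_smul, mul_pow, Real.norm_eq_abs, sq_abs] at h1
    have ht2 : t ^ 2 ≠ 0 := pow_ne_zero 2 ht0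
    apply mul_left_cancel₀ ht2
    rw [← h1]
    field_simp
    rw [mul_assoc (w _) (t ^ 2), ← h2]
    ring)
  have := tendsto_nhds_unique l3 l2
  rw [div_self hz0.ne', one_mul] at this
  exact (sq_eq_sq₀ (norm_nonneg _) (norm_nonneg _)).1 this

/-- `f` distorts distances on `U` like a Möbius map with weight `w`. -/
structure IsMoebiusOn (f : F → F) (w : F → ℝ) (U : Set F) : Prop where
  pos : ∀ x ∈ U, 0 < w x
  norm_sub_sq : ∀ x ∈ U, ∀ z ∈ U, w x * w z * ‖f x - f z‖ ^ 2 = ‖x - z‖ ^ 2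
  exists_isometry : ∀ z ∈ U, ∃ (L : F →ₗ[ℝ] F) (β : F), (∀ h, ‖L h‖ = ‖h‖) ∧
    ∀ x ∈ U, w x • (f x - f z) = L (x - z) + ‖x - z‖ ^ 2 • β

variable [FiniteDimensional ℝ F]

/-- **Liouville's theorem** for injective `C¹` conformal maps, as a distance distortion formula. -/
theorem exists_weight_of_conformal [Nontrivial F] [MeasurableSpace F] [BorelSpace F]
    (hd : 3 ≤ Module.finrank ℝ F) {f : F → F} {U : Set F} (hU : IsOpen U) (hUc : IsPreconnected U)
    (hf : ContDiffOn ℝ 1 f U) (hinj : InjOn f U) (hconf : ∀ x ∈ U, ConformalAt f x) :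
    ∃ w : F → ℝ, IsMoebiusOn f w U := by
  let w : F → ℝ := fun x => ‖fderiv ℝ f x‖⁻¹
  have hc : ∀ x ∈ U, IsConformalMap (fderiv ℝ f x) := fun x hx =>
    conformalAt_iff_isConformalMap_fderiv.1 (hconf x hx)
  have hpos : ∀ x ∈ U, 0 < w x := fun x hx => inv_pos.2 (norm_pos_iff.2 (hc x hx).ne_zero)
  have hwc : ContinuousOn w U := ((hf.continuousOn_fderiv_of_isOpen hU le_rfl).norm).inv₀
    fun x hx => (norm_pos_iff.2 (hc x hx).ne_zero).ne'
  have hwf : ∀ c, IsSphericalOn (fun x => w x * ‖f x - c‖ ^ 2) U := by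
    intro c
    refine IsSphericalOn.of_locally hU hUc fun x hx => ?_
    obtain ⟨R, hR, hRU, h⟩ := exists_ball_weak_hessian_eq_zero hd hU hf hinj hconf hx
    refine ⟨R / 4, by positivity, isSphericalOn_of_weak_hessian (by omega) hR ?_ ?_⟩
    · exact ((hwc.mul (((hf.continuousOn.sub continuousOn_const).norm).pow 2))).mono hRU
    · intro u v hu hv huv ξ hξ hξc hξs
      simpa only [real_inner_self_eq_norm_sq] using h u v hu hv huv c ξ hξ hξc hξs
  have hw : IsSphericalOn w U := by
    obtain ⟨e, he⟩ := exists_norm_eq F zero_le_one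
    refine ((((hwf e).add (hwf (-e))).add ((hwf 0).const_mul (-2))).const_mul (1 / 2)).congr
      fun x _ => ?_
    rw [norm_sub_sq_real, norm_sub_sq_real, inner_neg_right, norm_neg, he, sub_zero]
    ring
  have hwv : ∀ v, IsSphericalOn (fun x => w x * ⟪f x, v⟫) U := by
    intro v
    refine (((hwf (-v)).add ((hwf v).const_mul (-1))).const_mul (1 / 4)).congr fun x _ => ?_
    rw [norm_sub_sq_real, norm_sub_sq_real, inner_neg_right, norm_neg]
    ring
  have key := fun z (hz : z ∈ U) => exists_isometry_of_spherical hU hpos hw hwf hwv hz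
    ((hconf z hz).differentiableAt.hasFDerivAt) (fun e => by
      have := (hc z hz).inner_map_map e e
      rw [real_inner_self_eq_norm_sq, real_inner_self_eq_norm_sq, ← mul_pow] at this
      rw [(sq_eq_sq₀ (norm_nonneg _) (by positivity)).1 this]
      exact inv_mul_cancel_left₀ (norm_pos_iff.2 (hc z hz).ne_zero).ne' _)
  exact ⟨w, hpos, fun x hx z hz => (key z hz).1 x hx, fun z hz => (key z hz).2⟩

end Spherical

section Hull

variable {F : Type*} [NormedAddCommGroup F] [InnerProductSpace ℝ F] [FiniteDimensional ℝ F]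

/-- A ball is contained in a compact convex set that reaches beyond it in every direction. -/
lemma closedBall_subset_of_forall_exists_le_inner [Nontrivial F] {S : Set F} (hS : IsCompact S) (hc : Convex ℝ S)
    {m : F} {c : ℝ} (h : ∀ v : F, ‖v‖ = 1 → ∃ p ∈ S, c ≤ ⟪p - m, v⟫) : closedBall m c ⊆ S := by
  intro y hy
  by_contra hyS
  obtain ⟨φ, a, ha, hay⟩ := geometric_hahn_banach_closed_point hc hS.isClosed hyS
  obtain ⟨u, rfl⟩ := (InnerProductSpace.toDual ℝ F).surjective φ
  simp only [InnerProductSpace.toDual_apply_apply] at ha hay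
  by_cases hu : u = 0
  · subst hu
    simp only [inner_zero_left] at ha hay
    obtain ⟨e, he⟩ := exists_norm_eq F zero_le_one
    obtain ⟨p, hp, -⟩ := h e he
    linarith [ha p hp]
  have hu0 : 0 < ‖u‖ := norm_pos_iff.2 hu
  obtain ⟨p, hp, hpc⟩ := h (‖u‖⁻¹ • u) (by rw [norm_smul, norm_inv, norm_norm, inv_mul_cancel₀ hu0.ne'])
  have h1 : ⟪y - m, ‖u‖⁻¹ • u⟫ ≤ c := by
    refine (real_inner_le_norm _ _).trans ?_
    rw [norm_smul, norm_inv, norm_norm, inv_mul_cancel₀ hu0.ne', mul_one, ← dist_eq_norm]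
    exact hy
  have h2 : ⟪y - m, ‖u‖⁻¹ • u⟫ ≤ ⟪p - m, ‖u‖⁻¹ • u⟫ := h1.trans hpc
  rw [inner_smul_right, inner_smul_right, inner_sub_left, inner_sub_left] at h2
  have h3 := le_of_mul_le_mul_left h2 (inv_pos.2 hu0)
  rw [real_inner_comm, real_inner_comm u p] at h3
  linarith [ha p hp]

/-- A set of diameter comparable to `r` and width at least `κ * r` in every direction has a ball of
radius comparable to `r` in its convex hull. -/
lemma exists_closedBall_subset_convexHull [Nontrivial F] {κ : ℝ} (hκ : 0 < κ) :
    ∃ c > 0, ∀ (S : Set F) (x : F) (r : ℝ), 0 < r → S ⊆ closedBall x r →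
      (∀ v : F, ‖v‖ = 1 → ∃ s ∈ S, ∃ s' ∈ S, κ * r ≤ ⟪s - s', v⟫) →
      ∃ y, closedBall y (c * r) ⊆ convexHull ℝ S := by
  obtain ⟨t, hts, htf, ht⟩ := (isCompact_sphere (0 : F) 1).finite_cover_balls
    (show 0 < κ / 4 by positivity)
  have : Fintype t := htf.fintype
  obtain ⟨e, he⟩ := exists_norm_eq F zero_le_one
  have hne : Nonempty t := by
    have := ht (mem_sphere_zero_iff_norm.2 he)
    simp only [mem_iUnion] at this
    obtain ⟨j, hj, -⟩ := this
    exact ⟨⟨j, hj⟩⟩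
  set N : ℝ := (Fintype.card t : ℝ) with hN
  have hN0 : 0 < N := by rw [hN]; exact_mod_cast Fintype.card_pos
  refine ⟨κ / (8 * N), by positivity, fun S x r hr hS hw => ?_⟩
  have hw' : ∀ j : t, ∃ s ∈ S, ∃ s' ∈ S, κ * r ≤ ⟪s - s', (j : F)⟫ := fun j =>
    hw j (mem_sphere_zero_iff_norm.1 (hts j.2))
  choose s hs s' hs' hss using hw'
  set m : F := (1 / (2 * N)) • ∑ j, (s j + s' j) with hm
  let T : Set F := range s ∪ range s'
  have hTS : T ⊆ S := by
    rintro _ (⟨j, rfl⟩ | ⟨j, rfl⟩)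
    exacts [hs j, hs' j]
  have hTf : T.Finite := (finite_range s).union (finite_range s')
  refine ⟨m, (closedBall_subset_of_forall_exists_le_inner (hTf.isCompact_convexHull (𝕜 := ℝ))
    (convex_convexHull ℝ T) fun v hv => ?_).trans (convexHull_mono hTS)⟩
  by_contra! hlt
  have hA : ∀ j, ⟪s j - m, v⟫ < κ / (8 * N) * r := fun j =>
    hlt _ (subset_convexHull ℝ T (Or.inl ⟨j, rfl⟩))
  have hB : ∀ j, ⟪s' j - m, v⟫ < κ / (8 * N) * r := fun j =>
    hlt _ (subset_convexHull ℝ T (Or.inr ⟨j, rfl⟩))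
  have hsum : ∑ j, (⟪s j - m, v⟫ + ⟪s' j - m, v⟫) = 0 := by
    have e1 : ∀ j, ⟪s j - m, v⟫ + ⟪s' j - m, v⟫ = ⟪s j + s' j, v⟫ - 2 * ⟪m, v⟫ := fun j => by
      rw [inner_sub_left, inner_sub_left, inner_add_left]; ring
    rw [Finset.sum_congr rfl fun j _ => e1 j, Finset.sum_sub_distrib, ← sum_inner, Finset.sum_const,
      Finset.card_univ, nsmul_eq_mul, ← hN]
    rw [hm, inner_smul_left]
    simp only [conj_trivial]
    field_simp
    ring
  obtain ⟨v₀, hv₀, hvv⟩ : ∃ v₀ ∈ t, v ∈ ball v₀ (κ / 4) := by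
    simpa using ht (mem_sphere_zero_iff_norm.2 hv)
  let j₀ : t := ⟨v₀, hv₀⟩
  have h1 : 2 * (κ / (8 * N) * r) - (⟪s j₀ - m, v⟫ + ⟪s' j₀ - m, v⟫) ≤ 2 * N * (κ / (8 * N) * r) := by
    have := Finset.single_le_sum (f := fun j => 2 * (κ / (8 * N) * r) -
      (⟪s j - m, v⟫ + ⟪s' j - m, v⟫)) (s := Finset.univ)
      (fun j _ => by have := hA j; have := hB j; show 0 ≤ _ - _; linarith) (Finset.mem_univ j₀)
    rw [Finset.sum_sub_distrib, hsum, Finset.sum_const, Finset.card_univ, nsmul_eq_mul, ← hN] at this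
    linarith
  have h2 : 2 * N * (κ / (8 * N) * r) = κ * r / 4 := by field_simp; norm_num
  have h3 : ⟪s j₀ - s' j₀, v⟫ = ⟪s j₀ - m, v⟫ - ⟪s' j₀ - m, v⟫ := by
    rw [← inner_sub_left]; congr 1; abel
  have h4 : ⟪s j₀ - s' j₀, v₀⟫ - ⟪s j₀ - s' j₀, v⟫ ≤ 2 * r * (κ / 4) := by
    rw [← inner_sub_right]
    refine (real_inner_le_norm _ _).trans (mul_le_mul ?_ ?_ (norm_nonneg _) (by positivity))
    · have h5 := hS (hs j₀)
      have h6 := hS (hs' j₀)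
      rw [mem_closedBall] at h5 h6
      rw [← dist_eq_norm]
      linarith [dist_triangle_right (s j₀) (s' j₀) x]
    · rw [mem_ball, dist_comm, dist_eq_norm] at hvv
      exact hvv.le
  have h7 : κ * r ≤ ⟪s j₀ - s' j₀, v₀⟫ := hss j₀
  have h8 := hA j₀
  have : 0 < κ * r := by positivity
  linarith

/-- A compact set in no affine hyperplane has width bounded below in every direction. -/
lemma exists_width_of_not_hyperplane {E : Set F} (hE : IsCompact E) (hne : E.Nonempty)
    (hhyp : ¬ ∃ (v : F) (c : ℝ), v ≠ 0 ∧ ∀ x ∈ E, ⟪x, v⟫ = c) :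
    ∃ c > 0, ∀ z ∈ E, ∀ u : F, ∃ x ∈ E, c * ‖u‖ ≤ |⟪x - z, u⟫| := by
  obtain ⟨e₀, he₀⟩ := hne
  have : CompactSpace E := isCompact_iff_compactSpace.1 hE
  let T : F →ₗ[ℝ] C(E, ℝ) :=
    { toFun := fun u => ⟨fun x => ⟪(x : F) - e₀, u⟫, by fun_prop⟩
      map_add' := fun u v => by ext x; simp [inner_add_right]
      map_smul' := fun c u => by ext x; simp [inner_smul_right] }
  have hT : LinearMap.ker T = ⊥ := by
    rw [LinearMap.ker_eq_bot']
    intro u hu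
    by_contra hu0
    refine hhyp ⟨u, ⟪e₀, u⟫, hu0, fun x hx => ?_⟩
    have := DFunLike.congr_fun hu (⟨x, hx⟩ : E)
    have h2 : ⟪x - e₀, u⟫ = 0 := this
    rw [inner_sub_left] at h2
    linarith
  obtain ⟨K, hK, hanti⟩ := T.exists_antilipschitzWith hT
  have hK' : (0 : ℝ) < K := hK
  refine ⟨1 / (4 * K), by positivity, fun z hz u => ?_⟩
  by_contra! h
  have h0 : u ≠ 0 := by
    rintro rfl
    have := h z hz
    simp at this
  have hu : 0 < ‖u‖ := norm_pos_iff.2 h0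
  have hle : ‖T u‖ ≤ 1 / (2 * K) * ‖u‖ := by
    rw [ContinuousMap.norm_le _ (by positivity)]
    intro x
    have h1 := h x x.2
    have h2 := h e₀ he₀
    have e : T u x = ⟪(x : F) - z, u⟫ - ⟪e₀ - z, u⟫ := by
      rw [← inner_sub_left]
      show ⟪(x : F) - e₀, u⟫ = _
      congr 1
      abel
    rw [e, Real.norm_eq_abs]
    refine (abs_sub _ _).trans ?_
    have : 1 / (2 * (K : ℝ)) * ‖u‖ = 1 / (4 * K) * ‖u‖ + 1 / (4 * K) * ‖u‖ := by ring
    linarith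
  have h3 := hanti.le_mul_dist u 0
  simp only [dist_zero_right, map_zero] at h3
  have h4 := mul_le_mul_of_nonneg_left hle hK'.le
  have h5 : (K : ℝ) * (1 / (2 * K) * ‖u‖) = ‖u‖ / 2 := by field_simp
  linarith

omit [FiniteDimensional ℝ F] in
/-- Two lines through points of a sphere that are neither close nor nearly antipodal do not both pass
near the same unit vector. -/
lemma exists_lower_bound_of_ne_of_ne_neg {p q : F} {ρ : ℝ} (hρ : 0 < ρ) (h1 : p ≠ q) (h2 : p ≠ -q) :
    ∃ ε > 0, ∃ κ > 0, ∀ a b : F, ‖a‖ = ρ → ‖b‖ = ρ → ‖a - p‖ ≤ ε → ‖b - q‖ ≤ ε →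
      ∀ v : F, ‖v‖ = 1 → ∀ s t : ℝ, κ ≤ ‖v - s • a‖ + ‖v - t • b‖ := by
  set μ := min ‖p - q‖ ‖p + q‖ with hμ
  have hμ0 : 0 < μ := lt_min (norm_pos_iff.2 (sub_ne_zero.2 h1))
    (norm_pos_iff.2 fun h => h2 (eq_neg_of_add_eq_zero_left h))
  refine ⟨μ / 4, by positivity, min (1 / 2) (μ / (8 * ρ)), by positivity, ?_⟩
  intro a b ha hb hap hbq v hv s t
  by_contra! hlt
  have k1 := lt_of_lt_of_le hlt (min_le_left _ _)
  have k2 := lt_of_lt_of_le hlt (min_le_right _ _)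
  have hsρ : 1 / 2 ≤ |s| * ρ := by
    have := norm_sub_norm_le v (s • a)
    rw [hv, norm_smul, ha, Real.norm_eq_abs] at this
    linarith [norm_nonneg (v - t • b)]
  have hst : ‖s • a - t • b‖ < μ / (8 * ρ) := by
    have e : s • a - t • b = (v - t • b) - (v - s • a) := by abel
    rw [e]
    exact (norm_sub_le _ _).trans_lt (by linarith)
  have habs : |(|s| - |t|)| * ρ < μ / (8 * ρ) := by
    have := abs_norm_sub_norm_le (s • a) (t • b)
    rw [norm_smul, norm_smul, ha, hb, ← sub_mul, abs_mul, abs_of_pos hρ, Real.norm_eq_abs,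
      Real.norm_eq_abs] at this
    linarith
  have key : ∃ σ : ℝ, |σ| = 1 ∧ |s - σ * t| = |(|s| - |t|)| := by
    rcases abs_cases s with ⟨hs, -⟩ | ⟨hs, -⟩ <;> rcases abs_cases t with ⟨ht, -⟩ | ⟨ht, -⟩ <;>
      rw [hs, ht]
    · exact ⟨1, by simp, by simp⟩
    · exact ⟨-1, by simp, by simp⟩
    · exact ⟨-1, by simp, by rw [← abs_neg]; congr 1; ring⟩
    · exact ⟨1, by simp, by rw [← abs_neg]; congr 1; ring⟩
  obtain ⟨σ, hσ, hσs⟩ := key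
  have hσσ : σ * σ = 1 := by rw [← abs_mul_abs_self, hσ, one_mul]
  have hab : |s| * ‖a - σ • b‖ < μ / (4 * ρ) := by
    have e : s • (a - σ • b) = (s • a - t • b) - (σ * (s - σ * t)) • b := by
      have : σ * (s - σ * t) = σ * s - t := by
        calc σ * (s - σ * t) = σ * s - σ * σ * t := by ring
          _ = _ := by rw [hσσ, one_mul]
      rw [this, smul_sub, sub_smul, smul_smul, mul_comm s σ]
      abel
    rw [← Real.norm_eq_abs, ← norm_smul, e]
    refine (norm_sub_le _ _).trans_lt ?_
    rw [norm_smul, Real.norm_eq_abs, abs_mul, hσ, one_mul, hσs, hb]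
    have : μ / (4 * ρ) = μ / (8 * ρ) + μ / (8 * ρ) := by field_simp; norm_num
    linarith
  have hab2 : ‖a - σ • b‖ < μ / 2 := by
    have h3 : 1 / 2 * ‖a - σ • b‖ ≤ |s| * ρ * ‖a - σ • b‖ :=
      mul_le_mul_of_nonneg_right hsρ (norm_nonneg _)
    have h4 := mul_lt_mul_of_pos_left hab hρ
    have h5 : ρ * (μ / (4 * ρ)) = μ / 4 := by field_simp
    linarith
  have hpq : μ ≤ ‖p - σ • q‖ := by
    rcases eq_or_eq_neg_of_abs_eq hσ with rfl | rfl
    · rw [one_smul]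
      exact min_le_left _ _
    · rw [neg_smul, one_smul, sub_neg_eq_add]
      exact min_le_right _ _
  have e : p - σ • q = (a - σ • b) - (a - p) + σ • (b - q) := by
    rw [smul_sub]; abel
  have h6 : ‖p - σ • q‖ ≤ ‖a - σ • b‖ + ‖a - p‖ + ‖b - q‖ := by
    rw [e]
    refine (norm_add_le _ _).trans (add_le_add (norm_sub_le _ _) ?_)
    rw [norm_smul, Real.norm_eq_abs, hσ, one_mul]
  linarith

end Hull

section MoebiusGeometry

variable {F : Type*} [NormedAddCommGroup F] [InnerProductSpace ℝ F] [FiniteDimensional ℝ F]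
  {f : F → F} {w : F → ℝ} {U : Set F}

namespace IsMoebiusOn

lemma weight_le (hf : IsMoebiusOn f w U) {z : F} (hz : z ∈ U) {δ : ℝ} (hδ : 0 < δ)
    (hδU : ball z δ ⊆ U) {x : F} (hx : x ∈ U) : w x ≤ (1 + ‖x - z‖ / δ) ^ 2 * w z := by
  obtain ⟨L, β, hL, h⟩ := hf.exists_isometry z hz
  let Li : F ≃ₗᵢ[ℝ] F := LinearIsometry.toLinearIsometryEquiv ⟨L, hL⟩ rfl
  have hLi : ∀ y, Li y = L y := fun y => rfl
  have hwz := hf.pos z hz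
  have hwx := hf.pos x hx
  have hβ : ‖β‖ ≤ 1 / δ := by
    by_contra! hlt
    have hβ0 : 0 < ‖β‖ := lt_trans (by positivity) hlt
    let k : F := Li.symm (-((‖β‖ ^ 2)⁻¹ • β))
    have hLk : L k = -((‖β‖ ^ 2)⁻¹ • β) := by rw [← hLi]; simp [k]
    have hk : ‖k‖ = ‖β‖⁻¹ := by
      rw [← hL k, hLk, norm_neg, norm_smul, norm_inv, norm_pow, norm_norm]
      field_simp
    have hkU : z + k ∈ U := hδU (by
      rw [mem_ball, dist_eq_norm, add_sub_cancel_left, hk]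
      rw [one_div] at hlt
      exact inv_lt_of_inv_lt₀ hδ hlt)
    have h1 := h _ hkU
    rw [add_sub_cancel_left, hLk, hk, inv_pow, neg_add_cancel, smul_eq_zero] at h1
    have h2 := hf.norm_sub_sq _ hkU z hz
    rw [h1.resolve_left (hf.pos _ hkU).ne', add_sub_cancel_left, hk, norm_zero] at h2
    have : 0 < ‖β‖⁻¹ ^ 2 := by positivity
    linarith
  by_cases hxz : x = z
  · subst hxz
    simp
  have hh : 0 < ‖x - z‖ := norm_pos_iff.2 (sub_ne_zero.2 hxz)
  have h1 := congrArg norm (h x hx)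
  rw [norm_smul, Real.norm_of_nonneg hwx.le] at h1
  have h2 : w x * ‖f x - f z‖ ≤ ‖x - z‖ * (1 + ‖x - z‖ / δ) := by
    rw [h1]
    refine (norm_add_le _ _).trans ?_
    rw [hL, norm_smul, norm_pow, norm_norm]
    have := mul_le_mul_of_nonneg_left hβ (sq_nonneg ‖x - z‖)
    have e : ‖x - z‖ * (1 + ‖x - z‖ / δ) = ‖x - z‖ + ‖x - z‖ ^ 2 * (1 / δ) := by field_simp
    linarith
  have h3 := pow_le_pow_left₀ (by positivity) h2 2
  have h4 := hf.norm_sub_sq x hx z hz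
  have h5 : w x * ‖x - z‖ ^ 2 ≤ (1 + ‖x - z‖ / δ) ^ 2 * w z * ‖x - z‖ ^ 2 := by
    calc w x * ‖x - z‖ ^ 2 = (w x * ‖f x - f z‖) ^ 2 * w z := by rw [← h4]; ring
      _ ≤ (‖x - z‖ * (1 + ‖x - z‖ / δ)) ^ 2 * w z := mul_le_mul_of_nonneg_right h3 hwz.le
      _ = _ := by ring
  exact le_of_mul_le_mul_right h5 (by positivity)

/-- A Möbius map preserving a subset `E` of a sphere maps it to a set that is wide in all directions
tangent to the sphere. -/
lemma exists_tangential_width (hf : IsMoebiusOn f w U) {E : Set F} (hEU : E ⊆ U)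
    (hfE : MapsTo f E E) {x₀ : F} {ρ : ℝ} (hρ : 0 < ρ) (hE : E ⊆ sphere x₀ ρ) {c : ℝ} (hc : 0 < c)
    (hw : ∀ z ∈ E, ∀ u : F, ∃ x ∈ E, c * ‖u‖ ≤ |⟪x - z, u⟫|) {z : F} (hz : z ∈ E) (v : F) :
    ∃ x ∈ E, ∃ s : ℝ, c * ‖v - s • (f z - x₀)‖ ≤ w x * |⟪f x - f z, v⟫| := by
  obtain ⟨L, β, hL, h⟩ := hf.exists_isometry z (hEU hz)
  let Li : F ≃ₗᵢ[ℝ] F := LinearIsometry.toLinearIsometryEquiv ⟨L, hL⟩ rfl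
  have hLi : ∀ y, Li y = L y := fun y => rfl
  have hadj : ∀ y u, ⟪L y, u⟫ = ⟪y, Li.symm u⟫ := fun y u => by
    rw [← hLi, ← Li.inner_map_map y (Li.symm u), Li.apply_symm_apply]
  have hnorm : ∀ y ∈ E, ‖y - x₀‖ = ρ := fun y hy => by
    rw [← dist_eq_norm]; exact hE hy
  have hsph : ∀ x ∈ E, ∀ y ∈ E, ‖x - y‖ ^ 2 = -2 * ⟪x - y, y - x₀⟫ := by
    intro x hx y hy
    have e : x - x₀ = (x - y) + (y - x₀) := by abel
    have h1 := norm_add_sq_real (x - y) (y - x₀)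
    rw [← e, hnorm x hx, hnorm y hy] at h1
    linarith
  set m := z - x₀ with hm
  set n := f z - x₀ with hn
  clear_value m n
  have hu : ∀ v, ∀ x ∈ E, w x * ⟪f x - f z, v⟫ = ⟪x - z, Li.symm v - (2 * ⟪β, v⟫) • m⟫ := by
    intro v x hx
    have h1 := congrArg (fun y => ⟪y, v⟫) (h x (hEU hx))
    rw [inner_smul_left, inner_add_left, inner_smul_left, hadj, hsph x hx z hz, ← hm] at h1
    rw [inner_sub_right, inner_smul_right]
    simp only [conj_trivial] at h1
    rw [h1]
    ring
  have hwz := hf.pos z (hEU hz)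
  have horth : w z • (Li.symm n - (2 * ⟪β, n⟫) • m) - m = 0 := by
    obtain ⟨x, hx, hxu⟩ := hw z hz (w z • (Li.symm n - (2 * ⟪β, n⟫) • m) - m)
    have h1 := hf.norm_sub_sq x (hEU hx) z (hEU hz)
    rw [hsph x hx z hz, hsph _ (hfE hx) _ (hfE hz), ← hm, ← hn] at h1
    have h2 := hu n x hx
    rw [inner_sub_right, inner_smul_right, ← h2] at hxu
    have h3 : w z * (w x * ⟪f x - f z, n⟫) - ⟪x - z, m⟫ = 0 := by linarith
    rw [h3, abs_zero] at hxu
    exact norm_le_zero_iff.1 (nonpos_of_mul_nonpos_right hxu hc)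
  have hκ : ∃ κ : ℝ, Li.symm n = κ • m := by
    refine ⟨(w z)⁻¹ + 2 * ⟪β, n⟫, ?_⟩
    have h1 := sub_eq_zero.1 horth
    have h2 : Li.symm n - (2 * ⟪β, n⟫) • m = (w z)⁻¹ • m := by
      nth_rewrite 2 [← h1]
      rw [smul_smul, inv_mul_cancel₀ hwz.ne', one_smul]
    rw [add_smul, ← h2]
    abel
  obtain ⟨κ, hκ⟩ := hκ
  have hκ0 : κ ≠ 0 := by
    rintro rfl
    rw [zero_smul] at hκ
    have h1 : ‖n‖ = 0 := by rw [← Li.symm.norm_map, hκ, norm_zero]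
    rw [hn, hnorm _ (hfE hz)] at h1
    exact hρ.ne' h1
  have hLm : L m = κ⁻¹ • n := by
    have h1 := congrArg Li hκ
    rw [Li.apply_symm_apply, map_smul, hLi] at h1
    rw [h1, smul_smul, inv_mul_cancel₀ hκ0, one_smul]
  obtain ⟨x, hx, hxu⟩ := hw z hz (Li.symm v - (2 * ⟪β, v⟫) • m)
  refine ⟨x, hx, 2 * ⟪β, v⟫ * κ⁻¹, ?_⟩
  have e : ‖Li.symm v - (2 * ⟪β, v⟫) • m‖ = ‖v - (2 * ⟪β, v⟫ * κ⁻¹) • n‖ := by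
    rw [← Li.norm_map, map_sub, Li.apply_symm_apply, map_smul, hLi, hLm, smul_smul]
  rw [e, ← hu v x hx, abs_mul, abs_of_pos (hf.pos x (hEU hx))] at hxu
  exact hxu

end IsMoebiusOn

end MoebiusGeometry

section Words

variable {α X : Type*} (φ : α → X → X)

lemma compWord_append (I J : List α) : compWord φ (I ++ J) = compWord φ I ∘ compWord φ J := by
  induction I with
  | nil => rfl
  | cons i I ih =>
    show φ i ∘ compWord φ (I ++ J) = (φ i ∘ compWord φ I) ∘ compWord φ J
    rw [ih]
    rfl

variable {φ}

lemma mapsTo_compWord {S : Set X} (h : ∀ i, MapsTo (φ i) S S) (I : List α) :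
    MapsTo (compWord φ I) S S := by
  induction I with
  | nil => exact mapsTo_id S
  | cons i I ih => exact (h i).comp ih

lemma injOn_compWord {S : Set X} (h : ∀ i, MapsTo (φ i) S S) (hinj : ∀ i, InjOn (φ i) S)
    (I : List α) : InjOn (compWord φ I) S := by
  induction I with
  | nil => exact injOn_id S
  | cons i I ih => exact (hinj i).comp ih (mapsTo_compWord h I)

lemma exists_mem_image_compWord {E : Set X} (hattr : E = ⋃ i, φ i '' E) (n : ℕ) :
    ∀ a ∈ E, ∃ I : List α, I.length = n ∧ a ∈ compWord φ I '' E := by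
  induction n with
  | zero => exact fun a ha => ⟨[], rfl, a, ha, rfl⟩
  | succ n ih =>
    intro a ha
    rw [hattr, mem_iUnion] at ha
    obtain ⟨i, y, hy, rfl⟩ := ha
    obtain ⟨I, hI, z, hz, rfl⟩ := ih y hy
    exact ⟨i :: I, by simp [hI], z, hz, rfl⟩

lemma exists_mem_image_compWord_append_singleton {E : Set X} (hattr : E = ⋃ i, φ i '' E)
    {K : List α} {a : X} (ha : a ∈ compWord φ K '' E) : ∃ i, a ∈ compWord φ (K ++ [i]) '' E := by
  obtain ⟨y, hy, rfl⟩ := ha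
  rw [hattr, mem_iUnion] at hy
  obtain ⟨i, z, hz, rfl⟩ := hy
  exact ⟨i, z, hz, by rw [compWord_append]; rfl⟩

lemma image_compWord_append_subset {E : Set X} (h : ∀ i, MapsTo (φ i) E E) (I J : List α) :
    compWord φ (I ++ J) '' E ⊆ compWord φ I '' E := by
  rw [compWord_append, image_comp]
  exact image_mono (mapsTo_compWord h J).image_subset

end Words

section WordsNormed

variable {α F : Type*} [NormedAddCommGroup F] {φ : α → F → F}

lemma dist_compWord_le {U : Set F} (h : ∀ i, MapsTo (φ i) U U) {c : ℝ} (hc : 0 ≤ c)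
    (hφ : ∀ i, ∀ x ∈ U, ∀ y ∈ U, dist (φ i x) (φ i y) ≤ c * dist x y) (I : List α) :
    ∀ x ∈ U, ∀ y ∈ U, dist (compWord φ I x) (compWord φ I y) ≤ c ^ I.length * dist x y := by
  induction I with
  | nil => intro x _ y _; simp [compWord]
  | cons i I ih =>
    intro x hx y hy
    refine (hφ i _ (mapsTo_compWord h I hx) _ (mapsTo_compWord h I hy)).trans ?_
    rw [List.length_cons, pow_succ', mul_assoc]
    exact mul_le_mul_of_nonneg_left (ih x hx y hy) hc

variable [NormedSpace ℝ F]

lemma contDiffOn_compWord {U : Set F} (h : ∀ i, MapsTo (φ i) U U)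
    (hφ : ∀ i, ContDiffOn ℝ 1 (φ i) U) (I : List α) : ContDiffOn ℝ 1 (compWord φ I) U := by
  induction I with
  | nil => exact contDiffOn_id
  | cons i I ih => exact (hφ i).comp ih (mapsTo_compWord h I)

lemma conformalAt_compWord {U : Set F} (h : ∀ i, MapsTo (φ i) U U)
    (hφ : ∀ i, ∀ x ∈ U, ConformalAt (φ i) x) (I : List α) : ∀ x ∈ U, ConformalAt (compWord φ I) x := by
  induction I with
  | nil => exact fun x _ => conformalAt_id x
  | cons i I ih => exact fun x hx => (hφ i _ (mapsTo_compWord h I hx)).comp x (ih x hx)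

end WordsNormed

section Scales

variable {α F : Type*} [NormedAddCommGroup F] [InnerProductSpace ℝ F]

/-- Uniform scales `h K` of the cylinders `φ_K(E)`: the maps `φ_K` are bi-Lipschitz on `E` at scale
`h K`, and `φ_K(E)` is wide at that scale in all directions tangent to the sphere about `x₀`. -/
structure IsScale (φ : α → F → F) (E : Set F) (x₀ : F) (h : List α → ℝ) (C c : ℝ) : Prop where
  pos : ∀ K, 0 < h K
  le : ∀ K, ∀ x ∈ E, ∀ y ∈ E, ‖compWord φ K x - compWord φ K y‖ ≤ C * h K * ‖x - y‖
  ge : ∀ K, ∀ x ∈ E, ∀ y ∈ E, h K * ‖x - y‖ ≤ C * ‖compWord φ K x - compWord φ K y‖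
  width : ∀ K, ∀ z ∈ E, ∀ v : F, ∃ x ∈ E, ∃ s : ℝ, c * h K * ‖v - s • (compWord φ K z - x₀)‖ ≤
    |⟪compWord φ K x - compWord φ K z, v⟫|

lemma exists_isScale [FiniteDimensional ℝ F] {φ : α → F → F} {E U : Set F} (hE : IsCompact E)
    (hne : E.Nonempty) (hU : IsOpen U) (hEU : E ⊆ U) (hφE : ∀ i, MapsTo (φ i) E E)
    {w : List α → F → ℝ} (hw : ∀ K, IsMoebiusOn (compWord φ K) (w K) U) {x₀ : F} {ρ : ℝ}
    (hρ : 0 < ρ) (hsph : E ⊆ sphere x₀ ρ)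
    (hhyp : ¬ ∃ (v : F) (c : ℝ), v ≠ 0 ∧ ∀ x ∈ E, ⟪x, v⟫ = c) :
    ∃ h : List α → ℝ, ∃ C > 0, ∃ c > 0, IsScale φ E x₀ h C c := by
  obtain ⟨c, hc, hcw⟩ := exists_width_of_not_hyperplane hE hne hhyp
  obtain ⟨e₀, he₀⟩ := hne
  obtain ⟨δ, hδ, hδU⟩ := hE.exists_thickening_subset_open hU hEU
  have hball : ∀ z ∈ E, ball z δ ⊆ U := fun z hz => (ball_subset_thickening hz δ).trans hδU
  obtain ⟨C, hC1, hC⟩ : ∃ C ≥ (1 : ℝ), ∀ K, ∀ x ∈ E, ∀ z ∈ E, w K x ≤ C * w K z := by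
    refine ⟨(1 + 2 * ρ / δ) ^ 2, one_le_pow₀ (by
      have : 0 < 2 * ρ / δ := by positivity
      linarith), fun K x hx z hz => ?_⟩
    refine ((hw K).weight_le (hEU hz) hδ (hball z hz) (hEU hx)).trans
      (mul_le_mul_of_nonneg_right ?_ ((hw K).pos z (hEU hz)).le)
    have : ‖x - z‖ ≤ 2 * ρ := by
      have h1 : dist x x₀ = ρ := hsph hx
      have h2 : dist z x₀ = ρ := hsph hz
      rw [← dist_eq_norm]
      linarith [dist_triangle_right x z x₀]
    gcongr
  have hC0 : 0 < C := by linarith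
  refine ⟨fun K => (w K e₀)⁻¹, C, hC0, c / C, by positivity, ?_⟩
  have hp : ∀ K, ∀ x ∈ E, 0 < w K x := fun K x hx => (hw K).pos x (hEU hx)
  refine ⟨fun K => inv_pos.2 (hp K e₀ he₀), ?_, ?_, ?_⟩
  · intro K x hx y hy
    have h0 := hp K e₀ he₀
    have h1 := (hw K).norm_sub_sq x (hEU hx) y (hEU hy)
    have hxx := hC K e₀ he₀ x hx
    have hyy := hC K e₀ he₀ y hy
    have h2 : w K e₀ * w K e₀ ≤ C * w K x * (C * w K y) :=
      mul_le_mul hxx hyy h0.le (mul_nonneg hC0.le (hp K x hx).le)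
    have h3 : (w K e₀ * ‖compWord φ K x - compWord φ K y‖) ^ 2 ≤ (C * ‖x - y‖) ^ 2 := by
      calc _ = w K e₀ * w K e₀ * ‖compWord φ K x - compWord φ K y‖ ^ 2 := by ring
        _ ≤ C * w K x * (C * w K y) * ‖compWord φ K x - compWord φ K y‖ ^ 2 :=
          mul_le_mul_of_nonneg_right h2 (sq_nonneg _)
        _ = _ := by rw [mul_pow, ← h1]; ring
    have h4 := le_of_sq_le_sq h3 (by positivity)
    have e : C * (w K e₀)⁻¹ * ‖x - y‖ = (C * ‖x - y‖) / w K e₀ := by field_simp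
    rw [e, le_div_iff₀ h0]
    linarith
  · intro K x hx y hy
    have h0 := hp K e₀ he₀
    have h1 := (hw K).norm_sub_sq x (hEU hx) y (hEU hy)
    have hxx := hC K x hx e₀ he₀
    have hyy := hC K y hy e₀ he₀
    have h2 : w K x * w K y ≤ C * w K e₀ * (C * w K e₀) :=
      mul_le_mul hxx hyy (hp K y hy).le (mul_nonneg hC0.le h0.le)
    have h3 : ‖x - y‖ ^ 2 ≤ (C * w K e₀ * ‖compWord φ K x - compWord φ K y‖) ^ 2 := by
      rw [← h1]
      refine (mul_le_mul_of_nonneg_right h2 (sq_nonneg _)).trans (le_of_eq ?_)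
      ring
    have h4 := le_of_sq_le_sq h3 (by positivity)
    rw [inv_mul_le_iff₀ h0]
    linarith
  · intro K z hz v
    have h0 := hp K e₀ he₀
    obtain ⟨x, hx, s, hs⟩ := (hw K).exists_tangential_width hEU (mapsTo_compWord hφE K) hρ hsph hc hcw
      hz v
    refine ⟨x, hx, s, ?_⟩
    have h1 := hs.trans (mul_le_mul_of_nonneg_right (hC K x hx e₀ he₀) (abs_nonneg _))
    have e : c / C * (w K e₀)⁻¹ * ‖v - s • (compWord φ K z - x₀)‖ =
      (c * ‖v - s • (compWord φ K z - x₀)‖) / (C * w K e₀) := by field_simp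
    rw [e, div_le_iff₀ (by positivity)]
    linarith

namespace IsScale

variable {φ : α → F → F} {E : Set F} {x₀ : F} {h : List α → ℝ} {C c : ℝ}

lemma exists_mul_le_append [Finite α] (hs : IsScale φ E x₀ h C c) (hC : 0 < C)
    (hφE : ∀ i, MapsTo (φ i) E E) (hE : E.Nontrivial) :
    ∃ c' > 0, ∀ K i, c' * h K ≤ h (K ++ [i]) := by
  obtain ⟨x, hx, y, hy, hxy⟩ := hE
  have hxy0 : 0 < ‖x - y‖ := norm_pos_iff.2 (sub_ne_zero.2 hxy)
  have key : ∀ K i, h [i] / C ^ 3 * h K ≤ h (K ++ [i]) := by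
    intro K i
    have h1 := hs.ge [i] x hx y hy
    have h2 := hs.ge K _ (mapsTo_compWord hφE [i] hx) _ (mapsTo_compWord hφE [i] hy)
    have h3 := hs.le (K ++ [i]) x hx y hy
    rw [compWord_append, Function.comp_apply, Function.comp_apply] at h3
    have hK := hs.pos K
    have h4 : h K * (h [i] * ‖x - y‖) ≤ C * (C * (C * h (K ++ [i]) * ‖x - y‖)) := by
      calc h K * (h [i] * ‖x - y‖) ≤ h K * (C * ‖compWord φ [i] x - compWord φ [i] y‖) :=
            mul_le_mul_of_nonneg_left h1 hK.le
        _ = C * (h K * ‖compWord φ [i] x - compWord φ [i] y‖) := by ring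
        _ ≤ C * (C * (C * h (K ++ [i]) * ‖x - y‖)) :=
            mul_le_mul_of_nonneg_left (h2.trans (mul_le_mul_of_nonneg_left h3 hC.le)) hC.le
    have h5 : h K * h [i] * ‖x - y‖ ≤ C ^ 3 * h (K ++ [i]) * ‖x - y‖ := by linarith
    have h6 := le_of_mul_le_mul_right h5 hxy0
    rw [div_mul_eq_mul_div, div_le_iff₀ (by positivity)]
    linarith
  cases isEmpty_or_nonempty α with
  | inl _ => exact ⟨1, one_pos, fun K i => isEmptyElim i⟩
  | inr _ =>
    obtain ⟨i₀, hi₀⟩ := Finite.exists_min fun i => h [i]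
    refine ⟨h [i₀] / C ^ 3, by have := hs.pos [i₀]; positivity, fun K i => ?_⟩
    refine le_trans (mul_le_mul_of_nonneg_right ?_ (hs.pos K).le) (key K i)
    have := hi₀ i
    gcongr

/-- Every point of a cylinder lies in a subcylinder of prescribed scale. -/
lemma exists_append_scale (hs : IsScale φ E x₀ h C c) (hC : 0 < C) (hattr : E = ⋃ i, φ i '' E)
    (hE : E.Nontrivial) {l : ℝ} (hl0 : 0 ≤ l) (hl1 : l < 1)
    (hl : ∀ K, ∀ x ∈ E, ∀ y ∈ E, dist (compWord φ K x) (compWord φ K y) ≤ l ^ K.length * dist x y)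
    {c' : ℝ} (hc' : 0 < c') (hap : ∀ K i, c' * h K ≤ h (K ++ [i])) {r : ℝ} (hr : 0 < r) {I : List α}
    (hI : r ≤ h I) {a : F} (ha : a ∈ compWord φ I '' E) :
    ∃ J, a ∈ compWord φ (I ++ J) '' E ∧ c' * r ≤ h (I ++ J) ∧ h (I ++ J) ≤ r := by
  obtain ⟨x, hx, y, hy, hxy⟩ := hE
  have hxy0 : 0 < ‖x - y‖ := norm_pos_iff.2 (sub_ne_zero.2 hxy)
  have hlen : ∀ K, h K ≤ C * l ^ K.length := by
    intro K
    have h1 := hs.ge K x hx y hy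
    have h2 := hl K x hx y hy
    rw [dist_eq_norm, dist_eq_norm] at h2
    have h3 := h1.trans (mul_le_mul_of_nonneg_left h2 hC.le)
    rw [← mul_assoc] at h3
    exact le_of_mul_le_mul_right h3 hxy0
  have key : ∀ n : ℕ, ∀ K, C * l ^ (K.length + n) < r → r ≤ h K → a ∈ compWord φ K '' E →
      ∃ J, a ∈ compWord φ (K ++ J) '' E ∧ c' * r ≤ h (K ++ J) ∧ h (K ++ J) ≤ r := by
    intro n
    induction n with
    | zero =>
      intro K h1 h2 _
      rw [add_zero] at h1
      linarith [hlen K]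
    | succ n ih =>
      intro K h1 h2 h3
      obtain ⟨i, hi⟩ := exists_mem_image_compWord_append_singleton hattr h3
      by_cases hle : h (K ++ [i]) ≤ r
      · exact ⟨[i], hi, (mul_le_mul_of_nonneg_left h2 hc'.le).trans (hap K i), hle⟩
      · obtain ⟨J, hJ⟩ := ih (K ++ [i]) (by
          rwa [List.length_append, List.length_singleton, add_assoc, add_comm 1 n])
          (not_le.1 hle).le hi
        exact ⟨[i] ++ J, by rwa [← List.append_assoc]⟩
  obtain ⟨n, hn⟩ := exists_pow_lt_of_lt_one (show 0 < r / C by positivity) hl1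
  refine key n I ?_ hI ha
  calc C * l ^ (I.length + n) ≤ C * l ^ n := mul_le_mul_of_nonneg_left
        (pow_le_pow_of_le_one hl0 hl1.le (by omega)) hC.le
    _ < C * (r / C) := mul_lt_mul_of_pos_left hn hC
    _ = r := by field_simp

end IsScale

end Scales

section Sums

variable {α F : Type*} [NormedAddCommGroup F] [InnerProductSpace ℝ F]

/-- A cylinder is wide in all tangential directions at all points and all bounded scales. -/
lemma IsScale.exists_width_at_scale {φ : α → F → F} {E : Set F} {x₀ : F} {h : List α → ℝ}
    {C c : ℝ} (hs : IsScale φ E x₀ h C c) (hC : 0 < C) (hc : 0 < c) (hattr : E = ⋃ i, φ i '' E)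
    (hφE : ∀ i, MapsTo (φ i) E E) (hE : E.Nontrivial) {l : ℝ} (hl0 : 0 ≤ l) (hl1 : l < 1)
    (hl : ∀ K, ∀ x ∈ E, ∀ y ∈ E, dist (compWord φ K x) (compWord φ K y) ≤ l ^ K.length * dist x y)
    {c' : ℝ} (hc' : 0 < c') (hap : ∀ K i, c' * h K ≤ h (K ++ [i])) {M : ℝ} (hM : 0 < M)
    (hEM : ∀ x ∈ E, ∀ y ∈ E, ‖x - y‖ ≤ M) (I : List α) {D : ℝ} (hD : 0 < D) :
    ∃ κ > 0, ∀ a ∈ compWord φ I '' E, ∀ r, 0 < r → r ≤ D → ∀ v : F,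
      ∃ p ∈ compWord φ I '' E, ‖p - a‖ ≤ r ∧
        ∃ s : ℝ, κ * r * ‖v - s • (a - x₀)‖ ≤ |⟪p - a, v⟫| := by
  have hI := hs.pos I
  obtain ⟨θ, hθ, hθ1, hθ2⟩ : ∃ θ > 0, θ ≤ 1 / (C * M) ∧ θ ≤ h I / D :=
    ⟨min (1 / (C * M)) (h I / D), by positivity, min_le_left _ _, min_le_right _ _⟩
  rw [le_div_iff₀ (by positivity)] at hθ1 hθ2
  refine ⟨c * (c' * θ), by positivity, fun a ha r hr hrD v => ?_⟩
  obtain ⟨J, haJ, hge, hle⟩ := hs.exists_append_scale hC hattr hE hl0 hl1 hl hc' hap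
    (show 0 < θ * r by positivity) (I := I)
    ((mul_le_mul_of_nonneg_left hrD hθ.le).trans hθ2) ha
  obtain ⟨z, hz, rfl⟩ := haJ
  obtain ⟨x, hx, s, hw⟩ := hs.width (I ++ J) z hz v
  refine ⟨_, image_compWord_append_subset hφE I J ⟨x, hx, rfl⟩, ?_, s, le_trans ?_ hw⟩
  · calc _ ≤ C * h (I ++ J) * ‖x - z‖ := hs.le _ x hx z hz
      _ ≤ C * (θ * r) * M := by
        gcongr
        exact hEM x hx z hz
      _ = θ * (C * M) * r := by ring
      _ ≤ 1 * r := by gcongr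
      _ = r := one_mul r
  · refine mul_le_mul_of_nonneg_right ?_ (norm_nonneg _)
    calc c * (c' * θ) * r = c * (c' * (θ * r)) := by ring
      _ ≤ c * h (I ++ J) := by gcongr

/-- If `A` is wide in directions tangent at its points, and likewise `B`, and tangent directions
jointly span, then `A + B` is wide in all directions. -/
lemma exists_width_add {A B : Set F} {x₀ : F} {κ κ' κ₀ D : ℝ} (hκ : 0 < κ) (hκ' : 0 < κ')
    (hκ₀ : 0 < κ₀)
    (hA : ∀ a ∈ A, ∀ r, 0 < r → r ≤ D → ∀ v : F, ∃ p ∈ A, ‖p - a‖ ≤ r ∧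
      ∃ s : ℝ, κ * r * ‖v - s • (a - x₀)‖ ≤ |⟪p - a, v⟫|)
    (hB : ∀ b ∈ B, ∀ r, 0 < r → r ≤ D → ∀ v : F, ∃ p ∈ B, ‖p - b‖ ≤ r ∧
      ∃ s : ℝ, κ' * r * ‖v - s • (b - x₀)‖ ≤ |⟪p - b, v⟫|)
    (hAB : ∀ a ∈ A, ∀ b ∈ B, ∀ v : F, ‖v‖ = 1 → ∀ s t : ℝ,
      κ₀ ≤ ‖v - s • (a - x₀)‖ + ‖v - t • (b - x₀)‖) :
    ∃ η > 0, ∀ x ∈ A + B, ∀ r, 0 < r → r ≤ D → ∀ v : F, ‖v‖ = 1 →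
      ∃ s ∈ closedBall x r ∩ (A + B), ∃ s' ∈ closedBall x r ∩ (A + B), η * r ≤ ⟪s - s', v⟫ := by
  refine ⟨min κ κ' * (κ₀ / 2), by positivity, ?_⟩
  rintro _ ⟨a, ha, b, hb, rfl⟩ r hr hrD v hv
  obtain ⟨p, hp, hpa, s, hs⟩ := hA a ha r hr hrD v
  obtain ⟨q, hq, hqb, t, ht⟩ := hB b hb r hr hrD v
  have hx : a + b ∈ closedBall (a + b) r ∩ (A + B) :=
    ⟨mem_closedBall_self hr.le, add_mem_add ha hb⟩
  have key : ∀ y ∈ closedBall (a + b) r ∩ (A + B),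
      min κ κ' * (κ₀ / 2) * r ≤ |⟪y - (a + b), v⟫| →
      ∃ s ∈ closedBall (a + b) r ∩ (A + B), ∃ s' ∈ closedBall (a + b) r ∩ (A + B),
        min κ κ' * (κ₀ / 2) * r ≤ ⟪s - s', v⟫ := by
    intro y hy hle
    rcases le_abs'.1 hle with h1 | h1
    · refine ⟨_, hx, y, hy, ?_⟩
      rw [← neg_sub, inner_neg_left]
      linarith
    · exact ⟨y, hy, _, hx, h1⟩
  have hsum := hAB a ha b hb v hv s t
  rcases le_or_gt (κ₀ / 2) ‖v - s • (a - x₀)‖ with h1 | h1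
  · have e : p + b - (a + b) = p - a := by abel
    refine key (p + b) ⟨?_, add_mem_add hp hb⟩ ?_
    · rwa [mem_closedBall, dist_eq_norm, e]
    · rw [e]
      refine le_trans ?_ hs
      calc min κ κ' * (κ₀ / 2) * r ≤ κ * ‖v - s • (a - x₀)‖ * r := by
            gcongr
            exact min_le_left _ _
        _ = _ := by ring
  · have e : a + q - (a + b) = q - b := by abel
    refine key (a + q) ⟨?_, add_mem_add ha hq⟩ ?_
    · rwa [mem_closedBall, dist_eq_norm, e]
    · rw [e]
      refine le_trans ?_ ht
      calc min κ κ' * (κ₀ / 2) * r ≤ κ' * ‖v - t • (b - x₀)‖ * r := by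
            gcongr
            · exact min_le_right _ _
            · linarith
        _ = _ := by ring

/-- A set on a sphere but on no hyperplane contains two points that are neither equal nor
antipodal. -/
lemma exists_mem_ne_ne_neg [FiniteDimensional ℝ F] (hF : 2 ≤ Module.finrank ℝ F) {E : Set F}
    {x₀ a : F} (hhyp : ¬ ∃ (v : F) (c : ℝ), v ≠ 0 ∧ ∀ x ∈ E, ⟪x, v⟫ = c) :
    ∃ b ∈ E, a - x₀ ≠ b - x₀ ∧ a - x₀ ≠ -(b - x₀) := by
  by_contra hcon
  push Not at hcon
  apply hhyp
  have hlt : Module.finrank ℝ (ℝ ∙ (a - x₀)) < Module.finrank ℝ F :=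
    ((finrank_span_le_card {a - x₀}).trans (by simp)).trans_lt (show 1 < _ by omega)
  obtain ⟨v, hv, hv0⟩ := Submodule.exists_mem_ne_zero_of_ne_bot
    (p := (ℝ ∙ (a - x₀))ᗮ) (by
      intro hbot
      rw [Submodule.orthogonal_eq_bot_iff] at hbot
      rw [hbot, finrank_top] at hlt
      exact lt_irrefl _ hlt)
  rw [Submodule.mem_orthogonal_singleton_iff_inner_right] at hv
  refine ⟨v, ⟪x₀, v⟫, hv0, fun x hx => ?_⟩
  have h1 : ⟪x - x₀, v⟫ = 0 := by
    by_cases h : a - x₀ = x - x₀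
    · rw [← h, hv]
    · rw [hcon x hx h, inner_neg_left, neg_eq_zero] at hv
      exact hv
  rwa [inner_sub_left, sub_eq_zero] at h1

end Sums

lemma thickness_pos_of_width {d : ℕ} [Nontrivial (EuclideanSpace ℝ (Fin d))]
    {S : Set (EuclideanSpace ℝ (Fin d))} {κ : ℝ} (hκ : 0 < κ)
    (h : ∀ x ∈ S, ∀ r, 0 < r → r ≤ diam S → ∀ v : EuclideanSpace ℝ (Fin d), ‖v‖ = 1 →
      ∃ s ∈ closedBall x r ∩ S, ∃ s' ∈ closedBall x r ∩ S, κ * r ≤ ⟪s - s', v⟫) :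
    0 < thickness S := by
  obtain ⟨c, hc, hcS⟩ := exists_closedBall_subset_convexHull
    (F := EuclideanSpace ℝ (Fin d)) hκ
  have hm : 0 < min c 1 := lt_min hc one_pos
  refine hm.trans_le (le_csSup ⟨1, fun t ht => ht.1.2⟩
    ⟨⟨hm.le, min_le_right _ _⟩, fun x hx r hr hrS => ?_⟩)
  obtain ⟨y, hy⟩ := hcS (closedBall x r ∩ S) x r hr inter_subset_left (h x hx r hr hrS)
  exact ⟨y, (closedBall_subset_closedBall
    (mul_le_mul_of_nonneg_right (min_le_left _ _) hr.le)).trans hy⟩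

/-- Let `d ≥ 3` and let `E` (not a singleton) be the self-conformal set generated by a
conformal IFS on a compact `X ⊆ ℝ^d`. If `E` lies on a `(d−1)`-dimensional sphere but in
no affine hyperplane, then there are finite words `I, J` such that the Minkowski sum
`φ_I(E) + φ_J(E)` has positive thickness. -/
theorem selfConformal_on_sphere_sum_positive_thickness {d ℓ : ℕ} (hd : 3 ≤ d) (hl : 0 < ℓ)
    (X U : Set (EuclideanSpace ℝ (Fin d)))
    (hX : IsCompact X) (hU : IsOpen U) (hUconn : IsConnected U)
    (hUbdd : Bornology.IsBounded U) (hXU : X ⊆ U)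
    (φ : Fin ℓ → EuclideanSpace ℝ (Fin d) → EuclideanSpace ℝ (Fin d))
    (hmapsX : ∀ i, Set.MapsTo (φ i) X X)
    (hmapsU : ∀ i, φ i '' U ⊆ U)
    (hinj : ∀ i, Set.InjOn (φ i) U)
    (hcontr : ∀ i, ∃ c : ℝ, 0 < c ∧ c < 1 ∧
      ∀ x ∈ U, ∀ y ∈ U, dist (φ i x) (φ i y) ≤ c * dist x y)
    (hC1 : ∀ i, ContDiffOn ℝ 1 (φ i) U)
    (hconf : ∀ i, ∀ x ∈ U, ConformalAt (φ i) x)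
    (E : Set (EuclideanSpace ℝ (Fin d))) (hne : E.Nonempty) (hcomp : IsCompact E)
    (hEX : E ⊆ X) (hattr : E = ⋃ i, φ i '' E)
    (hnotsingleton : ¬ ∃ x, E = {x})
    (hsphere : ∃ (x₀ : EuclideanSpace ℝ (Fin d)) (ρ : ℝ), 0 < ρ ∧
      E ⊆ Metric.sphere x₀ ρ)
    (hhyp : ¬ ∃ (v : EuclideanSpace ℝ (Fin d)) (c : ℝ), v ≠ 0 ∧ ∀ x ∈ E, ⟪x, v⟫ = c) :
    ∃ I J : List (Fin ℓ),
      0 < thickness (compWord φ I '' E + compWord φ J '' E) := by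
  obtain ⟨x₀, ρ, hρ, hsph⟩ := hsphere
  have : NeZero d := ⟨by omega⟩
  have : NeZero ℓ := ⟨hl.ne'⟩
  have hfin : Module.finrank ℝ (EuclideanSpace ℝ (Fin d)) = d := finrank_euclideanSpace_fin
  have hnt : Nontrivial (EuclideanSpace ℝ (Fin d)) :=
    Module.nontrivial_of_finrank_pos (R := ℝ) (by omega)
  have hEU : E ⊆ U := hEX.trans hXU
  have hφU : ∀ i, MapsTo (φ i) U U := fun i => mapsTo_iff_image_subset.2 (hmapsU i)
  have hφE : ∀ i, MapsTo (φ i) E E := fun i x hx => by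
    rw [hattr]
    exact mem_iUnion.2 ⟨i, x, hx, rfl⟩
  have hEnt : E.Nontrivial := by
    obtain ⟨x, hx⟩ := hne
    by_contra hcon
    exact hnotsingleton ⟨x, (not_nontrivial_iff.1 hcon).eq_singleton_of_mem hx⟩
  choose cs hcs0 hcs1 hcs using hcontr
  obtain ⟨i₀, hi₀⟩ := Finite.exists_max cs
  have hlip := dist_compWord_le hφU (hcs0 i₀).le fun i x hx y hy =>
    (hcs i x hx y hy).trans (mul_le_mul_of_nonneg_right (hi₀ i) dist_nonneg)
  have hlipE : ∀ K, ∀ x ∈ E, ∀ y ∈ E,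
      dist (compWord φ K x) (compWord φ K y) ≤ cs i₀ ^ K.length * dist x y :=
    fun K x hx y hy => hlip K x (hEU hx) y (hEU hy)
  choose w hw using fun K => exists_weight_of_conformal (by rwa [hfin]) hU
    hUconn.isPreconnected (contDiffOn_compWord hφU hC1 K) (injOn_compWord hφU hinj K)
    (conformalAt_compWord hφU hconf K)
  obtain ⟨h, C, hC, c, hc, hs⟩ := exists_isScale hcomp hne hU hEU hφE hw hρ hsph hhyp
  obtain ⟨c', hc', hap⟩ := hs.exists_mul_le_append hC hφE hEnt
  have hdiam : ∀ x ∈ E, ∀ y ∈ E, ‖x - y‖ ≤ 2 * ρ := fun x hx y hy => by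
    have h1 : dist x x₀ = ρ := hsph hx
    have h2 : dist y x₀ = ρ := hsph hy
    rw [← dist_eq_norm]
    linarith [dist_triangle_right x y x₀]
  obtain ⟨a, ha⟩ := hne
  obtain ⟨b, hb, hab, hab'⟩ := exists_mem_ne_ne_neg (x₀ := x₀) (a := a) (by omega) hhyp
  obtain ⟨ε, hε, κ₀, hκ₀, hlow⟩ := exists_lower_bound_of_ne_of_ne_neg hρ hab hab'
  obtain ⟨n, hn⟩ := exists_pow_lt_of_lt_one (show 0 < ε / (2 * ρ) by positivity) (hcs1 i₀)
  have hsmall : ∀ I : List (Fin ℓ), I.length = n → ∀ p ∈ compWord φ I '' E,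
      ∀ q ∈ compWord φ I '' E, ‖p - q‖ ≤ ε := by
    rintro I hI _ ⟨x, hx, rfl⟩ _ ⟨y, hy, rfl⟩
    have h1 := hlipE I x hx y hy
    rw [hI, dist_eq_norm, dist_eq_norm] at h1
    refine h1.trans ?_
    calc _ ≤ ε / (2 * ρ) * (2 * ρ) := by
          gcongr
          exact hdiam x hx y hy
      _ = ε := by field_simp
  obtain ⟨I, hI, haI⟩ := exists_mem_image_compWord hattr n a ha
  obtain ⟨J, hJ, hbJ⟩ := exists_mem_image_compWord hattr n b hb
  have hsub : ∀ K, compWord φ K '' E ⊆ E := fun K => (mapsTo_compWord hφE K).image_subset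
  have hD : 0 < diam (compWord φ I '' E + compWord φ J '' E) + 1 := by
    have := diam_nonneg (s := compWord φ I '' E + compWord φ J '' E)
    positivity
  have hρ2 : 0 < 2 * ρ := by positivity
  obtain ⟨κ, hκ, hA⟩ := hs.exists_width_at_scale hC hc hattr hφE hEnt (hcs0 i₀).le (hcs1 i₀) hlipE
    hc' hap hρ2 hdiam I hD
  obtain ⟨κ', hκ', hB⟩ := hs.exists_width_at_scale hC hc hattr hφE hEnt (hcs0 i₀).le (hcs1 i₀) hlipE
    hc' hap hρ2 hdiam J hD
  obtain ⟨η, hη, hAB⟩ := exists_width_add hκ hκ' hκ₀ hA hB fun p hp q hq v hv s t => by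
    refine hlow _ _ (mem_sphere_iff_norm.1 (hsph (hsub I hp)))
      (mem_sphere_iff_norm.1 (hsph (hsub J hq))) ?_ ?_ v hv s t
    · rw [sub_sub_sub_cancel_right]
      exact hsmall I hI p hp a haI
    · rw [sub_sub_sub_cancel_right]
      exact hsmall J hJ q hq b hbJ
  exact ⟨I, J, thickness_pos_of_width hη fun x hx r hr hrS => hAB x hx r hr (by linarith)⟩
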